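/- Let D₁ ⊆ B(H₁) and D₂ ⊆ B(H₂) be masas on separable Hilbert spaces, let V ⊆ B(H₁,H₂) be a weak* closed masa-bimodule, let B ⊆ B(H₁,H₂) be a masa-bimodule of finite width, and let U ⊆ B(K₁,K₂) be a weak* closed subspace. If F(V,U) = V ⊗̄ U, then F(cl(V + B), U) = cl(V + B) ⊗̄ U, where cl denotes weak* closure. In particular, if V possesses property S_σ, then the weak* closure of V + B possesses property S_σ. -/

import Mathlib

open scoped ComplexInnerProductSpace Pointwise
open Set MeasureTheory

noncomputable section

namespace OpSynth

/-! ### The σ-weak (weak*) topology on `B(H,K)` -/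

/-- The σ-weak (weak*) topology on the space of bounded operators between Hilbert
spaces: the initial topology with respect to the functionals
`T ↦ ∑' n, ⟪η n, T (ξ n)⟫` associated to square-summable sequences `ξ`, `η`.
This is the weak* topology arising from the identification of `B(H,K)` with the
dual of the trace class operators. -/
def sigmaWeak (H K : Type*) [NormedAddCommGroup H] [InnerProductSpace ℂ H]
    [NormedAddCommGroup K] [InnerProductSpace ℂ K] :
    TopologicalSpace (H →L[ℂ] K) :=
  ⨅ (ξ : ℕ → H) (η : ℕ → K) (_ : Summable fun n => ‖ξ n‖ ^ 2)
    (_ : Summable fun n => ‖η n‖ ^ 2),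
    TopologicalSpace.induced
      (fun T : H →L[ℂ] K => ∑' n, ⟪η n, T (ξ n)⟫) inferInstance

section Basic

variable {H K H₁ H₂ H₃ K₁ K₂ T₁ T₂ : Type*}
  [NormedAddCommGroup H] [InnerProductSpace ℂ H]
  [NormedAddCommGroup K] [InnerProductSpace ℂ K]
  [NormedAddCommGroup H₁] [InnerProductSpace ℂ H₁]
  [NormedAddCommGroup H₂] [InnerProductSpace ℂ H₂]
  [NormedAddCommGroup H₃] [InnerProductSpace ℂ H₃]
  [NormedAddCommGroup K₁] [InnerProductSpace ℂ K₁]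
  [NormedAddCommGroup K₂] [InnerProductSpace ℂ K₂]
  [NormedAddCommGroup T₁] [InnerProductSpace ℂ T₁]
  [NormedAddCommGroup T₂] [InnerProductSpace ℂ T₂]

/-- A set of operators is weak* closed if it is closed in the σ-weak topology. -/
def WkClosed (S : Set (H →L[ℂ] K)) : Prop :=
  @IsClosed _ (sigmaWeak H K) S

/-- The weak* closure of a set of operators. -/
def wkClosure (S : Set (H →L[ℂ] K)) : Set (H →L[ℂ] K) :=
  @closure _ (sigmaWeak H K) S

/-- A weak* closed (linear) subspace of `B(H,K)`. -/
def IsWkClosedSubspace (S : Set (H →L[ℂ] K)) : Prop :=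
  (∃ M : Submodule ℂ (H →L[ℂ] K), (M : Set (H →L[ℂ] K)) = S) ∧ WkClosed S

/-- A map between operator spaces is weak* continuous if it is continuous with
respect to the σ-weak topologies. -/
def WkContinuous (φ : (H₁ →L[ℂ] H₂) → (K₁ →L[ℂ] K₂)) : Prop :=
  @Continuous _ _ (sigmaWeak H₁ H₂) (sigmaWeak K₁ K₂) φ

/-- The norm of an `n × n` matrix of operators, viewed as an operator on the
column Hilbert space `ℓ²(Fin n, H)`: the supremum over the unit ball of the
ℓ²-norm of the image. -/
def blockNorm {n : ℕ} (M : Matrix (Fin n) (Fin n) (H →L[ℂ] K)) : ℝ :=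
  sSup { r | ∃ v : Fin n → H, (∑ j, ‖v j‖ ^ 2) ≤ 1 ∧
    r = Real.sqrt (∑ i, ‖∑ j, M i j (v j)‖ ^ 2) }

/-- A map `φ : B(H₁,H₂) → B(K₁,K₂)` is completely bounded if its matrix
amplifications are uniformly bounded. -/
def CompletelyBounded (φ : (H₁ →L[ℂ] H₂) → (K₁ →L[ℂ] K₂)) : Prop :=
  ∃ C : ℝ, 0 ≤ C ∧ ∀ (n : ℕ) (M : Matrix (Fin n) (Fin n) (H₁ →L[ℂ] H₂)),
    blockNorm (M.map φ) ≤ C * blockNorm M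

/-- `t : H → K → T₁` realizes `T₁` as the Hilbertian tensor product `H ⊗ K`:
`t` is bilinear, multiplicative for inner products, and has total range. -/
def IsTensorEmbedding (t : H → K → T₁) : Prop :=
  (∀ x x' y, t (x + x') y = t x y + t x' y) ∧
  (∀ x y y', t x (y + y') = t x y + t x y') ∧
  (∀ (c : ℂ) x y, t (c • x) y = c • t x y) ∧
  (∀ (c : ℂ) x y, t x (c • y) = c • t x y) ∧
  (∀ x x' y y', ⟪t x y, t x' y'⟫ = ⟪x, x'⟫ * ⟪y, y'⟫) ∧
  (Submodule.span ℂ { z | ∃ x y, z = t x y }).topologicalClosure = ⊤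

/-- `W` is the elementary tensor `S ⊗ R` of the operators `S` and `R`, relative
to the tensor product realizations `t₁`, `t₂`. -/
def IsElemTensor (t₁ : H₁ → K₁ → T₁) (t₂ : H₂ → K₂ → T₂)
    (W : T₁ →L[ℂ] T₂) (S : H₁ →L[ℂ] H₂) (R : K₁ →L[ℂ] K₂) : Prop :=
  ∀ x y, W (t₁ x y) = t₂ (S x) (R y)

/-- The weak* closed tensor product `V ⊗̄ U`: the weak* closed subspace generated
by the elementary tensors `S ⊗ R` with `S ∈ V`, `R ∈ U`. -/
def wTensor (t₁ : H₁ → K₁ → T₁) (t₂ : H₂ → K₂ → T₂)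
    (V : Set (H₁ →L[ℂ] H₂)) (U : Set (K₁ →L[ℂ] K₂)) : Set (T₁ →L[ℂ] T₂) :=
  wkClosure ↑(Submodule.span ℂ
    { W : T₁ →L[ℂ] T₂ | ∃ S ∈ V, ∃ R ∈ U, IsElemTensor t₁ t₂ W S R })

/-- The Fubini product `F(V,U) = (V ⊗̄ B(K₁,K₂)) ∩ (B(H₁,H₂) ⊗̄ U)`. -/
def Fubini (t₁ : H₁ → K₁ → T₁) (t₂ : H₂ → K₂ → T₂)
    (V : Set (H₁ →L[ℂ] H₂)) (U : Set (K₁ →L[ℂ] K₂)) : Set (T₁ →L[ℂ] T₂) :=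
  wTensor t₁ t₂ V univ ∩ wTensor t₁ t₂ univ U

/-- Sum of finitely many subsets of an additive monoid. -/
def setSum {α : Type*} [AddCommMonoid α] {n : ℕ} (S : Fin n → Set α) : Set α :=
  { x | ∃ f : Fin n → α, (∀ i, f i ∈ S i) ∧ x = ∑ i, f i }

/-- The reflexive hull `Ref W = {T : Tx ∈ closure (W x) for all x}`. -/
def RefHull (W : Set (H →L[ℂ] K)) : Set (H →L[ℂ] K) :=
  { T | ∀ x : H, T x ∈ closure ((fun S : H →L[ℂ] K => S x) '' W) }

end Basic

/-- Property `S_σ`: `F(V,U) = V ⊗̄ U` for every weak* closed subspace `U` of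
`B(K₁,K₂)`, all Hilbert spaces `K₁`, `K₂`, and all realizations of the
corresponding Hilbertian tensor products. -/
def HasSsigma {H₁ H₂ : Type*}
    [NormedAddCommGroup H₁] [InnerProductSpace ℂ H₁]
    [NormedAddCommGroup H₂] [InnerProductSpace ℂ H₂]
    (V : Set (H₁ →L[ℂ] H₂)) : Prop :=
  ∀ (K₁ K₂ T₁ T₂ : Type)
    [NormedAddCommGroup K₁] [InnerProductSpace ℂ K₁] [CompleteSpace K₁]
    [NormedAddCommGroup K₂] [InnerProductSpace ℂ K₂] [CompleteSpace K₂]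
    [NormedAddCommGroup T₁] [InnerProductSpace ℂ T₁] [CompleteSpace T₁]
    [NormedAddCommGroup T₂] [InnerProductSpace ℂ T₂] [CompleteSpace T₂]
    (t₁ : H₁ → K₁ → T₁) (t₂ : H₂ → K₂ → T₂),
    IsTensorEmbedding t₁ → IsTensorEmbedding t₂ →
    ∀ U : Set (K₁ →L[ℂ] K₂), IsWkClosedSubspace U →
      Fubini t₁ t₂ V U = wTensor t₁ t₂ V U

section Masa

variable {H H₁ H₂ H₃ : Type*}
  [NormedAddCommGroup H] [InnerProductSpace ℂ H] [CompleteSpace H]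
  [NormedAddCommGroup H₁] [InnerProductSpace ℂ H₁] [CompleteSpace H₁]
  [NormedAddCommGroup H₂] [InnerProductSpace ℂ H₂] [CompleteSpace H₂]
  [NormedAddCommGroup H₃] [InnerProductSpace ℂ H₃] [CompleteSpace H₃]

/-- A masa: a maximal abelian selfadjoint subalgebra of `B(H)`. -/
def IsMasa (D : StarSubalgebra ℂ (H →L[ℂ] H)) : Prop :=
  (∀ a ∈ D, ∀ b ∈ D, a * b = b * a) ∧
  ∀ E : StarSubalgebra ℂ (H →L[ℂ] H),
    (∀ a ∈ E, ∀ b ∈ E, a * b = b * a) → D ≤ E → E = D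

/-- A (weak* closed) `D₂,D₁`-masa-bimodule. -/
def IsMasaBimodule (D₁ : StarSubalgebra ℂ (H₁ →L[ℂ] H₁))
    (D₂ : StarSubalgebra ℂ (H₂ →L[ℂ] H₂)) (V : Set (H₁ →L[ℂ] H₂)) : Prop :=
  IsWkClosedSubspace V ∧
  ∀ X ∈ V, ∀ A ∈ D₁, ∀ B ∈ D₂, B ∘L X ∘L A ∈ V

/-- A ternary set of operators: closed under the triple product `T S* R`. -/
def IsTernary (M : Set (H₁ →L[ℂ] H₂)) : Prop :=
  ∀ T ∈ M, ∀ S ∈ M, ∀ R ∈ M, T ∘L (ContinuousLinearMap.adjoint S) ∘L R ∈ M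

/-- An orthogonal projection. -/
def IsProj (p : H →L[ℂ] H) : Prop := p ∘L p = p ∧ IsSelfAdjoint p

/-- A minimal non-zero projection of a masa. -/
def IsMinimalProjOf (D : StarSubalgebra ℂ (H →L[ℂ] H)) (p : H →L[ℂ] H) : Prop :=
  p ∈ D ∧ IsProj p ∧ p ≠ 0 ∧
    ∀ q ∈ D, IsProj q → p ∘L q = q → q = 0 ∨ q = p

/-- A projection in a masa is non-atomic if it dominates no minimal non-zero
projection of the masa. -/
def IsNonAtomicProj (D : StarSubalgebra ℂ (H →L[ℂ] H)) (E : H →L[ℂ] H) : Prop :=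
  ∀ p, IsMinimalProjOf D p → ¬ (E ∘L p = p)

/-- A `D₂,D₁`-masa-bimodule map. -/
def IsMasaBimoduleMap (D₁ : StarSubalgebra ℂ (H₁ →L[ℂ] H₁))
    (D₂ : StarSubalgebra ℂ (H₂ →L[ℂ] H₂))
    (φ : (H₁ →L[ℂ] H₂) → (H₁ →L[ℂ] H₂)) : Prop :=
  ∀ (X : H₁ →L[ℂ] H₂), ∀ A ∈ D₁, ∀ B ∈ D₂,
    φ (B ∘L X ∘L A) = B ∘L (φ X) ∘L A

/-- A Schur idempotent: a weak* continuous completely bounded idempotent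
masa-bimodule map. -/
def IsSchurIdempotent (D₁ : StarSubalgebra ℂ (H₁ →L[ℂ] H₁))
    (D₂ : StarSubalgebra ℂ (H₂ →L[ℂ] H₂))
    (φ : (H₁ →L[ℂ] H₂) → (H₁ →L[ℂ] H₂)) : Prop :=
  IsLinearMap ℂ φ ∧ WkContinuous φ ∧ CompletelyBounded φ ∧ φ ∘ φ = φ ∧
    IsMasaBimoduleMap D₁ D₂ φ

/-- A nest: a totally ordered family of closed subspaces containing the
intersection and the closed linear span of any of its subsets. -/
def IsNest (N : Set (Submodule ℂ H)) : Prop :=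
  (∀ p ∈ N, IsClosed (p : Set H)) ∧ IsChain (· ≤ ·) N ∧
  ∀ S : Set (Submodule ℂ H), S ⊆ N →
    sInf S ∈ N ∧ (sSup S).topologicalClosure ∈ N

/-- The nest algebra of a nest: all operators leaving each subspace invariant. -/
def nestAlg (N : Set (Submodule ℂ H)) : Set (H →L[ℂ] H) :=
  { T | ∀ p ∈ N, ∀ x ∈ p, T x ∈ p }

/-- A (weak* closed) nest algebra bimodule. -/
def IsNestBimodule (V : Set (H₁ →L[ℂ] H₂)) : Prop :=
  IsWkClosedSubspace V ∧
  ∃ (N₁ : Set (Submodule ℂ H₁)) (N₂ : Set (Submodule ℂ H₂)),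
    IsNest N₁ ∧ IsNest N₂ ∧
    ∀ X ∈ V, ∀ A ∈ nestAlg N₁, ∀ B ∈ nestAlg N₂, B ∘L X ∘L A ∈ V

/-- A masa-bimodule of finite width: a finite intersection of masa-bimodules
each of which is a nest algebra bimodule. -/
def HasFiniteWidth (D₁ : StarSubalgebra ℂ (H₁ →L[ℂ] H₁))
    (D₂ : StarSubalgebra ℂ (H₂ →L[ℂ] H₂)) (V : Set (H₁ →L[ℂ] H₂)) : Prop :=
  ∃ (k : ℕ) (Vs : Fin k → Set (H₁ →L[ℂ] H₂)),
    (∀ j, IsMasaBimodule D₁ D₂ (Vs j) ∧ IsNestBimodule (Vs j)) ∧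
    V = ⋂ j, Vs j

end Masa

section Algebras

variable {H H₁ H₂ H₃ K : Type*}
  [NormedAddCommGroup H] [InnerProductSpace ℂ H] [CompleteSpace H]
  [NormedAddCommGroup H₁] [InnerProductSpace ℂ H₁] [CompleteSpace H₁]
  [NormedAddCommGroup H₂] [InnerProductSpace ℂ H₂] [CompleteSpace H₂]
  [NormedAddCommGroup H₃] [InnerProductSpace ℂ H₃] [CompleteSpace H₃]

/-- A weak* closed unital operator algebra in `B(H)`. -/
def IsWkClosedUnitalAlg (A : Set (H →L[ℂ] H)) : Prop :=
  IsWkClosedSubspace A ∧ (1 : H →L[ℂ] H) ∈ A ∧ ∀ a ∈ A, ∀ b ∈ A, a ∘L b ∈ A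

/-- `[X Y]`: the weak* closed linear span of the products `x ∘ y`. -/
def mulSpan (X : Set (H₂ →L[ℂ] H₃)) (Y : Set (H₁ →L[ℂ] H₂)) :
    Set (H₁ →L[ℂ] H₃) :=
  wkClosure ↑(Submodule.span ℂ { T : H₁ →L[ℂ] H₃ | ∃ x ∈ X, ∃ y ∈ Y, T = x ∘L y })

/-- The data witnessing a spatial embedding of `A` into `B`. -/
def SpatialPair (A : Set (H₁ →L[ℂ] H₁)) (B : Set (H₂ →L[ℂ] H₂))
    (X : Set (H₁ →L[ℂ] H₂)) (Y : Set (H₂ →L[ℂ] H₁)) : Prop :=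
  IsWkClosedSubspace X ∧ IsWkClosedSubspace Y ∧
  (∀ x ∈ X, ∀ b ∈ B, ∀ a ∈ A, b ∘L x ∘L a ∈ X) ∧
  (∀ y ∈ Y, ∀ a ∈ A, ∀ b ∈ B, a ∘L y ∘L b ∈ Y) ∧
  mulSpan X Y ⊆ B ∧ mulSpan Y X = A

/-- `A` is spatially embedded in `B`. -/
def SpatiallyEmbedded (A : Set (H₁ →L[ℂ] H₁)) (B : Set (H₂ →L[ℂ] H₂)) : Prop :=
  ∃ X Y, SpatialPair A B X Y

/-- `A` and `B` are spatially Morita equivalent. -/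
def SpatiallyMorita (A : Set (H₁ →L[ℂ] H₁)) (B : Set (H₂ →L[ℂ] H₂)) : Prop :=
  ∃ X Y, SpatialPair A B X Y ∧ mulSpan X Y = B

/-- The strong operator topology on `B(H,K)`. -/
def sot (H K : Type*) [NormedAddCommGroup H] [InnerProductSpace ℂ H]
    [NormedAddCommGroup K] [InnerProductSpace ℂ K] :
    TopologicalSpace (H →L[ℂ] K) :=
  TopologicalSpace.induced (fun T : H →L[ℂ] K => (T : H → K)) Pi.topologicalSpace

/-- A commutative subspace lattice (CSL): a strongly closed lattice of mutually
commuting orthogonal projections containing `0` and `1`. -/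
def IsCSL (L : Set (H →L[ℂ] H)) : Prop :=
  (∀ P ∈ L, IsProj P) ∧
  (∀ P ∈ L, ∀ Q ∈ L, P ∘L Q = Q ∘L P) ∧
  (0 : H →L[ℂ] H) ∈ L ∧ (1 : H →L[ℂ] H) ∈ L ∧
  (∀ P ∈ L, ∀ Q ∈ L, P ∘L Q ∈ L ∧ P + Q - P ∘L Q ∈ L) ∧
  @IsClosed _ (sot H H) L

/-- The CSL algebra `Alg L = {T : (1 - P) T P = 0 for all P ∈ L}`. -/
def cslAlg (L : Set (H →L[ℂ] H)) : Set (H →L[ℂ] H) :=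
  { T | ∀ P ∈ L, (1 - P) ∘L T ∘L P = 0 }

/-- A lattice homomorphism between CSLs (preserving meets and joins). -/
def IsLatticeHom (L₁ : Set (H₁ →L[ℂ] H₁)) (L₂ : Set (H₂ →L[ℂ] H₂))
    (φ : (H₁ →L[ℂ] H₁) → (H₂ →L[ℂ] H₂)) : Prop :=
  MapsTo φ L₁ L₂ ∧
  (∀ P ∈ L₁, ∀ Q ∈ L₁, φ (P ∘L Q) = φ P ∘L φ Q) ∧
  (∀ P ∈ L₁, ∀ Q ∈ L₁, φ (P + Q - P ∘L Q) = φ P + φ Q - φ P ∘L φ Q)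

end Algebras

section MeasurePart

variable {X X₁ X₂ : Type*} [MeasurableSpace X] [MeasurableSpace X₁] [MeasurableSpace X₂]

/-- A subset of a product of measure spaces is marginally null if it is
contained in `(M₁ × X₂) ∪ (X₁ × M₂)` with `μ₁ M₁ = μ₂ M₂ = 0`. -/
def MargNull (μ₁ : Measure X₁) (μ₂ : Measure X₂) (E : Set (X₁ × X₂)) : Prop :=
  ∃ (M₁ : Set X₁) (M₂ : Set X₂), MeasurableSet M₁ ∧ MeasurableSet M₂ ∧
    μ₁ M₁ = 0 ∧ μ₂ M₂ = 0 ∧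
    E ⊆ (M₁ ×ˢ (univ : Set X₂)) ∪ ((univ : Set X₁) ×ˢ M₂)

/-- Marginal equivalence: the symmetric difference is marginally null. -/
def MargEquiv (μ₁ : Measure X₁) (μ₂ : Measure X₂) (E F : Set (X₁ × X₂)) : Prop :=
  MargNull μ₁ μ₂ ((E \ F) ∪ (F \ E))

/-- ω-open sets: marginally equivalent to a countable union of measurable
rectangles. -/
def OmegaOpen (μ₁ : Measure X₁) (μ₂ : Measure X₂) (E : Set (X₁ × X₂)) : Prop :=
  ∃ (α : ℕ → Set X₁) (β : ℕ → Set X₂),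
    (∀ n, MeasurableSet (α n)) ∧ (∀ n, MeasurableSet (β n)) ∧
    MargEquiv μ₁ μ₂ E (⋃ n, (α n) ×ˢ (β n))

/-- ω-closed sets: complements of ω-open sets. -/
def OmegaClosed (μ₁ : Measure X₁) (μ₂ : Measure X₂) (E : Set (X₁ × X₂)) : Prop :=
  OmegaOpen μ₁ μ₂ Eᶜ

/-- `A` is a multiplication operator on `L²(X,μ)`: `A f = φ · f` for some
essentially bounded function `φ`.  The collection `{A | IsMultOp μ A}` is the
multiplication masa of `L^∞(X,μ)`. -/
def IsMultOp (μ : Measure X) (A : Lp ℂ 2 μ →L[ℂ] Lp ℂ 2 μ) : Prop :=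
  ∃ φ : X → ℂ, AEStronglyMeasurable φ μ ∧ (∃ C, ∀ᵐ x ∂μ, ‖φ x‖ ≤ C) ∧
    ∀ f : Lp ℂ 2 μ, ⇑(A f) =ᵐ[μ] fun x => φ x * f x

/-- A (weak* closed) masa-bimodule over the multiplication masas. -/
def IsMultBimodule (μ₁ : Measure X₁) (μ₂ : Measure X₂)
    (V : Set (Lp ℂ 2 μ₁ →L[ℂ] Lp ℂ 2 μ₂)) : Prop :=
  IsWkClosedSubspace V ∧
  ∀ X ∈ V, ∀ (A : Lp ℂ 2 μ₁ →L[ℂ] Lp ℂ 2 μ₁) (B : Lp ℂ 2 μ₂ →L[ℂ] Lp ℂ 2 μ₂),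
    IsMultOp μ₁ A → IsMultOp μ₂ B → B ∘L X ∘L A ∈ V

/-- `T` is supported on `κ`: `M_{χ_β} T M_{χ_α} = 0` (equivalently,
`⟪T f, g⟫ = 0` whenever `f` vanishes off `α` and `g` vanishes off `β`)
whenever the rectangle `α × β` intersects `κ` marginally nullly. -/
def SupportedOn (μ₁ : Measure X₁) (μ₂ : Measure X₂) (κ : Set (X₁ × X₂))
    (T : Lp ℂ 2 μ₁ →L[ℂ] Lp ℂ 2 μ₂) : Prop :=
  ∀ (α : Set X₁) (β : Set X₂), MeasurableSet α → MeasurableSet β →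
    MargNull μ₁ μ₂ ((α ×ˢ β) ∩ κ) →
    ∀ (f : Lp ℂ 2 μ₁) (g : Lp ℂ 2 μ₂),
      (∀ᵐ x ∂μ₁, x ∉ α → f x = 0) → (∀ᵐ y ∂μ₂, y ∉ β → g y = 0) →
      ⟪T f, g⟫ = (0 : ℂ)

/-- `M_max κ`: the space of all operators supported on `κ` — the largest
masa-bimodule with support `κ`. -/
def Mmax (μ₁ : Measure X₁) (μ₂ : Measure X₂) (κ : Set (X₁ × X₂)) :
    Set (Lp ℂ 2 μ₁ →L[ℂ] Lp ℂ 2 μ₂) :=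
  { T | SupportedOn μ₁ μ₂ κ T }

/-- `U` has support `κ`: `κ` is ω-closed and `Ref U = M_max κ`. -/
def HasSupport (μ₁ : Measure X₁) (μ₂ : Measure X₂)
    (U : Set (Lp ℂ 2 μ₁ →L[ℂ] Lp ℂ 2 μ₂)) (κ : Set (X₁ × X₂)) : Prop :=
  OmegaClosed μ₁ μ₂ κ ∧ RefHull U = Mmax μ₁ μ₂ κ

/-- `M_min κ`: the smallest weak* closed masa-bimodule with support `κ`,
realized as the intersection of all weak* closed masa-bimodules with support `κ`. -/
def Mmin (μ₁ : Measure X₁) (μ₂ : Measure X₂) (κ : Set (X₁ × X₂)) :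
    Set (Lp ℂ 2 μ₁ →L[ℂ] Lp ℂ 2 μ₂) :=
  ⋂₀ { U | IsMultBimodule μ₁ μ₂ U ∧ HasSupport μ₁ μ₂ U κ }

/-- `κ` is operator synthetic if it is ω-closed and `M_min κ = M_max κ`. -/
def OperatorSynthetic (μ₁ : Measure X₁) (μ₂ : Measure X₂)
    (κ : Set (X₁ × X₂)) : Prop :=
  OmegaClosed μ₁ μ₂ κ ∧ Mmin μ₁ μ₂ κ = Mmax μ₁ μ₂ κ

/-- A masa-bimodule of finite width over the multiplication masas. -/
def MultFiniteWidth (μ₁ : Measure X₁) (μ₂ : Measure X₂)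
    (V : Set (Lp ℂ 2 μ₁ →L[ℂ] Lp ℂ 2 μ₂)) : Prop :=
  ∃ (k : ℕ) (Vs : Fin k → Set (Lp ℂ 2 μ₁ →L[ℂ] Lp ℂ 2 μ₂)),
    (∀ j, IsMultBimodule μ₁ μ₂ (Vs j) ∧ IsNestBimodule (Vs j)) ∧
    V = ⋂ j, Vs j

/-- A set of finite width: the support of a masa-bimodule of finite width. -/
def FiniteWidthSet (μ₁ : Measure X₁) (μ₂ : Measure X₂)
    (κ : Set (X₁ × X₂)) : Prop :=
  ∃ V, MultFiniteWidth μ₁ μ₂ V ∧ HasSupport μ₁ μ₂ V κ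

end MeasurePart

/-- The flip `ρ : (X₁ × X₂) × (Y₁ × Y₂) → (X₁ × Y₁) × (X₂ × Y₂)`. -/
def flipProd {X₁ X₂ Y₁ Y₂ : Type*} :
    (X₁ × X₂) × (Y₁ × Y₂) → (X₁ × Y₁) × (X₂ × Y₂) :=
  fun q => ((q.1.1, q.2.1), (q.1.2, q.2.2))

end OpSynth


namespace OpSynth

open Filter Topology
open scoped ComplexInnerProductSpace Pointwise
open Set
section P1

variable {H K H' K' : Type*}
  [NormedAddCommGroup H] [InnerProductSpace ℂ H]
  [NormedAddCommGroup K] [InnerProductSpace ℂ K]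
  [NormedAddCommGroup H'] [InnerProductSpace ℂ H']
  [NormedAddCommGroup K'] [InnerProductSpace ℂ K']

lemma wk_tendsto_iff {ι : Type*} (f : ι → (H →L[ℂ] K)) (l : Filter ι) (X : H →L[ℂ] K) :
    Tendsto f l (@nhds _ (sigmaWeak H K) X) ↔
    ∀ (ξ : ℕ → H) (η : ℕ → K), (Summable fun n => ‖ξ n‖ ^ 2) → (Summable fun n => ‖η n‖ ^ 2) →
      Tendsto (fun i => ∑' n, ⟪η n, f i (ξ n)⟫) l (𝓝 (∑' n, ⟪η n, X (ξ n)⟫)) := by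
  unfold sigmaWeak
  simp only [nhds_iInf, tendsto_iInf, nhds_induced, tendsto_comap_iff]
  rfl

lemma wk_cont_iff {A : Type*} (tA : TopologicalSpace A) (φ : A → (H →L[ℂ] K)) :
    @Continuous _ _ tA (sigmaWeak H K) φ ↔
    ∀ (ξ : ℕ → H) (η : ℕ → K), (Summable fun n => ‖ξ n‖ ^ 2) → (Summable fun n => ‖η n‖ ^ 2) →
      Continuous (fun a => ∑' n, ⟪η n, φ a (ξ n)⟫) := by
  unfold sigmaWeak
  simp only [continuous_iInf_rng, continuous_induced_rng]
  rfl

lemma wk_cont_fun {ξ : ℕ → H} {η : ℕ → K} (h1 : Summable fun n => ‖ξ n‖ ^ 2)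
    (h2 : Summable fun n => ‖η n‖ ^ 2) :
    @Continuous _ _ (sigmaWeak H K) _ (fun T : H →L[ℂ] K => ∑' n, ⟪η n, T (ξ n)⟫) :=
  (wk_cont_iff (sigmaWeak H K) id).1 (@continuous_id _ (sigmaWeak H K)) ξ η h1 h2

lemma inner_bd (T : H →L[ℂ] K) (x : H) (y : K) {C : ℝ} (hC : ‖T‖ ≤ C) :
    ‖⟪y, T x⟫‖ ≤ C * (‖x‖ ^ 2 + ‖y‖ ^ 2) := by
  have h0 : 0 ≤ C := (norm_nonneg _).trans hC
  calc ‖⟪y, T x⟫‖ ≤ ‖y‖ * ‖T x‖ := norm_inner_le_norm _ _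
    _ ≤ ‖y‖ * (C * ‖x‖) := by gcongr; exact T.le_of_opNorm_le hC x
    _ = C * (‖x‖ * ‖y‖) := by ring
    _ ≤ _ := by gcongr; nlinarith [sq_nonneg (‖x‖ - ‖y‖), norm_nonneg x, norm_nonneg y]

lemma summ_inner {ξ : ℕ → H} {η : ℕ → K} (h1 : Summable fun n => ‖ξ n‖ ^ 2)
    (h2 : Summable fun n => ‖η n‖ ^ 2) (T : H →L[ℂ] K) : Summable fun n => ⟪η n, T (ξ n)⟫ :=
  Summable.of_norm_bounded ((h1.add h2).mul_left ‖T‖) fun _ => inner_bd T _ _ le_rfl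

lemma wk_cont_add_right (Y : H →L[ℂ] K) :
    @Continuous _ _ (sigmaWeak H K) (sigmaWeak H K) (fun X => X + Y) := by
  rw [wk_cont_iff]
  intro ξ η h1 h2
  have : (fun a : H →L[ℂ] K => ∑' n, ⟪η n, (a + Y) (ξ n)⟫) =
      fun a => (∑' n, ⟪η n, a (ξ n)⟫) + ∑' n, ⟪η n, Y (ξ n)⟫ := by
    funext a
    rw [← (summ_inner h1 h2 a).tsum_add (summ_inner h1 h2 Y)]
    simp
  rw [this]
  let _ := sigmaWeak H K
  exact (continuous_add_const _).comp (wk_cont_fun h1 h2)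

lemma wk_cont_smul (c : ℂ) :
    @Continuous _ _ (sigmaWeak H K) (sigmaWeak H K) (fun X => c • X) := by
  rw [wk_cont_iff]
  intro ξ η h1 h2
  have : (fun a : H →L[ℂ] K => ∑' n, ⟪η n, (c • a) (ξ n)⟫) =
      fun a => c * (∑' n, ⟪η n, a (ξ n)⟫) := by
    funext a
    rw [← tsum_mul_left]
    simp
  rw [this]
  let _ := sigmaWeak H K
  exact (continuous_const_mul _).comp (wk_cont_fun h1 h2)

lemma summ_map {ξ : ℕ → H} (h1 : Summable fun n => ‖ξ n‖ ^ 2) (A : H →L[ℂ] K) :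
    Summable fun n => ‖A (ξ n)‖ ^ 2 := by
  refine Summable.of_nonneg_of_le (fun _ => by positivity) (fun n => ?_) (h1.mul_left (‖A‖ ^ 2))
  rw [← mul_pow]
  gcongr
  exact A.le_opNorm _

lemma wk_cont_mul [CompleteSpace K] [CompleteSpace K'] (B : K →L[ℂ] K') (A : H' →L[ℂ] H) :
    @Continuous _ _ (sigmaWeak H K) (sigmaWeak H' K') (fun X => B ∘L X ∘L A) := by
  rw [wk_cont_iff]
  intro ξ η h1 h2
  have : (fun a : H →L[ℂ] K => ∑' n, ⟪η n, (B ∘L a ∘L A) (ξ n)⟫) =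
      fun a => ∑' n, ⟪(ContinuousLinearMap.adjoint B) (η n), a (A (ξ n))⟫ := by
    funext a
    simp [ContinuousLinearMap.adjoint_inner_left]
  rw [this]
  exact wk_cont_fun (summ_map h1 A) (summ_map h2 _)

lemma subset_wkClosure (S : Set (H →L[ℂ] K)) : S ⊆ wkClosure S :=
  @subset_closure _ (sigmaWeak H K) S

lemma wkClosed_wkClosure (S : Set (H →L[ℂ] K)) : WkClosed (wkClosure S) :=
  @isClosed_closure _ (sigmaWeak H K) S

lemma wkClosure_min {S T : Set (H →L[ℂ] K)} (h : S ⊆ T) (hT : WkClosed T) : wkClosure S ⊆ T :=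
  @closure_minimal _ (sigmaWeak H K) S T h hT

lemma wkClosure_mono {S T : Set (H →L[ℂ] K)} (h : S ⊆ T) : wkClosure S ⊆ wkClosure T :=
  @closure_mono _ (sigmaWeak H K) S T h

lemma wkClosure_map {S : Set (H →L[ℂ] K)} {S' : Set (H' →L[ℂ] K')}
    {φ : (H →L[ℂ] K) → (H' →L[ℂ] K')}
    (hφ : @Continuous _ _ (sigmaWeak H K) (sigmaWeak H' K') φ) (h : ∀ x ∈ S, φ x ∈ S')
    (hS' : WkClosed S') {X : H →L[ℂ] K} (hX : X ∈ wkClosure S) : φ X ∈ S' := by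
  have : S ⊆ φ ⁻¹' S' := h
  exact wkClosure_min this (@IsClosed.preimage _ _ (sigmaWeak H K) (sigmaWeak H' K') _ hφ _ hS') hX

/-- closure of a submodule -/
lemma isWkClosedSubspace_closure (M : Submodule ℂ (H →L[ℂ] K)) :
    IsWkClosedSubspace (wkClosure (M : Set (H →L[ℂ] K))) := by
  refine ⟨⟨{ carrier := wkClosure (M : Set (H →L[ℂ] K)), zero_mem' := ?_, add_mem' := ?_, smul_mem' := ?_}, rfl⟩, wkClosed_wkClosure _⟩
  · intro a b ha hb
    have h1 : ∀ m ∈ M, a + m ∈ wkClosure (M : Set (H →L[ℂ] K)) := fun m hm =>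
      wkClosure_map (wk_cont_add_right m) (fun x hx => subset_wkClosure _ (M.add_mem hx hm))
        (wkClosed_wkClosure _) ha
    have := wkClosure_map (wk_cont_add_right a) (fun x hx => by
      have := h1 x hx; rwa [add_comm] at this) (wkClosed_wkClosure _) hb
    rwa [add_comm] at this
  · exact subset_wkClosure _ M.zero_mem
  · intro c x hx
    exact wkClosure_map (wk_cont_smul c) (fun x hx => subset_wkClosure _ (M.smul_mem c hx))
      (wkClosed_wkClosure _) hx

/-- bundled submodule -/
def IsWkClosedSubspace.sub {S : Set (H →L[ℂ] K)} (h : IsWkClosedSubspace S) :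
    Submodule ℂ (H →L[ℂ] K) where
  carrier := S
  zero_mem' := by obtain ⟨⟨M, rfl⟩, -⟩ := h; exact M.zero_mem
  add_mem' := by obtain ⟨⟨M, rfl⟩, -⟩ := h; exact M.add_mem
  smul_mem' := by obtain ⟨⟨M, rfl⟩, -⟩ := h; exact fun c x => M.smul_mem c

@[simp] lemma IsWkClosedSubspace.mem_sub {S : Set (H →L[ℂ] K)} (h : IsWkClosedSubspace S)
    (X : H →L[ℂ] K) : X ∈ h.sub ↔ X ∈ S := Iff.rfl

lemma wk_tendsto_of_bdd {ι : Type*} {f : ι → (H →L[ℂ] K)} {l : Filter ι} {X : H →L[ℂ] K} {C : ℝ}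
    (hC : ∀ᶠ i in l, ‖f i‖ ≤ C) (h : ∀ x y, Tendsto (fun i => ⟪y, f i x⟫) l (𝓝 ⟪y, X x⟫)) :
    Tendsto f l (@nhds _ (sigmaWeak H K) X) := by
  rw [wk_tendsto_iff]
  intro ξ η h1 h2
  refine tendsto_tsum_of_dominated_convergence ((h1.add h2).mul_left C) (fun n => h _ _) ?_
  filter_upwards [hC] with i hi n
  exact inner_bd _ _ _ hi

lemma WkClosed.mem_of_bdd {S : Set (H →L[ℂ] K)} (hS : WkClosed S) {ι : Type*}
    {f : ι → (H →L[ℂ] K)} {l : Filter ι} [l.NeBot] {X : H →L[ℂ] K} {C : ℝ}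
    (hfS : ∀ i, f i ∈ S)
    (hC : ∀ i, ‖f i‖ ≤ C) (h : ∀ x y, Tendsto (fun i => ⟪y, f i x⟫) l (𝓝 ⟪y, X x⟫)) :
    X ∈ S := by
  have := wk_tendsto_of_bdd (Eventually.of_forall hC) h
  let _ := sigmaWeak H K
  exact IsClosed.mem_of_tendsto hS this (Eventually.of_forall hfS)

lemma WkClosed.inter {S T : Set (H →L[ℂ] K)} (hS : WkClosed S) (hT : WkClosed T) :
    WkClosed (S ∩ T) := @IsClosed.inter _ _ _ (sigmaWeak H K) hS hT

lemma WkClosed.preim {S : Set (H' →L[ℂ] K')} (hS : WkClosed S)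
    {φ : (H →L[ℂ] K) → (H' →L[ℂ] K')}
    (hφ : @Continuous _ _ (sigmaWeak H K) (sigmaWeak H' K') φ) : WkClosed (φ ⁻¹' S) :=
  @IsClosed.preimage _ _ (sigmaWeak H K) (sigmaWeak H' K') _ hφ _ hS

lemma wk_cont_coef (x : H) (y : K) :
    @Continuous _ _ (sigmaWeak H K) _ (fun T : H →L[ℂ] K => ⟪y, T x⟫) := by
  have h1 : Summable fun n => ‖(Pi.single 0 x : ℕ → H) n‖ ^ 2 :=
    summable_of_ne_finset_zero (s := {0}) (fun n hn => by
      simp at hn; simp [hn])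
  have h2 : Summable fun n => ‖(Pi.single 0 y : ℕ → K) n‖ ^ 2 :=
    summable_of_ne_finset_zero (s := {0}) (fun n hn => by
      simp at hn; simp [hn])
  have := wk_cont_fun h1 h2
  convert this using 2 with T
  rw [tsum_eq_single 0]
  · simp
  · intro n hn; simp [hn]

lemma wkClosed_eq [CompleteSpace K'] [CompleteSpace K] (B B' : K →L[ℂ] K') (A A' : H' →L[ℂ] H) :
    WkClosed {X : H →L[ℂ] K | B ∘L X ∘L A = B' ∘L X ∘L A'} := by
  have : {X : H →L[ℂ] K | B ∘L X ∘L A = B' ∘L X ∘L A'} =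
      ⋂ (x : H') (y : K'), {X | ⟪y, (B ∘L X ∘L A) x⟫ = ⟪y, (B' ∘L X ∘L A') x⟫} := by
    ext X
    simp only [mem_ofPred_eq, mem_iInter]
    refine ⟨fun h x y => by rw [h], fun h => ?_⟩
    ext x
    exact ext_inner_left ℂ fun y => h x y
  rw [this]
  refine @isClosed_iInter _ _ (sigmaWeak H K) _ fun x => @isClosed_iInter _ _ (sigmaWeak H K) _ fun y => ?_
  refine @isClosed_eq _ _ _ (sigmaWeak H K) _ _ _ ?_ ?_
  · exact @Continuous.comp _ _ _ (sigmaWeak H K) (sigmaWeak H' K') _ _ _ (wk_cont_coef x y) (wk_cont_mul B A)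
  · exact @Continuous.comp _ _ _ (sigmaWeak H K) (sigmaWeak H' K') _ _ _ (wk_cont_coef x y) (wk_cont_mul B' A')

lemma wk_compact_ball [CompleteSpace K] (C : ℝ) (hC : 0 ≤ C) :
    @IsCompact _ (sigmaWeak H K) {X : H →L[ℂ] K | ‖X‖ ≤ C} := by
  rw [@isCompact_iff_ultrafilter_le_nhds _ (sigmaWeak H K)]
  intro f hf
  rw [le_principal_iff] at hf
  have hb : ∀ x y, ∀ᶠ X in f, ‖⟪(X : H →L[ℂ] K) x, y⟫‖ ≤ C * ‖x‖ * ‖y‖ := by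
    intro x y
    filter_upwards [hf] with X hX
    exact (norm_inner_le_norm _ _).trans (by gcongr; exact X.le_of_opNorm_le hX x)
  have hlim : ∀ (x : H) (y : K), ∃ L : ℂ, ‖L‖ ≤ C * ‖x‖ * ‖y‖ ∧ Tendsto (fun X : H →L[ℂ] K => ⟪X x, y⟫) f (𝓝 L) := by
    intro x y
    have := (isCompact_closedBall (0 : ℂ) (C * ‖x‖ * ‖y‖))
    rw [isCompact_iff_ultrafilter_le_nhds] at this
    obtain ⟨L, hL, h⟩ := this (f.map (fun X : H →L[ℂ] K => ⟪X x, y⟫)) (by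
      rw [le_principal_iff]
      have := hb x y
      rw [Ultrafilter.coe_map, Filter.mem_map]
      filter_upwards [this] with X hX
      simpa using hX)
    exact ⟨L, by simpa using hL, h⟩
  choose L hL1 hL2 using hlim
  let g : H → (K →L[ℂ] ℂ) := fun x => LinearMap.mkContinuous
    { toFun := L x
      map_add' := fun y y' => tendsto_nhds_unique (hL2 x (y + y'))
        (by simpa [inner_add_right] using (hL2 x y).add (hL2 x y'))
      map_smul' := fun c y => tendsto_nhds_unique (hL2 x (c • y))
        (by simpa [inner_smul_right] using (hL2 x y).const_mul c) } (C * ‖x‖) (hL1 x)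
  let X : H →L[ℂ] K := LinearMap.mkContinuous
    { toFun := fun x => (InnerProductSpace.toDual ℂ K).symm (g x)
      map_add' := fun x x' => by
        refine ext_inner_right ℂ fun y => ?_
        rw [inner_add_left]
        simp only [InnerProductSpace.toDual_symm_apply]
        change L (x + x') y = L x y + L x' y
        exact tendsto_nhds_unique (hL2 (x + x') y)
          (by simpa only [map_add, inner_add_left] using (hL2 x y).add (hL2 x' y))
      map_smul' := fun c x => by
        refine ext_inner_right ℂ fun y => ?_
        simp only [RingHom.id_apply, inner_smul_left, InnerProductSpace.toDual_symm_apply]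
        change L (c • x) y = starRingEnd ℂ c * L x y
        exact tendsto_nhds_unique (hL2 (c • x) y)
          (by simpa only [map_smul, inner_smul_left] using (hL2 x y).const_mul (starRingEnd ℂ c)) } C (by
      intro x
      simp only [LinearMap.coe_mk, AddHom.coe_mk, LinearIsometryEquiv.norm_map]
      exact LinearMap.mkContinuous_norm_le _ (by positivity) _)
  refine ⟨X, LinearMap.mkContinuous_norm_le _ hC _, ?_⟩
  have := wk_tendsto_of_bdd (f := id) (l := (f : Filter (H →L[ℂ] K))) (X := X) (C := C) hf ?_
  · simpa [Tendsto] using this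
  · intro x y
    have h1 : ⟪X x, y⟫ = L x y := by
      simp only [X, LinearMap.mkContinuous_apply, LinearMap.coe_mk, AddHom.coe_mk, InnerProductSpace.toDual_symm_apply]
      rfl
    have h2 := (Complex.continuous_conj.tendsto _).comp (hL2 x y)
    rw [← h1] at h2
    simpa [Function.comp_def] using h2

/-- Closed under bounded sequential (pointwise) limits. -/
def BCClosed (Y : Submodule ℂ (H →L[ℂ] K)) : Prop :=
  ∀ (X : ℕ → (H →L[ℂ] K)) (X' : H →L[ℂ] K) (C : ℝ), (∀ n, X n ∈ Y) → (∀ n, ‖X n‖ ≤ C) →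
    (∀ x, Tendsto (fun n => X n x) atTop (𝓝 (X' x))) → X' ∈ Y

lemma IsWkClosedSubspace.bc {S : Set (H →L[ℂ] K)} (h : IsWkClosedSubspace S) : BCClosed h.sub := by
  intro X X' C h1 h2 h3
  exact h.2.mem_of_bdd (l := atTop) h1 h2 fun x y => ((continuous_const.inner continuous_id).tendsto _).comp (h3 x)

/-- generic density lemma for bounded nets of operators -/
lemma tendsto_coef_of_dense {ι : Type*} {l : Filter ι} {f : ι → (H →L[ℂ] K)} {X : H →L[ℂ] K} {C : ℝ}
    (hC : ∀ i, ‖f i‖ ≤ C) (S1 : Set H) (S2 : Set K)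
    (h : ∀ x ∈ S1, ∀ y ∈ S2, Tendsto (fun i => ⟪y, f i x⟫) l (𝓝 ⟪y, X x⟫)) :
    ∀ x ∈ (Submodule.span ℂ S1).topologicalClosure, ∀ y ∈ (Submodule.span ℂ S2).topologicalClosure,
      Tendsto (fun i => ⟪y, f i x⟫) l (𝓝 ⟪y, X x⟫) := by
  rcases isEmpty_or_nonempty ι with hι | hι
  · intro x _ y _
    rw [filter_eq_bot_of_isEmpty l]; exact tendsto_bot
  have hC0 : 0 ≤ C := (norm_nonneg _).trans (hC hι.some)
  have a1 : ∀ x ∈ S1, ∀ y ∈ Submodule.span ℂ S2, Tendsto (fun i => ⟪y, f i x⟫) l (𝓝 ⟪y, X x⟫) := by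
    intro x hx y hy
    induction hy using Submodule.span_induction with
    | mem y hy => exact h x hx y hy
    | zero => simp only [map_zero, inner_zero_left, inner_zero_right]; exact tendsto_const_nhds
    | add a b _ _ ha hb => simpa [inner_add_left] using ha.add hb
    | smul c a _ ha => simpa only [inner_smul_left] using ha.const_mul (starRingEnd ℂ c)
  have a2 : ∀ x ∈ Submodule.span ℂ S1, ∀ y ∈ Submodule.span ℂ S2,
      Tendsto (fun i => ⟪y, f i x⟫) l (𝓝 ⟪y, X x⟫) := by
    intro x hx y hy
    induction hx using Submodule.span_induction with
    | mem x hx => exact a1 x hx y hy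
    | zero => simp only [map_zero, inner_zero_left, inner_zero_right]; exact tendsto_const_nhds
    | add a b _ _ ha hb => simpa [inner_add_right] using ha.add hb
    | smul c a _ ha => simpa [inner_smul_right] using ha.const_mul c
  have cl : ∀ (D : ℝ) (_ : 0 ≤ D) (g : ι → ℂ) (g0 : ℂ),
      (∀ ε > 0, ∃ g' : ι → ℂ, ∃ g0' : ℂ, Tendsto g' l (𝓝 g0') ∧ (∀ i, ‖g i - g' i‖ ≤ D * ε) ∧
        ‖g0 - g0'‖ ≤ D * ε) → Tendsto g l (𝓝 g0) := by
    intro D hD g g0 hg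
    rw [Metric.tendsto_nhds]
    intro ε hε
    obtain ⟨g', g0', h1, h2, h3⟩ := hg (ε / (3 * (D + 1))) (by positivity)
    have hDe : D * (ε / (3 * (D + 1))) ≤ ε / 3 := by
      rw [← mul_div_assoc, div_le_div_iff₀ (by positivity) (by positivity)]; nlinarith
    have := (Metric.tendsto_nhds.1 h1) (ε / 3) (by positivity)
    filter_upwards [this] with i hi
    rw [dist_eq_norm] at hi ⊢
    calc ‖g i - g0‖ = ‖(g i - g' i) + (g' i - g0') - (g0 - g0')‖ := by congr 1; ring
      _ ≤ ‖g i - g' i‖ + ‖g' i - g0'‖ + ‖g0 - g0'‖ := (norm_sub_le _ _).trans (by gcongr; exact norm_add_le _ _)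
      _ < ε := by linarith [h2 i]
  have a3 : ∀ x ∈ (Submodule.span ℂ S1).topologicalClosure, ∀ y ∈ Submodule.span ℂ S2,
      Tendsto (fun i => ⟪y, f i x⟫) l (𝓝 ⟪y, X x⟫) := by
    intro x hx y hy
    refine cl (‖y‖ * (C + ‖X‖)) (by positivity) _ _ fun ε hε => ?_
    obtain ⟨x', hx', hd⟩ := Metric.mem_closure_iff.1 hx ε hε
    rw [dist_eq_norm] at hd
    refine ⟨_, _, a2 x' hx' y hy, fun i => ?_, ?_⟩
    · rw [← inner_sub_right, ← map_sub]
      refine (norm_inner_le_norm _ _).trans ?_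
      rw [mul_assoc]
      gcongr
      refine (f i).le_opNorm_of_le le_rfl |>.trans ?_
      gcongr
      linarith [hC i, norm_nonneg X]
    · rw [← inner_sub_right, ← map_sub]
      refine (norm_inner_le_norm _ _).trans ?_
      rw [mul_assoc]
      gcongr
      refine X.le_opNorm_of_le le_rfl |>.trans ?_
      gcongr
      linarith
  intro x hx y hy
  refine cl (‖x‖ * (C + ‖X‖)) (by positivity) _ _ fun ε hε => ?_
  obtain ⟨y', hy', hd⟩ := Metric.mem_closure_iff.1 hy ε hε
  rw [dist_eq_norm] at hd
  refine ⟨_, _, a3 x hx y' hy', fun i => ?_, ?_⟩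
  · rw [← inner_sub_left]
    refine (norm_inner_le_norm _ _).trans ?_
    rw [mul_comm]
    gcongr
    refine (f i).le_opNorm_of_le le_rfl |>.trans ?_
    rw [mul_comm]
    gcongr
    linarith [hC i, norm_nonneg X]
  · rw [← inner_sub_left]
    refine (norm_inner_le_norm _ _).trans ?_
    rw [mul_comm]
    gcongr
    refine X.le_opNorm_of_le le_rfl |>.trans ?_
    rw [mul_comm]
    gcongr
    linarith

end P1
end OpSynth


namespace OpSynth

open Filter Topology
open scoped ComplexInnerProductSpace Pointwise ComplexOrder
open Set

noncomputable section P2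

variable {H K H₁ H₂ K₁ K₂ T T₁ T₂ E : Type*}
  [NormedAddCommGroup H] [InnerProductSpace ℂ H]
  [NormedAddCommGroup K] [InnerProductSpace ℂ K]
  [NormedAddCommGroup H₁] [InnerProductSpace ℂ H₁]
  [NormedAddCommGroup H₂] [InnerProductSpace ℂ H₂]
  [NormedAddCommGroup K₁] [InnerProductSpace ℂ K₁]
  [NormedAddCommGroup K₂] [InnerProductSpace ℂ K₂]
  [NormedAddCommGroup T] [InnerProductSpace ℂ T]
  [NormedAddCommGroup T₁] [InnerProductSpace ℂ T₁]
  [NormedAddCommGroup T₂] [InnerProductSpace ℂ T₂]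
  [NormedAddCommGroup E] [InnerProductSpace ℂ E]
  {t : H → K → T} {t₁ : H₁ → K₁ → T₁} {t₂ : H₂ → K₂ → T₂}

namespace IsTensorEmbedding

lemma add_left (ht : IsTensorEmbedding t) (x x' y) : t (x + x') y = t x y + t x' y := ht.1 x x' y
lemma add_right (ht : IsTensorEmbedding t) (x y y') : t x (y + y') = t x y + t x y' := ht.2.1 x y y'
lemma smul_left (ht : IsTensorEmbedding t) (c : ℂ) (x y) : t (c • x) y = c • t x y := ht.2.2.1 c x y
lemma smul_right (ht : IsTensorEmbedding t) (c : ℂ) (x y) : t x (c • y) = c • t x y := ht.2.2.2.1 c x y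
lemma inner (ht : IsTensorEmbedding t) (x x' y y') : ⟪t x y, t x' y'⟫ = ⟪x, x'⟫ * ⟪y, y'⟫ :=
  ht.2.2.2.2.1 x x' y y'
lemma dense (ht : IsTensorEmbedding t) :
    (Submodule.span ℂ { z | ∃ x y, z = t x y }).topologicalClosure = ⊤ := ht.2.2.2.2.2

lemma norm_eq (ht : IsTensorEmbedding t) (x y) : ‖t x y‖ = ‖x‖ * ‖y‖ := by
  have h : ‖t x y‖ ^ 2 = (‖x‖ * ‖y‖) ^ 2 := by
    have h := ht.inner x x y y
    rw [inner_self_eq_norm_sq_to_K, inner_self_eq_norm_sq_to_K, inner_self_eq_norm_sq_to_K] at h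
    rw [mul_pow]
    exact_mod_cast h
  exact (pow_left_inj₀ (norm_nonneg _) (by positivity) two_ne_zero).1 h

lemma ext (ht : IsTensorEmbedding t) {W W' : T →L[ℂ] E} (h : ∀ x y, W (t x y) = W' (t x y)) :
    W = W' := by
  refine ContinuousLinearMap.ext_on (s := { z | ∃ x y, z = t x y }) ?_ ?_
  · exact (Submodule.dense_iff_topologicalClosure_eq_top).2 ht.dense
  · rintro _ ⟨x, y, rfl⟩; exact h x y

lemma ext_inner (ht : IsTensorEmbedding t) {u v : T} (h : ∀ x y, ⟪t x y, u⟫ = ⟪t x y, v⟫) :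
    u = v := by
  have : innerSL ℂ u = innerSL ℂ v := ht.ext fun x y => by
    simp only [innerSL_apply_apply]
    rw [← inner_conj_symm, h, inner_conj_symm]
  refine ext_inner_right ℂ fun z => ?_
  simpa using congrArg (fun f : T →L[ℂ] ℂ => f z) this

end IsTensorEmbedding

lemma gram_tens (ht : IsTensorEmbedding t) {ι : Type*} [Fintype ι] (x : ι → H) (y : ι → K) :
    Matrix.gram ℂ (fun i => t (x i) (y i)) = Matrix.hadamard (Matrix.gram ℂ x) (Matrix.gram ℂ y) := by
  ext i j
  simp [Matrix.gram, ht.inner]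

lemma inner_self_C (x : H) : ⟪x, x⟫ = ((‖x‖ ^ 2 : ℝ) : ℂ) := by
  rw [inner_self_eq_norm_sq_to_K]; simp

lemma gram_psd {ι : Type*} [Fintype ι] (S : H₁ →L[ℂ] H₂) (x : ι → H₁) :
    (((‖S‖ ^ 2 : ℝ) : ℂ) • Matrix.gram ℂ x - Matrix.gram ℂ (fun i => S (x i))).PosSemidef := by
  have hsa : IsSelfAdjoint (((‖S‖ ^ 2 : ℝ) : ℂ)) := by
    rw [isSelfAdjoint_iff]; simp
  refine .of_dotProduct_mulVec_nonneg ((Matrix.isHermitian_gram ℂ _).smul hsa |>.sub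
    (Matrix.isHermitian_gram ℂ _)) fun c => ?_
  rw [Matrix.sub_mulVec, dotProduct_sub, Matrix.smul_mulVec, dotProduct_smul,
    Matrix.star_dotProduct_gram_mulVec, Matrix.star_dotProduct_gram_mulVec]
  have : ∑ i, c i • S (x i) = S (∑ i, c i • x i) := by simp
  rw [this, inner_self_C, inner_self_C, smul_eq_mul]
  have h := S.le_opNorm (∑ i, c i • x i)
  have h2 : 0 ≤ ‖S‖ ^ 2 * ‖∑ i, c i • x i‖ ^ 2 - ‖S (∑ i, c i • x i)‖ ^ 2 := by
    rw [← mul_pow]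
    exact sub_nonneg.2 (by gcongr)
  rw [← Complex.ofReal_mul, ← Complex.ofReal_sub]
  exact Complex.zero_le_real.2 h2

lemma had_sub {ι : Type*} (c : ℂ) (A B C : Matrix ι ι ℂ) : Matrix.hadamard (c • A - B) C =
    c • Matrix.hadamard A C - Matrix.hadamard B C := by
  ext i j; simp [Matrix.hadamard]; ring

lemma had_sub' {ι : Type*} (c : ℂ) (A B C : Matrix ι ι ℂ) : Matrix.hadamard C (c • A - B) =
    c • Matrix.hadamard C A - Matrix.hadamard C B := by
  ext i j; simp [Matrix.hadamard]; ring

lemma tens_bound (ht₁ : IsTensorEmbedding t₁) (ht₂ : IsTensorEmbedding t₂) {ι : Type*} [Fintype ι]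
    (S : H₁ →L[ℂ] H₂) (R : K₁ →L[ℂ] K₂) (x : ι → H₁) (y : ι → K₁) (c : ι → ℂ) :
    ‖∑ i, c i • t₂ (S (x i)) (R (y i))‖ ≤ ‖S‖ * ‖R‖ * ‖∑ i, c i • t₁ (x i) (y i)‖ := by
  have h1 := ((gram_psd S x).hadamard (Matrix.posSemidef_gram ℂ (fun i => R (y i)))).dotProduct_mulVec_nonneg c
  have h2 := ((Matrix.posSemidef_gram ℂ x).hadamard (gram_psd R y)).dotProduct_mulVec_nonneg c
  rw [had_sub, Matrix.sub_mulVec, dotProduct_sub, Matrix.smul_mulVec, dotProduct_smul,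
    ← gram_tens ht₂, Matrix.star_dotProduct_gram_mulVec, inner_self_C] at h1
  rw [had_sub', Matrix.sub_mulVec, dotProduct_sub, Matrix.smul_mulVec, dotProduct_smul,
    ← gram_tens ht₁, Matrix.star_dotProduct_gram_mulVec, inner_self_C] at h2
  set Z := star c ⬝ᵥ (Matrix.hadamard (Matrix.gram ℂ x) (Matrix.gram ℂ fun i ↦ R (y i))).mulVec c
  rw [smul_eq_mul, ← Complex.ofReal_mul] at h2
  have h2' := (Complex.le_def.1 h2).1
  have h1' := (Complex.le_def.1 h1).1
  simp only [smul_eq_mul, Complex.sub_re, Complex.re_ofReal_mul, Complex.ofReal_re, Complex.zero_re] at h1' h2'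
  refine le_of_sq_le_sq ?_ (by positivity)
  rw [mul_pow, mul_pow]
  nlinarith [mul_le_mul_of_nonneg_left (sub_nonneg.1 h2') (sq_nonneg ‖S‖)]

/-- elementary tensor -/
def tens [CompleteSpace T₂] (t₁ : H₁ → K₁ → T₁) (t₂ : H₂ → K₂ → T₂)
    (S : H₁ →L[ℂ] H₂) (R : K₁ →L[ℂ] K₂) : T₁ →L[ℂ] T₂ :=
  (Finsupp.linearCombination ℂ (fun p : H₁ × K₁ => t₂ (S p.1) (R p.2))).extendOfNorm
    (Finsupp.linearCombination ℂ (fun p : H₁ × K₁ => t₁ p.1 p.2))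

variable [CompleteSpace T₂] (ht₁ : IsTensorEmbedding t₁) (ht₂ : IsTensorEmbedding t₂)

include ht₁ in
lemma tens_dense : DenseRange (Finsupp.linearCombination ℂ (fun p : H₁ × K₁ => t₁ p.1 p.2)) := by
  have h := (Submodule.dense_iff_topologicalClosure_eq_top).2 ht₁.dense
  have h2 : range (Finsupp.linearCombination ℂ (fun p : H₁ × K₁ => t₁ p.1 p.2)) =
     (Submodule.span ℂ { z | ∃ x y, z = t₁ x y } : Set T₁) := by
    rw [← LinearMap.coe_range, Finsupp.range_linearCombination]
    congr 2
    ext z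
    simp [eq_comm]
  rw [DenseRange, h2]
  exact h

include ht₁ ht₂ in
lemma tens_bd (S : H₁ →L[ℂ] H₂) (R : K₁ →L[ℂ] K₂) (c : H₁ × K₁ →₀ ℂ) :
    ‖Finsupp.linearCombination ℂ (fun p : H₁ × K₁ => t₂ (S p.1) (R p.2)) c‖ ≤
    ‖S‖ * ‖R‖ * ‖Finsupp.linearCombination ℂ (fun p : H₁ × K₁ => t₁ p.1 p.2) c‖ := by
  have := tens_bound ht₁ ht₂ S R (fun i : c.support => i.1.1) (fun i => i.1.2) (fun i => c i)
  simp only [Finsupp.linearCombination_apply, Finsupp.sum]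
  rw [Finset.sum_coe_sort c.support (fun i => c i • t₂ (S i.1) (R i.2)),
    Finset.sum_coe_sort c.support (fun i => c i • t₁ i.1 i.2)] at this
  exact this

include ht₁ ht₂ in
lemma tens_apply (S : H₁ →L[ℂ] H₂) (R : K₁ →L[ℂ] K₂) (x y) :
    tens t₁ t₂ S R (t₁ x y) = t₂ (S x) (R y) := by
  have := LinearMap.extendOfNorm_eq (tens_dense ht₁) ⟨_, tens_bd ht₁ ht₂ S R⟩ (Finsupp.single (x, y) 1)
  simpa [tens] using this

include ht₁ ht₂ in
lemma norm_tens_le (S : H₁ →L[ℂ] H₂) (R : K₁ →L[ℂ] K₂) : ‖tens t₁ t₂ S R‖ ≤ ‖S‖ * ‖R‖ :=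
  LinearMap.opNorm_extendOfNorm_le (tens_dense ht₁) (by positivity) (tens_bd ht₁ ht₂ S R)

include ht₁ ht₂ in
lemma isElemTensor_iff (S : H₁ →L[ℂ] H₂) (R : K₁ →L[ℂ] K₂) (W : T₁ →L[ℂ] T₂) :
    IsElemTensor t₁ t₂ W S R ↔ W = tens t₁ t₂ S R :=
  ⟨fun h => ht₁.ext fun x y => by rw [h, tens_apply ht₁ ht₂], fun h x y => by rw [h, tens_apply ht₁ ht₂]⟩

omit [CompleteSpace T₂] in
lemma isWkClosedSubspace_wTensor (V : Set (H₁ →L[ℂ] H₂)) (U : Set (K₁ →L[ℂ] K₂)) :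
    IsWkClosedSubspace (wTensor t₁ t₂ V U) := isWkClosedSubspace_closure _

omit [CompleteSpace T₂] in
lemma wTensor_mono {V V' : Set (H₁ →L[ℂ] H₂)} {U U' : Set (K₁ →L[ℂ] K₂)} (h : V ⊆ V') (h' : U ⊆ U') :
    wTensor t₁ t₂ V U ⊆ wTensor t₁ t₂ V' U' := by
  refine wkClosure_mono (Submodule.span_mono ?_)
  rintro W ⟨S, hS, R, hR, h0⟩
  exact ⟨S, h hS, R, h' hR, h0⟩

include ht₁ ht₂ in
lemma tens_mem {V : Set (H₁ →L[ℂ] H₂)} {U : Set (K₁ →L[ℂ] K₂)} {S R} (hS : S ∈ V) (hR : R ∈ U) :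
    tens t₁ t₂ S R ∈ wTensor t₁ t₂ V U :=
  subset_wkClosure _ (Submodule.subset_span ⟨S, hS, R, hR, (isElemTensor_iff ht₁ ht₂ S R _).2 rfl⟩)

/-- generic mapping lemma -/
lemma wTensor_ind {H' K' : Type*} [NormedAddCommGroup H'] [InnerProductSpace ℂ H']
    [NormedAddCommGroup K'] [InnerProductSpace ℂ K'] [CompleteSpace K']
    (ht₁ : IsTensorEmbedding t₁) (ht₂ : IsTensorEmbedding t₂)
    (V : Set (H₁ →L[ℂ] H₂)) (U : Set (K₁ →L[ℂ] K₂))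
    {S' : Set (H' →L[ℂ] K')} (hS' : IsWkClosedSubspace S') (b : T₂ →L[ℂ] K') (a : H' →L[ℂ] T₁)
    (h : ∀ S ∈ V, ∀ R ∈ U, b ∘L tens t₁ t₂ S R ∘L a ∈ S') :
    ∀ W ∈ wTensor t₁ t₂ V U, b ∘L W ∘L a ∈ S' := by
  intro W hW
  refine wkClosure_map (wk_cont_mul b a) ?_ hS'.2 hW
  intro X hX
  induction hX using Submodule.span_induction with
  | mem X hX =>
    obtain ⟨S, hS, R, hR, h0⟩ := hX
    rw [(isElemTensor_iff ht₁ ht₂ S R X).1 h0]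
    exact h S hS R hR
  | zero => rw [ContinuousLinearMap.zero_comp, ContinuousLinearMap.comp_zero]; exact hS'.sub.zero_mem
  | add X Y _ _ hX hY =>
    have := hS'.sub.add_mem hX hY
    rwa [← ContinuousLinearMap.comp_add, ← ContinuousLinearMap.add_comp] at this
  | smul c X _ hX =>
    have := hS'.sub.smul_mem c hX
    rwa [← ContinuousLinearMap.comp_smul, ← ContinuousLinearMap.smul_comp] at this

/-- inclusion y ↦ x ⊗ y -/
def incl (ht : IsTensorEmbedding t) (x : H) : K →L[ℂ] T :=
  LinearMap.mkContinuous { toFun := t x, map_add' := ht.add_right x, map_smul' := fun c => ht.smul_right c x }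
    ‖x‖ fun y => (ht.norm_eq x y).le

@[simp] lemma incl_apply (ht : IsTensorEmbedding t) (x : H) (y : K) : incl ht x y = t x y := rfl

lemma norm_incl_le (ht : IsTensorEmbedding t) (x : H) : ‖incl ht x‖ ≤ ‖x‖ :=
  LinearMap.mkContinuous_norm_le _ (norm_nonneg _) _

variable [CompleteSpace K₂]

/-- slices -/
def slice (ht₁ : IsTensorEmbedding t₁) (ht₂ : IsTensorEmbedding t₂) (ξ : H₁) (η : H₂) (X : T₁ →L[ℂ] T₂) :
    K₁ →L[ℂ] K₂ := ContinuousLinearMap.adjoint (incl ht₂ η) ∘L X ∘L incl ht₁ ξ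

lemma inner_slice (ξ : H₁) (η : H₂) (X : T₁ →L[ℂ] T₂) (y : K₁) (z : K₂) :
    ⟪z, slice ht₁ ht₂ ξ η X y⟫ = ⟪t₂ η z, X (t₁ ξ y)⟫ := by
  simp [slice, ContinuousLinearMap.adjoint_inner_right]

lemma norm_slice_le (ξ : H₁) (η : H₂) (X : T₁ →L[ℂ] T₂) :
    ‖slice ht₁ ht₂ ξ η X‖ ≤ ‖ξ‖ * ‖η‖ * ‖X‖ := by
  calc _ ≤ ‖ContinuousLinearMap.adjoint (incl ht₂ η)‖ * (‖X‖ * ‖incl ht₁ ξ‖) :=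
        (ContinuousLinearMap.opNorm_comp_le _ _).trans (by gcongr; exact ContinuousLinearMap.opNorm_comp_le _ _)
    _ ≤ ‖η‖ * (‖X‖ * ‖ξ‖) := by
      rw [LinearIsometryEquiv.norm_map]
      gcongr <;> exact norm_incl_le _ _
    _ = _ := by ring

lemma slice_mem {U : Set (K₁ →L[ℂ] K₂)} (hU : IsWkClosedSubspace U) {X : T₁ →L[ℂ] T₂}
    (hX : X ∈ wTensor t₁ t₂ univ U) (ξ η) : slice ht₁ ht₂ ξ η X ∈ U := by
  refine wTensor_ind ht₁ ht₂ univ U hU _ _ ?_ X hX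
  intro S _ R hR
  have : ContinuousLinearMap.adjoint (incl ht₂ η) ∘L tens t₁ t₂ S R ∘L incl ht₁ ξ = ⟪η, S ξ⟫ • R := by
    ext y
    refine ext_inner_left ℂ fun z => ?_
    simp [ContinuousLinearMap.adjoint_inner_right, tens_apply ht₁ ht₂, ht₂.inner, inner_smul_right]
  rw [this]
  exact hU.sub.smul_mem _ hR

variable [CompleteSpace H] [CompleteSpace T]

/-- amplification -/
def amp (ht : IsTensorEmbedding t) : (H →L[ℂ] H) →⋆ₐ[ℂ] (T →L[ℂ] T) where
  toFun a := tens t t a 1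
  map_one' := ht.ext fun x y => by rw [tens_apply ht ht]; simp
  map_mul' a b := ht.ext fun x y => by simp [tens_apply ht ht]
  map_zero' := ht.ext fun x y => by
    rw [tens_apply ht ht]; simpa using ht.smul_left 0 0 y
  map_add' a b := ht.ext fun x y => by simp [tens_apply ht ht, ht.add_left]
  commutes' r := ht.ext fun x y => by
    rw [tens_apply ht ht]; simp [Algebra.algebraMap_eq_smul_one, ht.smul_left]
  map_star' a := ht.ext fun x y => by
    refine ht.ext_inner fun x' y' => ?_
    rw [tens_apply ht ht, ContinuousLinearMap.star_eq_adjoint, ContinuousLinearMap.star_eq_adjoint,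
      ContinuousLinearMap.adjoint_inner_right, tens_apply ht ht, ht.inner, ht.inner,
      ContinuousLinearMap.adjoint_inner_right]
    simp

lemma amp_apply (ht : IsTensorEmbedding t) (a : H →L[ℂ] H) (x y) : amp ht a (t x y) = t (a x) y :=
  tens_apply ht ht a 1 x y

lemma norm_amp_le (ht : IsTensorEmbedding t) (a : H →L[ℂ] H) : ‖amp ht a‖ ≤ ‖a‖ := by
  have := norm_tens_le ht ht a 1
  refine this.trans ?_
  calc ‖a‖ * ‖(1 : K →L[ℂ] K)‖ ≤ ‖a‖ * 1 := by gcongr; exact ContinuousLinearMap.norm_id_le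
    _ = ‖a‖ := mul_one _

lemma amp_tendsto {ι : Type*} {l : Filter ι} (ht : IsTensorEmbedding t) {a : ι → (H →L[ℂ] H)} {a' : H →L[ℂ] H} {C : ℝ}
    (hC : ∀ i, ‖a i‖ ≤ C) (h : ∀ x, Tendsto (fun i => a i x) l (𝓝 (a' x))) (u v : T) :
    Tendsto (fun i => ⟪v, amp ht (a i) u⟫) l (𝓝 ⟪v, amp ht a' u⟫) := by
  refine tendsto_coef_of_dense (fun i => (norm_amp_le ht (a i)).trans (hC i)) { z | ∃ x y, z = t x y }
    { z | ∃ x y, z = t x y } ?_ u (by rw [ht.dense]; trivial) v (by rw [ht.dense]; trivial)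
  rintro _ ⟨x, y, rfl⟩ _ ⟨x', y', rfl⟩
  simp only [amp_apply, ht.inner]
  exact (((continuous_const.inner continuous_id).tendsto _).comp (h x)).mul_const _

variable [CompleteSpace H₁] [CompleteSpace H₂] [CompleteSpace T₁]

lemma wTensor_map {V V' : Set (H₁ →L[ℂ] H₂)} {U : Set (K₁ →L[ℂ] K₂)} (b : H₂ →L[ℂ] H₂) (a : H₁ →L[ℂ] H₁)
    (h : ∀ X ∈ V, b ∘L X ∘L a ∈ V') {W : T₁ →L[ℂ] T₂} (hW : W ∈ wTensor t₁ t₂ V U) :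
    amp ht₂ b ∘L W ∘L amp ht₁ a ∈ wTensor t₁ t₂ V' U := by
  refine wTensor_ind ht₁ ht₂ V U (isWkClosedSubspace_wTensor V' U) _ _ ?_ W hW
  intro S hS R hR
  have : amp ht₂ b ∘L tens t₁ t₂ S R ∘L amp ht₁ a = tens t₁ t₂ (b ∘L S ∘L a) R :=
    ht₁.ext fun x y => by simp [amp_apply, tens_apply ht₁ ht₂]
  rw [this]
  exact tens_mem ht₁ ht₂ (h S hS) hR

/-- linear map Z ↦ X (Z ⊗ 1) -/
def rampL (ht₁ : IsTensorEmbedding t₁) (X : T₁ →L[ℂ] T₂) : (H₁ →L[ℂ] H₁) →ₗ[ℂ] (T₁ →L[ℂ] T₂) where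
  toFun Z := X ∘L amp ht₁ Z
  map_add' a b := by rw [map_add]; ext; simp
  map_smul' c a := by rw [map_smul]; ext; simp

/-- linear map Z ↦ (Z ⊗ 1) X -/
def lampL (ht₂ : IsTensorEmbedding t₂) (X : T₁ →L[ℂ] T₂) : (H₂ →L[ℂ] H₂) →ₗ[ℂ] (T₁ →L[ℂ] T₂) where
  toFun Z := amp ht₂ Z ∘L X
  map_add' a b := by rw [map_add]; ext; simp
  map_smul' c a := by rw [map_smul]; ext; simp

lemma bc_ramp {Y : Set (T₁ →L[ℂ] T₂)} (hY : IsWkClosedSubspace Y) (X : T₁ →L[ℂ] T₂) :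
    BCClosed (hY.sub.comap (rampL ht₁ X)) := by
  intro Z Z' C h1 h2 h3
  refine hY.2.mem_of_bdd (l := atTop) (f := fun n => X ∘L amp ht₁ (Z n)) (C := ‖X‖ * C) h1 (fun n => ?_) fun x y => ?_
  · refine (ContinuousLinearMap.opNorm_comp_le _ _).trans ?_
    gcongr
    exact (norm_amp_le ht₁ _).trans (h2 n)
  · have := amp_tendsto ht₁ h2 h3 x (ContinuousLinearMap.adjoint X y)
    simpa [ContinuousLinearMap.adjoint_inner_left, rampL] using this

lemma bc_lamp {Y : Set (T₁ →L[ℂ] T₂)} (hY : IsWkClosedSubspace Y) (X : T₁ →L[ℂ] T₂) :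
    BCClosed (hY.sub.comap (lampL ht₂ X)) := by
  intro Z Z' C h1 h2 h3
  refine hY.2.mem_of_bdd (l := atTop) (f := fun n => amp ht₂ (Z n) ∘L X) (C := C * ‖X‖) h1 (fun n => ?_) fun x y => ?_
  · refine (ContinuousLinearMap.opNorm_comp_le _ _).trans ?_
    gcongr
    exact (norm_amp_le ht₂ _).trans (h2 n)
  · have := amp_tendsto ht₂ h2 h3 (X x) y
    simpa [lampL] using this

end P2
end OpSynth


namespace OpSynth

open Filter Topology
open scoped ComplexInnerProductSpace Pointwise ComplexOrder
open Set

noncomputable section P3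

variable {H K : Type*}
  [NormedAddCommGroup H] [InnerProductSpace ℂ H]
  [NormedAddCommGroup K] [InnerProductSpace ℂ K]

lemma strong_tendsto_of_dense {ι : Type*} {l : Filter ι} {f : ι → (H →L[ℂ] K)} {X : H →L[ℂ] K} {C : ℝ}
    (hC : ∀ i, ‖f i‖ ≤ C) (S : Set H) (h : ∀ x ∈ S, Tendsto (fun i => f i x) l (𝓝 (X x))) :
    ∀ x ∈ (Submodule.span ℂ S).topologicalClosure, Tendsto (fun i => f i x) l (𝓝 (X x)) := by
  rcases isEmpty_or_nonempty ι with hι | hι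
  · intro x _
    rw [filter_eq_bot_of_isEmpty l]; exact tendsto_bot
  have hC0 : 0 ≤ C := (norm_nonneg _).trans (hC hι.some)
  have a1 : ∀ x ∈ Submodule.span ℂ S, Tendsto (fun i => f i x) l (𝓝 (X x)) := by
    intro x hx
    induction hx using Submodule.span_induction with
    | mem y hy => exact h y hy
    | zero => simp only [map_zero]; exact tendsto_const_nhds
    | add a b _ _ ha hb => simpa only [map_add] using ha.add hb
    | smul c a _ ha => simpa only [map_smul] using ha.const_smul c
  intro x hx
  rw [Metric.tendsto_nhds]
  intro ε hε
  have hpos : 0 < C + ‖X‖ + 1 := by positivity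
  obtain ⟨x', hx', hd⟩ := Metric.mem_closure_iff.1 hx (ε / (2 * (C + ‖X‖ + 1))) (by positivity)
  rw [dist_eq_norm] at hd
  have := (Metric.tendsto_nhds.1 (a1 x' hx')) (ε / 2) (by positivity)
  filter_upwards [this] with i hi
  rw [dist_eq_norm] at hi ⊢
  have e1 : f i x - X x = f i (x - x') - X (x - x') + (f i x' - X x') := by
    simp only [map_sub]; abel
  have e2 : ‖f i (x - x')‖ ≤ C * ‖x - x'‖ := (f i).le_of_opNorm_le (hC i) _
  have e3 : ‖X (x - x')‖ ≤ ‖X‖ * ‖x - x'‖ := X.le_opNorm _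
  have e4 : (C + ‖X‖ + 1) * ‖x - x'‖ < ε / 2 := by
    rw [lt_div_iff₀ (by positivity)] at hd
    linarith
  rw [e1]
  calc _ ≤ ‖f i (x - x')‖ + ‖X (x - x')‖ + ‖f i x' - X x'‖ :=
        (norm_add_le _ _).trans (by gcongr; exact norm_sub_le _ _)
    _ < ε := by nlinarith [norm_nonneg (x - x')]

variable [CompleteSpace H]

/-- projection on the closure of a subspace -/
def cproj (S : Submodule ℂ H) : H →L[ℂ] H := S.topologicalClosure.starProjection

lemma cproj_star (S : Submodule ℂ H) : IsStarProjection (cproj S) := isStarProjection_starProjection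

lemma cproj_mem (S : Submodule ℂ H) (x : H) : cproj S x ∈ S.topologicalClosure :=
  Submodule.starProjection_apply_mem _ _

lemma cproj_eq_self {S : Submodule ℂ H} {x : H} : cproj S x = x ↔ x ∈ S.topologicalClosure :=
  Submodule.starProjection_eq_self_iff

lemma cproj_of_mem {S : Submodule ℂ H} {x : H} (h : x ∈ S) : cproj S x = x :=
  cproj_eq_self.2 (S.le_topologicalClosure h)

lemma cproj_eq_zero {S : Submodule ℂ H} {x : H} : cproj S x = 0 ↔ x ∈ Sᗮ := by
  rw [← Submodule.orthogonal_closure]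
  exact Submodule.starProjection_apply_eq_zero_iff _

lemma cproj_norm (S : Submodule ℂ H) : ‖cproj S‖ ≤ 1 := Submodule.starProjection_norm_le _

lemma cproj_inner (S : Submodule ℂ H) (x y : H) : ⟪cproj S x, y⟫ = ⟪x, cproj S y⟫ :=
  Submodule.inner_starProjection_left_eq_right _ _ _

lemma star_inner (a : H →L[ℂ] H) (x y : H) : ⟪star a x, y⟫ = ⟪x, a y⟫ := by
  rw [ContinuousLinearMap.star_eq_adjoint, ContinuousLinearMap.adjoint_inner_left]

lemma sa_inner {a : H →L[ℂ] H} (h : IsSelfAdjoint a) (x y : H) : ⟪a x, y⟫ = ⟪x, a y⟫ := by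
  rw [← star_inner, h.star_eq]

lemma map_closure_mem {S : Submodule ℂ H} {S' : Submodule ℂ K} {a : H →L[ℂ] K} (h : ∀ x ∈ S, a x ∈ S') :
    ∀ x ∈ S.topologicalClosure, a x ∈ S'.topologicalClosure := fun _ hx =>
  map_mem_closure a.continuous hx h

lemma cproj_comm {S : Submodule ℂ H} {a : H →L[ℂ] H} (h : ∀ x ∈ S, a x ∈ S)
    (h' : ∀ x ∈ S, star a x ∈ S) : cproj S * a = a * cproj S := by
  have key : ∀ b : H →L[ℂ] H, (∀ x ∈ S, b x ∈ S) → cproj S * b * cproj S = b * cproj S := by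
    intro b hb
    ext x
    exact cproj_eq_self.2 (map_closure_mem hb _ (cproj_mem S x))
  have h1 := key a h
  have h2 := congrArg star (key (star a) h')
  simp only [star_mul, star_star, (cproj_star S).isSelfAdjoint.star_eq] at h2
  rw [← h2, ← mul_assoc, h1]

/-- cyclic subspace -/
def cyc (A : Set (H →L[ℂ] H)) (ζ : H) : Submodule ℂ H := Submodule.span ℂ ((fun a => a ζ) '' A)

lemma cyc_inv {A : Set (H →L[ℂ] H)} (hmul : ∀ a ∈ A, ∀ b ∈ A, a * b ∈ A) (ζ : H) {a} (ha : a ∈ A) :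
    ∀ x ∈ cyc A ζ, a x ∈ cyc A ζ := by
  intro x hx
  unfold cyc at hx
  induction hx using Submodule.span_induction with
  | mem y hy =>
    obtain ⟨b, hb, rfl⟩ := hy
    exact Submodule.subset_span ⟨a * b, hmul a ha b hb, rfl⟩
  | zero => simp
  | add x y _ _ hx hy => rw [map_add]; exact add_mem hx hy
  | smul c x _ hx => rw [map_smul]; exact Submodule.smul_mem _ _ hx

lemma cyc_comm {A : Set (H →L[ℂ] H)} (hmul : ∀ a ∈ A, ∀ b ∈ A, a * b ∈ A)
    (hsa : ∀ a ∈ A, IsSelfAdjoint a) (ζ : H) {a} (ha : a ∈ A) :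
    cproj (cyc A ζ) * a = a * cproj (cyc A ζ) :=
  cproj_comm (cyc_inv hmul ζ ha) (by rw [(hsa a ha).star_eq]; exact cyc_inv hmul ζ ha)

lemma cyc_self {A : Set (H →L[ℂ] H)} (h1 : 1 ∈ A) (ζ : H) : ζ ∈ cyc A ζ :=
  Submodule.subset_span ⟨1, h1, rfl⟩

lemma eqOn_closure {S : Submodule ℂ H} {a b : H →L[ℂ] K} (h : ∀ x ∈ S, a x = b x) :
    ∀ x ∈ S.topologicalClosure, a x = b x := fun _ hx =>
  closure_minimal (s := (S : Set H)) (t := {x | a x = b x}) h (isClosed_eq a.continuous b.continuous) hx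

lemma eqOn_span {S : Set H} {a b : H →L[ℂ] K} (h : ∀ x ∈ S, a x = b x) :
    ∀ x ∈ Submodule.span ℂ S, a x = b x := fun _ hx =>
  LinearMap.eqOn_span (f := a.toLinearMap) (g := b.toLinearMap) h hx

theorem lemG [TopologicalSpace.SeparableSpace H] (A : Set (H →L[ℂ] H)) (h1 : 1 ∈ A)
    (hmul : ∀ a ∈ A, ∀ b ∈ A, a * b ∈ A) (hsa : ∀ a ∈ A, IsSelfAdjoint a)
    (Y : Submodule ℂ (H →L[ℂ] H)) (hY : BCClosed Y) (Z : Set H)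
    (hZ : (Submodule.span ℂ Z).topologicalClosure = ⊤)
    (hZp : ∀ ζ ∈ Z, ∀ p : H →L[ℂ] H, IsStarProjection p → (∀ a ∈ A, p * a = a * p) → ζ - p ζ ∈ Z)
    (he : ∀ ζ ∈ Z, cproj (cyc A ζ) ∈ Y) : (1 : H →L[ℂ] H) ∈ Y := by
  rcases Z.eq_empty_or_nonempty with rfl | hne
  · have : (1 : H →L[ℂ] H) = 0 := by
      ext x
      have hx : x ∈ (Submodule.span ℂ (∅ : Set H)).topologicalClosure := by rw [hZ]; trivial
      exact eqOn_closure (eqOn_span (by simp)) x hx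
    rw [this]; exact Y.zero_mem
  have : Nonempty Z := hne.to_subtype
  have : SecondCountableTopology H := UniformSpace.secondCountable_of_separable H
  obtain ⟨u, hu⟩ := TopologicalSpace.exists_dense_seq Z
  let p : ℕ → (H →L[ℂ] H) := fun k => Nat.rec 0 (fun k q => q + cproj (cyc A ((u k : H) - q (u k)))) k
  have p0 : p 0 = 0 := rfl
  have ps : ∀ k, p (k + 1) = p k + cproj (cyc A ((u k : H) - p k (u k))) := fun k => rfl
  have inv : ∀ k, IsStarProjection (p k) ∧ (∀ a ∈ A, p k * a = a * p k) ∧ p k ∈ Y ∧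
      ∀ j < k, p k (u j) = u j := by
    intro k
    induction k with
    | zero => exact ⟨by rw [p0]; exact IsStarProjection.zero _, by simp [p0], by rw [p0]; exact Y.zero_mem, by simp⟩
    | succ k ih =>
      obtain ⟨i1, i2, i3, i4⟩ := ih
      rw [ps]
      set ζ := (u k : H) - p k (u k) with hζ
      set e := cproj (cyc A ζ) with hedef
      have hpz : p k ζ = 0 := by
        rw [hζ, map_sub]
        have := congrArg (fun f : H →L[ℂ] H => f (u k)) i1.isIdempotentElem.eq
        simp only [mul_apply_eq_comp] at this
        rw [this, sub_self]
      have hpe : p k * e = 0 := by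
        ext x
        refine eqOn_closure (a := p k) (b := 0) (eqOn_span ?_) _ (cproj_mem _ x)
        rintro _ ⟨a, ha, rfl⟩
        have := congrArg (fun f : H →L[ℂ] H => f ζ) (i2 a ha)
        simp only [mul_apply_eq_comp] at this
        simp [this, hpz]
      have hep : e * p k = 0 := by
        have := congrArg star hpe
        rwa [star_mul, star_zero, i1.isSelfAdjoint.star_eq, (cproj_star _).isSelfAdjoint.star_eq] at this
      have hepx : ∀ x, e (p k x) = 0 := fun x => congrArg (fun f : H →L[ℂ] H => f x) hep
      refine ⟨i1.add (cproj_star _) hpe, ?_, ?_, ?_⟩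
      · intro a ha
        rw [add_mul, mul_add, i2 a ha, cyc_comm hmul hsa ζ ha]
      · exact Y.add_mem i3 (he _ (hZp _ (u k).2 _ i1 i2))
      · intro j hj
        rcases Nat.lt_succ_iff_lt_or_eq.1 hj with hj | rfl
        · have := hepx (u j)
          rw [i4 j hj] at this
          simp [i4 j hj, this]
        · have h2 : e ζ = ζ := cproj_of_mem (cyc_self h1 ζ)
          have h3 : e (u j) = ζ := by
            have : (u j : H) = ζ + p j (u j) := by rw [hζ]; abel
            rw [this, map_add, hepx, h2, add_zero]
          simp [h3, hζ]
  refine hY p 1 1 (fun k => (inv k).2.2.1) (fun k => (inv k).1.norm_le _) fun x => ?_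
  refine strong_tendsto_of_dense (C := 1) (fun k => (inv k).1.norm_le _) (range fun j => (u j : H)) ?_ x ?_
  · rintro _ ⟨j, rfl⟩
    refine tendsto_const_nhds.congr' ?_
    filter_upwards [eventually_gt_atTop j] with k hk
    simp [(inv k).2.2.2 j hk]
  · have hx : x ∈ (Submodule.span ℂ Z).topologicalClosure := by rw [hZ]; trivial
    refine Submodule.topologicalClosure_minimal _ (Submodule.span_le.2 ?_) (Submodule.isClosed_topologicalClosure _) hx
    intro z hz
    have := hu ⟨z, hz⟩
    have h2 : z ∈ closure (range fun j => (u j : H)) := by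
      have := map_mem_closure continuous_subtype_val this (t := range fun j => (u j : H)) (by
        rintro _ ⟨j, rfl⟩; exact ⟨j, rfl⟩)
      exact this
    exact closure_mono Submodule.subset_span h2

end P3
end OpSynth


namespace OpSynth

open Filter Topology
open scoped ComplexInnerProductSpace Pointwise ComplexOrder
open Set

noncomputable section P4

variable {H : Type*} [NormedAddCommGroup H] [InnerProductSpace ℂ H] [CompleteSpace H]

lemma eq_cproj_tendsto {S : Set H} {f : ℕ → (H →L[ℂ] H)} (hf : ∀ n, ‖f n‖ ≤ 1)
    (h : ∀ x ∈ S, Tendsto (fun n => f n x) atTop (𝓝 x))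
    (h' : ∀ n, ∀ x ∈ (Submodule.span ℂ S)ᗮ, f n x = 0) (x : H) :
    Tendsto (fun n => f n x) atTop (𝓝 (cproj (Submodule.span ℂ S) x)) := by
  set e := cproj (Submodule.span ℂ S) with he
  have h1 := strong_tendsto_of_dense (X := 1) hf S h (e x) (cproj_mem _ x)
  refine h1.congr fun n => ?_
  have : x - e x ∈ (Submodule.span ℂ S)ᗮ := by
    rw [← cproj_eq_zero, map_sub, ← he]
    have := congrArg (fun f : H →L[ℂ] H => f x) (cproj_star (Submodule.span ℂ S)).isIdempotentElem.eq
    simp only [mul_apply_eq_comp] at this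
    rw [this, sub_self]
  have := h' n _ this
  rw [map_sub, sub_eq_zero] at this
  exact this.symm

section nest
variable {N : Set (Submodule ℂ H)} (hN : IsNest N)
include hN

lemma nest_top : (⊤ : Submodule ℂ H) ∈ N := by
  have := (hN.2.2 ∅ (empty_subset _)).1
  simpa using this

lemma nest_bot : (⊥ : Submodule ℂ H) ∈ N := by
  have := (hN.2.2 ∅ (empty_subset _)).2
  rw [sSup_empty] at this
  rwa [IsClosed.submodule_topologicalClosure_eq] at this
  simp

lemma nest_clo {p} (hp : p ∈ N) : p.topologicalClosure = p :=
  IsClosed.submodule_topologicalClosure_eq (hN.1 p hp)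

lemma nproj_mem {p} (hp : p ∈ N) (x : H) : cproj p x ∈ p := by
  have := cproj_mem p x
  rwa [nest_clo hN hp] at this

lemma nproj_self {p} (hp : p ∈ N) {x : H} : cproj p x = x ↔ x ∈ p := by
  rw [cproj_eq_self, nest_clo hN hp]

lemma nest_total {p q} (hp : p ∈ N) (hq : q ∈ N) : p ≤ q ∨ q ≤ p := by
  rcases eq_or_ne p q with rfl | h
  · exact Or.inl le_rfl
  · exact hN.2.1 hp hq h

end nest

lemma cproj_idem (p : Submodule ℂ H) (x : H) : cproj p (cproj p x) = cproj p x :=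
  cproj_eq_self.2 (cproj_mem p x)

lemma cproj_le_right {p q : Submodule ℂ H} (h : p ≤ q) (x : H) : cproj q (cproj p x) = cproj p x :=
  cproj_eq_self.2 (Submodule.topologicalClosure_mono h (cproj_mem p x))

lemma cproj_sub_mem (p : Submodule ℂ H) (x : H) : x - cproj p x ∈ pᗮ := by
  rw [← cproj_eq_zero, map_sub, cproj_idem, sub_self]

lemma cproj_le_left {p q : Submodule ℂ H} (h : p ≤ q) (x : H) : cproj p (cproj q x) = cproj p x := by
  have : x - cproj q x ∈ pᗮ := Submodule.orthogonal_le h (cproj_sub_mem q x)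
  rw [← cproj_eq_zero, map_sub, sub_eq_zero] at this
  exact this.symm

lemma cproj_norm_le (p : Submodule ℂ H) (x : H) : ‖cproj p x‖ ≤ ‖x‖ := by
  simpa using (cproj p).le_of_opNorm_le (cproj_norm p) x

/-- p ≤ q : pythagoras -/
lemma cproj_pyth {p q : Submodule ℂ H} (h : p ≤ q) (x : H) :
    ‖cproj q x - cproj p x‖ ^ 2 = ‖cproj q x‖ ^ 2 - ‖cproj p x‖ ^ 2 := by
  have h0 : ⟪cproj p x, cproj q x - cproj p x⟫ = 0 := by
    rw [cproj_inner, map_sub, cproj_le_left h, cproj_idem, sub_self, inner_zero_right]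
  have := norm_add_sq_eq_norm_sq_add_norm_sq_of_inner_eq_zero _ _ h0
  rw [add_sub_cancel] at this
  linarith

/-- compl pythagoras -/
lemma cproj_pyth' (p : Submodule ℂ H) (x : H) :
    ‖x - cproj p x‖ ^ 2 = ‖x‖ ^ 2 - ‖cproj p x‖ ^ 2 := by
  have h : cproj (⊤ : Submodule ℂ H) x = x := cproj_of_mem trivial
  have := cproj_pyth (p := p) (q := ⊤) le_top x
  rwa [h] at this

lemma inner_bound_closure {S : Submodule ℂ H} {ζ : H} {c : ℝ}
    (h : ∀ v ∈ S, ‖⟪v, ζ⟫‖ ≤ ‖v‖ * c) : ∀ v ∈ S.topologicalClosure, ‖⟪v, ζ⟫‖ ≤ ‖v‖ * c := by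
  intro v hv
  refine closure_minimal (s := (S : Set H)) (t := {v | ‖⟪v, ζ⟫‖ ≤ ‖v‖ * c}) h ?_ hv
  exact isClosed_le (by fun_prop) (by fun_prop)

lemma le_of_inner_bound {v ζ : H} {t : ℝ} (ht : 0 ≤ t) (h1 : ⟪v, ζ⟫ = (‖v‖ : ℂ) ^ 2)
    (h : ‖⟪v, ζ⟫‖ ≤ ‖v‖ * √t) : ‖v‖ ^ 2 ≤ t := by
  rw [h1] at h
  simp only [norm_pow, Complex.norm_real, norm_norm] at h
  rcases (norm_nonneg v).eq_or_lt with h0 | h0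
  · rw [← h0]; simpa
  · rw [sq] at h
    have := le_of_mul_le_mul_left h h0
    calc ‖v‖ ^ 2 ≤ (√t) ^ 2 := by gcongr
      _ = t := Real.sq_sqrt ht

lemma inner_proj_self {e : H →L[ℂ] H} (he : IsStarProjection e) (ζ : H) :
    ⟪e ζ, ζ⟫ = (‖e ζ‖ : ℂ) ^ 2 := by
  have h := congrArg (fun f : H →L[ℂ] H => f ζ) he.isIdempotentElem.eq
  simp only [mul_apply_eq_comp] at h
  rw [← h, sa_inner he.isSelfAdjoint, inner_self_eq_norm_sq_to_K, h]; rfl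

section nest2
variable {N : Set (Submodule ℂ H)} (hN : IsNest N)

def Cons (N : Set (Submodule ℂ H)) (p q : Submodule ℂ H) : Prop :=
  p ∈ N ∧ q ∈ N ∧ p < q ∧ ∀ L ∈ N, L ≤ p ∨ q ≤ L

include hN

lemma mass_ivt {ζ : H} (hζ : ∀ p q, Cons N p q → cproj q ζ = cproj p ζ) {t : ℝ} (ht : 0 ≤ t)
    (ht' : t ≤ ‖ζ‖ ^ 2) : ∃ L ∈ N, ‖cproj L ζ‖ ^ 2 = t := by
  set S1 := {L | L ∈ N ∧ ‖cproj L ζ‖ ^ 2 ≤ t} with hS1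
  set S2 := {L | L ∈ N ∧ t ≤ ‖cproj L ζ‖ ^ 2} with hS2
  have hS1N : S1 ⊆ N := fun L h => h.1
  have hS2N : S2 ⊆ N := fun L h => h.1
  set A := (sSup S1).topologicalClosure with hA
  set B := sInf S2 with hB
  have hAN : A ∈ N := (hN.2.2 S1 hS1N).2
  have hBN : B ∈ N := (hN.2.2 S2 hS2N).1
  have hbot : (⊥ : Submodule ℂ H) ∈ S1 := by
    refine ⟨nest_bot hN, ?_⟩
    have : cproj ⊥ ζ = 0 := by rw [cproj_eq_zero]; simp
    rw [this]; simpa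
  have hmA : ‖cproj A ζ‖ ^ 2 ≤ t := by
    have hb : ∀ v ∈ A, ‖⟪v, ζ⟫‖ ≤ ‖v‖ * √t := by
      refine inner_bound_closure ?_
      intro v hv
      have hdir : DirectedOn (· ≤ ·) S1 := by
        intro a ha b hb
        rcases nest_total hN ha.1 hb.1 with h | h
        · exact ⟨b, hb, h, le_rfl⟩
        · exact ⟨a, ha, le_rfl, h⟩
      obtain ⟨L, hL, hvL⟩ := (Submodule.mem_sSup_of_directed ⟨_, hbot⟩ hdir).1 hv
      have : ⟪v, ζ⟫ = ⟪v, cproj L ζ⟫ := by rw [← cproj_inner, cproj_of_mem hvL]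
      rw [this]
      refine (norm_inner_le_norm _ _).trans ?_
      gcongr
      exact Real.le_sqrt_of_sq_le hL.2
    exact le_of_inner_bound ht (inner_proj_self (cproj_star A) ζ) (hb _ (nproj_mem hN hAN ζ))
  have hmB : t ≤ ‖cproj B ζ‖ ^ 2 := by
    set T := sSup ((fun L : Submodule ℂ H => Lᗮ) '' S2) with hT
    have hTB : T.topologicalClosure = Bᗮ := by
      rw [← Submodule.orthogonal_orthogonal_eq_closure]
      congr 1
      rw [hT, ← Submodule.sInf_orthogonal, iInf_image, hB, sInf_eq_iInf]
      refine iInf_congr fun L => iInf_congr fun hL => ?_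
      rw [Submodule.orthogonal_orthogonal_eq_closure, nest_clo hN hL.1]
    have ht0 : 0 ≤ ‖ζ‖ ^ 2 - t := by linarith
    have hb : ∀ v ∈ T.topologicalClosure, ‖⟪v, ζ⟫‖ ≤ ‖v‖ * √(‖ζ‖ ^ 2 - t) := by
      refine inner_bound_closure ?_
      intro v hv
      have hdir : DirectedOn (· ≤ ·) ((fun L : Submodule ℂ H => Lᗮ) '' S2) := by
        rintro _ ⟨a, ha, rfl⟩ _ ⟨b, hb, rfl⟩
        rcases nest_total hN ha.1 hb.1 with h | h
        · exact ⟨_, ⟨a, ha, rfl⟩, le_rfl, Submodule.orthogonal_le h⟩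
        · exact ⟨_, ⟨b, hb, rfl⟩, Submodule.orthogonal_le h, le_rfl⟩
      have htop : (⊤ : Submodule ℂ H) ∈ S2 := by
        refine ⟨nest_top hN, ?_⟩
        rw [cproj_of_mem (show ζ ∈ (⊤ : Submodule ℂ H) from trivial)]
        exact ht'
      obtain ⟨_, ⟨L, hL, rfl⟩, hvL⟩ := (Submodule.mem_sSup_of_directed (Set.Nonempty.image _ ⟨_, htop⟩) hdir).1 hv
      have : ⟪v, ζ⟫ = ⟪v, ζ - cproj L ζ⟫ := by
        rw [inner_sub_right, ← cproj_inner, cproj_eq_zero.2 hvL]; simp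
      rw [this]
      refine (norm_inner_le_norm _ _).trans ?_
      gcongr
      refine Real.le_sqrt_of_sq_le ?_
      rw [cproj_pyth']
      linarith [hL.2]
    have hp := (cproj_star B).one_sub
    have h1 := le_of_inner_bound ht0 (inner_proj_self hp ζ) (hb _ (by
      rw [hTB]; exact cproj_sub_mem B ζ))
    have h2 := cproj_pyth' B ζ
    have h3 : (1 - cproj B) ζ = ζ - cproj B ζ := rfl
    rw [h3, h2] at h1
    linarith
  rcases nest_total hN hBN hAN with h | h
  · refine ⟨B, hBN, le_antisymm ?_ hmB⟩
    have := cproj_pyth h ζ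
    nlinarith [sq_nonneg ‖cproj A ζ - cproj B ζ‖]
  · rcases h.eq_or_lt with h | h
    · rw [h] at hmA
      exact ⟨B, hBN, le_antisymm hmA hmB⟩
    · have : Cons N A B := ⟨hAN, hBN, h, fun L hL => by
        rcases le_total (‖cproj L ζ‖ ^ 2) t with h | h
        · exact Or.inl ((le_sSup (show L ∈ S1 from ⟨hL, h⟩)).trans (Submodule.le_topologicalClosure _))
        · exact Or.inr (sInf_le ⟨hL, h⟩)⟩
      have := hζ _ _ this
      rw [this] at hmB
      exact ⟨A, hAN, le_antisymm hmA hmB⟩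

lemma nest_mono {p q} (hp : p ∈ N) (hq : q ∈ N) {ζ : H} (h : ‖cproj p ζ‖ ^ 2 < ‖cproj q ζ‖ ^ 2) : p ≤ q := by
  rcases nest_total hN hp hq with h' | h'
  · exact h'
  · have := cproj_pyth h' ζ
    nlinarith [sq_nonneg ‖cproj p ζ - cproj q ζ‖]

lemma nest_dist {p q} (hp : p ∈ N) (hq : q ∈ N) (ζ : H) :
    ‖cproj p ζ - cproj q ζ‖ ^ 2 = |‖cproj p ζ‖ ^ 2 - ‖cproj q ζ‖ ^ 2| := by
  rcases nest_total hN hp hq with h' | h'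
  · have := cproj_pyth h' ζ
    rw [← norm_neg, neg_sub, this, abs_sub_comm, abs_of_nonneg]
    rw [← this]; positivity
  · have := cproj_pyth h' ζ
    rw [this, abs_of_nonneg]
    rw [← this]; positivity

def nprojs (N : Set (Submodule ℂ H)) : Set (H →L[ℂ] H) := cproj '' N

lemma step_exists {ζ : H} (hζ0 : ζ ≠ 0) (hζ : ∀ p q, Cons N p q → cproj q ζ = cproj p ζ)
    (Y : Submodule ℂ (H →L[ℂ] H))
    (hr : ∀ p ∈ N, ∀ y ∈ p, ∀ x : H, (∀ L ∈ N, x ∈ Lᗮ ∨ p ≤ L) → InnerProductSpace.rankOne ℂ y x ∈ Y) (n : ℕ) :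
    ∃ R ∈ Y, ‖R‖ ≤ 1 ∧ (∀ p ∈ N, ‖R (cproj p ζ) - cproj p ζ‖ ≤ 3 * √(‖ζ‖ ^ 2 / (n + 1))) ∧
      ∀ x ∈ (cyc (nprojs N) ζ)ᗮ, R x = 0 := by
  set δ := ‖ζ‖ ^ 2 / (n + 1) with hδ
  have hδ0 : 0 < δ := by have := norm_pos_iff.2 hζ0; positivity
  have hδn : δ * (n + 1) = ‖ζ‖ ^ 2 := by rw [hδ]; field_simp
  have hex : ∀ i : ℕ, ∃ L ∈ N, i ≤ n + 1 → ‖cproj L ζ‖ ^ 2 = i * δ := by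
    intro i
    by_cases hi : i ≤ n + 1
    · have hi' : (i : ℝ) ≤ n + 1 := by exact_mod_cast hi
      obtain ⟨L, h1, h2⟩ := mass_ivt hN hζ (t := i * δ) (by positivity) (by rw [← hδn]; nlinarith)
      exact ⟨L, h1, fun _ => h2⟩
    · exact ⟨⊤, nest_top hN, fun h => absurd h hi⟩
  choose L hLN hLm using hex
  have hle : ∀ i j, i ≤ j → j ≤ n + 1 → L i ≤ L j := by
    intro i j hij hj
    rcases hij.eq_or_lt with rfl | hij
    · exact le_rfl
    · refine nest_mono hN (hLN _) (hLN _) (ζ := ζ) ?_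
      rw [hLm i (by omega), hLm j hj]
      have : (i : ℝ) < j := by exact_mod_cast hij
      gcongr
  set z : ℕ → H := fun i => cproj (L (i + 1)) ζ - cproj (L i) ζ with hz
  have hz1 : ∀ i, i ≤ n → z i ∈ L (i + 1) := fun i hi =>
    sub_mem (nproj_mem hN (hLN _) _) (hle i (i + 1) (by omega) (by omega) (nproj_mem hN (hLN _) _))
  have hz2 : ∀ i, i ≤ n → z i ∈ (L i)ᗮ := by
    intro i hi
    rw [← cproj_eq_zero, hz]
    simp only [map_sub]
    rw [cproj_le_left (hle i (i + 1) (by omega) (by omega)), cproj_idem, sub_self]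
  have hzn : ∀ i, i ≤ n → ‖z i‖ ^ 2 = δ := by
    intro i hi
    rw [hz]
    simp only
    rw [cproj_pyth (hle i (i + 1) (by omega) (by omega)), hLm _ (by omega), hLm _ (by omega)]
    push_cast; ring
  have hzo : ∀ i j, i < j → j ≤ n → ⟪z i, z j⟫ = 0 := fun i j hij hj =>
    hz2 j hj _ (hle (i + 1) j (by omega) (by omega) (hz1 i (by omega)))
  have hzo' : ∀ i j, i ≠ j → i ≤ n → j ≤ n → ⟪z i, z j⟫ = 0 := by
    intro i j hij hi hj
    rcases lt_or_gt_of_ne hij with h | h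
    · exact hzo i j h hj
    · rw [← inner_conj_symm, hzo j i h hi, map_zero]
  have hzi : ∀ i, i ≤ n → ⟪z i, z i⟫ = (δ : ℂ) := by
    intro i hi
    rw [inner_self_eq_norm_sq_to_K, ← hzn i hi]; push_cast; rfl
  -- orthonormal family
  have horth : Orthonormal ℂ (fun i : Fin (n + 1) => ((√δ : ℂ)⁻¹ : ℂ) • z i) := by
    have hs : ((√δ : ℝ) : ℂ) * (√δ : ℝ) = δ := by rw [← Complex.ofReal_mul, Real.mul_self_sqrt hδ0.le]
    have hs0 : ((√δ : ℝ) : ℂ) ≠ 0 := by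
      have := Real.sqrt_pos.2 hδ0
      exact_mod_cast this.ne'
    rw [orthonormal_iff_ite]
    intro i j
    rw [inner_smul_left, inner_smul_right]
    split_ifs with h
    · subst h
      rw [hzi _ (by omega), ← hs]
      simp only [map_inv₀, Complex.conj_ofReal]
      field_simp
    · rw [hzo' _ _ (fun h' => h (Fin.ext h')) (by omega) (by omega)]; simp
  set R : H →L[ℂ] H := ∑ i ∈ Finset.range n, ((δ : ℂ)⁻¹) • InnerProductSpace.rankOne ℂ (z i) (z (i + 1)) with hR
  have hRx : ∀ x, R x = ∑ i ∈ Finset.range n, ((δ : ℂ)⁻¹ * ⟪z (i + 1), x⟫) • z i := by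
    intro x
    simp [hR, ContinuousLinearMap.sum_apply, smul_smul]
  have bessel : ∀ x, ∑ i ∈ Finset.range (n + 1), ‖⟪z i, x⟫‖ ^ 2 ≤ δ * ‖x‖ ^ 2 := by
    intro x
    have h := horth.sum_inner_products_le x (s := Finset.univ)
    rw [Fin.sum_univ_eq_sum_range (fun i => ‖⟪((√δ : ℂ)⁻¹ : ℂ) • z i, x⟫‖ ^ 2) (n + 1)] at h
    have h2 : ∀ i, ‖⟪((√δ : ℂ)⁻¹ : ℂ) • z i, x⟫‖ ^ 2 = δ⁻¹ * ‖⟪z i, x⟫‖ ^ 2 := by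
      intro i
      rw [inner_smul_left, norm_mul, mul_pow]
      congr 1
      simp [Real.sq_sqrt hδ0.le, abs_of_nonneg, Real.sqrt_nonneg]
    simp only [h2] at h
    rw [← Finset.mul_sum] at h
    rwa [inv_mul_le_iff₀ hδ0] at h
  have hRnorm : ‖R‖ ≤ 1 := by
    refine ContinuousLinearMap.opNorm_le_bound _ zero_le_one fun x => ?_
    have b1 : ∑ i ∈ Finset.range n, ‖⟪z (i + 1), x⟫‖ ^ 2 ≤ δ * ‖x‖ ^ 2 := by
      refine le_trans ?_ (bessel x)
      rw [Finset.sum_range_succ']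
      exact le_add_of_nonneg_right (by positivity)
    have b2 : ∑ i ∈ Finset.range n, ‖⟪z i, R x⟫‖ ^ 2 ≤ δ * ‖R x‖ ^ 2 := by
      refine le_trans ?_ (bessel (R x))
      rw [Finset.sum_range_succ]
      exact le_add_of_nonneg_right (by positivity)
    have e : ‖R x‖ ^ 2 ≤ δ⁻¹ * ∑ i ∈ Finset.range n, ‖⟪z (i + 1), x⟫‖ * ‖⟪z i, R x⟫‖ := by
      have e1 : ‖R x‖ ^ 2 = ‖⟪R x, R x⟫‖ := by
        rw [inner_self_eq_norm_sq_to_K]; simp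
      rw [e1]
      conv_lhs => rw [show ⟪R x, R x⟫ = ⟪∑ i ∈ Finset.range n, ((δ : ℂ)⁻¹ * ⟪z (i + 1), x⟫) • z i, R x⟫ by rw [← hRx]]
      rw [sum_inner, Finset.mul_sum]
      refine (norm_sum_le _ _).trans (Finset.sum_le_sum fun i _ => le_of_eq ?_)
      rw [inner_smul_left, norm_mul, RCLike.norm_conj, norm_mul, mul_assoc, norm_inv, Complex.norm_real,
        Real.norm_of_nonneg hδ0.le]
    have e2 : ‖R x‖ ^ 2 ≤ ‖x‖ * ‖R x‖ := by
      refine e.trans ?_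
      rw [inv_mul_le_iff₀ hδ0]
      refine (Real.sum_mul_le_sqrt_mul_sqrt _ _ _).trans ?_
      refine (mul_le_mul (Real.sqrt_le_sqrt b1) (Real.sqrt_le_sqrt b2) (Real.sqrt_nonneg _) (Real.sqrt_nonneg _)).trans ?_
      rw [Real.sqrt_mul hδ0.le, Real.sqrt_mul hδ0.le, Real.sqrt_sq (norm_nonneg _), Real.sqrt_sq (norm_nonneg _)]
      have := Real.mul_self_sqrt hδ0.le
      refine le_of_eq ?_
      calc _ = (√δ * √δ) * (‖x‖ * ‖R x‖) := by ring
        _ = _ := by rw [this]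
    rw [one_mul]
    rcases (norm_nonneg (R x)).eq_or_lt with h0 | h0
    · rw [← h0]; positivity
    · rw [sq] at e2
      exact le_of_mul_le_mul_right e2 h0
  have hRz0 : R (z 0) = 0 := by
    rw [hRx]
    refine Finset.sum_eq_zero fun i hi => ?_
    rw [Finset.mem_range] at hi
    rw [hzo' _ _ (by omega) (by omega) (by omega)]; simp
  have hRz : ∀ j < n, R (z (j + 1)) = z j := by
    intro j hj
    rw [hRx, Finset.sum_eq_single j]
    · rw [hzi _ (by omega), inv_mul_cancel₀ (by exact_mod_cast hδ0.ne'), one_smul]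
    · intro i hi hij
      rw [Finset.mem_range] at hi
      rw [hzo' _ _ (by omega) (by omega) (by omega)]; simp
    · intro h; exact absurd (Finset.mem_range.2 hj) h
  have hP0 : cproj (L 0) ζ = 0 := by
    have := hLm 0 (by omega)
    simpa using this
  have hP1 : ∀ k ≤ n, R (cproj (L (k + 1)) ζ) = cproj (L k) ζ := by
    intro k hk
    induction k with
    | zero =>
      have : cproj (L (0 + 1)) ζ = z 0 + cproj (L 0) ζ := by simp [hz]
      rw [this, map_add, hRz0, hP0, map_zero, add_zero]
    | succ k ih =>
      have : cproj (L (k + 1 + 1)) ζ = z (k + 1) + cproj (L (k + 1)) ζ := by simp [hz]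
      rw [this, map_add, hRz k (by omega), ih (by omega)]
      simp [hz]
  have hzle : ∀ i ≤ n, ‖z i‖ ≤ √δ := fun i hi => Real.le_sqrt_of_sq_le (hzn i hi).le
  have hP2 : ∀ k ≤ n + 1, ‖R (cproj (L k) ζ) - cproj (L k) ζ‖ ≤ √δ := by
    intro k hk
    rcases k with _ | k
    · rw [hP0]; simp
    · rw [hP1 k (by omega), ← norm_neg, neg_sub]
      exact hzle k (by omega)
  refine ⟨R, ?_, hRnorm, ?_, ?_⟩
  · refine Submodule.sum_mem _ fun i hi => Submodule.smul_mem _ _ ?_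
    rw [Finset.mem_range] at hi
    refine hr (L (i + 1)) (hLN _) _ (hz1 i (by omega)) _ fun M hM => ?_
    rcases nest_total hN hM (hLN (i + 1)) with h | h
    · exact Or.inl (Submodule.orthogonal_le h (hz2 (i + 1) (by omega)))
    · exact Or.inr h
  · intro p hp
    have hm : ‖cproj p ζ‖ ^ 2 ≤ δ * (n + 1) := by
      rw [hδn]; gcongr; exact cproj_norm_le _ _
    set k := ⌊‖cproj p ζ‖ ^ 2 / δ⌋₊ with hk
    have hk0 : (k : ℝ) ≤ ‖cproj p ζ‖ ^ 2 / δ := Nat.floor_le (by positivity)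
    have hk1 : ‖cproj p ζ‖ ^ 2 / δ < k + 1 := Nat.lt_floor_add_one _
    rw [le_div_iff₀ hδ0] at hk0
    rw [div_lt_iff₀ hδ0] at hk1
    have hkn : k ≤ n + 1 := by
      have : (k : ℝ) ≤ n + 1 := le_of_mul_le_mul_right (by linarith) hδ0
      exact_mod_cast this
    have hd : ‖cproj p ζ - cproj (L k) ζ‖ ≤ √δ := by
      refine Real.le_sqrt_of_sq_le ?_
      rw [nest_dist hN hp (hLN k), hLm k hkn, abs_of_nonneg (by linarith)]
      linarith
    have e1 : R (cproj p ζ) - cproj p ζ = R (cproj p ζ - cproj (L k) ζ) - (cproj p ζ - cproj (L k) ζ)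
        + (R (cproj (L k) ζ) - cproj (L k) ζ) := by simp only [map_sub]; abel
    have e2 := R.le_of_opNorm_le hRnorm (cproj p ζ - cproj (L k) ζ)
    rw [e1]
    refine (norm_add_le _ _).trans ((add_le_add_left (norm_sub_le _ _) _).trans ?_)
    linarith [hP2 k hkn]
  · intro x hx
    rw [hRx]
    refine Finset.sum_eq_zero fun i hi => ?_
    have : z (i + 1) ∈ cyc (nprojs N) ζ :=
      sub_mem (Submodule.subset_span ⟨_, ⟨_, hLN _, rfl⟩, rfl⟩) (Submodule.subset_span ⟨_, ⟨_, hLN _, rfl⟩, rfl⟩)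
    rw [hx _ this]; simp

theorem lemE [TopologicalSpace.SeparableSpace H] (Y : Submodule ℂ (H →L[ℂ] H)) (hY : BCClosed Y)
    (hr : ∀ p ∈ N, ∀ y ∈ p, ∀ x : H, (∀ L ∈ N, x ∈ Lᗮ ∨ p ≤ L) → InnerProductSpace.rankOne ℂ y x ∈ Y) :
    (1 : H →L[ℂ] H) ∈ Y := by
  set Z1 : Set H := {ζ | ∃ p q, Cons N p q ∧ ζ ∈ q ∧ ζ ∈ pᗮ} with hZ1
  set Z2 : Set H := {ζ | ∀ x ∈ Z1, ⟪x, ζ⟫ = 0} with hZ2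
  refine lemG (nprojs N) ?_ ?_ ?_ Y hY (Z1 ∪ Z2) ?_ ?_ ?_
  · refine ⟨⊤, nest_top hN, ?_⟩
    ext x; exact cproj_of_mem trivial
  · rintro _ ⟨p, hp, rfl⟩ _ ⟨q, hq, rfl⟩
    rcases nest_total hN hp hq with h | h
    · exact ⟨p, hp, by ext x; exact (cproj_le_left h x).symm⟩
    · exact ⟨q, hq, by ext x; exact (cproj_le_right h x).symm⟩
  · rintro _ ⟨p, hp, rfl⟩
    exact (cproj_star p).isSelfAdjoint
  · rw [Submodule.topologicalClosure_eq_top_iff, Submodule.eq_bot_iff]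
    intro w hw
    have hw' : ∀ x ∈ Z1 ∪ Z2, ⟪x, w⟫ = 0 := fun x hx => hw x (Submodule.subset_span hx)
    exact inner_self_eq_zero.1 (hw' w (Or.inr fun x hx => hw' x (Or.inl hx)))
  · intro ζ hζ p hp hc
    have hc' : ∀ q ∈ N, ∀ x, cproj q (p x) = p (cproj q x) := fun q hq x =>
      (congrArg (fun f : H →L[ℂ] H => f x) (hc _ ⟨q, hq, rfl⟩)).symm
    have hpZ : ∀ x ∈ Z1, p x ∈ Z1 := by
      rintro x ⟨a, b, hab, h1, h2⟩
      refine ⟨a, b, hab, ?_, ?_⟩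
      · rw [← nproj_self hN hab.2.1] at h1 ⊢
        rw [hc' _ hab.2.1, h1]
      · rw [← cproj_eq_zero] at h2 ⊢
        rw [hc' _ hab.1, h2, map_zero]
    rcases hζ with hζ | hζ
    · left
      obtain ⟨a, b, hab, h1, h2⟩ := hζ
      refine ⟨a, b, hab, sub_mem h1 ?_, sub_mem h2 ?_⟩
      · rw [← nproj_self hN hab.2.1] at h1 ⊢
        rw [hc' _ hab.2.1, h1]
      · rw [← cproj_eq_zero] at h2 ⊢
        rw [hc' _ hab.1, h2, map_zero]
    · right
      intro x hx
      rw [inner_sub_right, hζ x hx, ← sa_inner hp.isSelfAdjoint, hζ _ (hpZ x hx), sub_zero]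
  · intro ζ hζ
    by_cases hζ0 : ζ = 0
    · have : cproj (cyc (nprojs N) ζ) = 0 := by
        ext x
        have hc : cyc (nprojs N) ζ = ⊥ := by
          rw [hζ0]; refine Submodule.span_eq_bot.2 ?_
          rintro _ ⟨a, _, rfl⟩; simp
        rw [hc]; exact cproj_eq_zero.2 (by simp)
      rw [this]; exact Y.zero_mem
    rcases hζ with ⟨p, q, hpq, h1, h2⟩ | hζ
    · set R : H →L[ℂ] H := ((‖ζ‖ : ℂ) ^ 2)⁻¹ • InnerProductSpace.rankOne ℂ ζ ζ with hR
      have hRY : R ∈ Y := by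
        refine Y.smul_mem _ (hr q hpq.2.1 ζ h1 ζ fun L hL => ?_)
        rcases hpq.2.2.2 L hL with h | h
        · exact Or.inl (Submodule.orthogonal_le h h2)
        · exact Or.inr h
      have hRζ : R ζ = ζ := by
        have : (‖ζ‖ : ℂ) ≠ 0 := by exact_mod_cast norm_ne_zero_iff.2 hζ0
        simp [hR, smul_smul, this]
      have hRn : ‖R‖ ≤ 1 := by
        have := norm_ne_zero_iff.2 hζ0
        rw [hR, norm_smul, InnerProductSpace.norm_rankOne]
        simp only [norm_inv, norm_pow, Complex.norm_real, norm_norm]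
        field_simp; rfl
      have hcyc : ∀ a ∈ nprojs N, a ζ = 0 ∨ a ζ = ζ := by
        rintro _ ⟨L, hL, rfl⟩
        rcases hpq.2.2.2 L hL with h | h
        · exact Or.inl (cproj_eq_zero.2 (Submodule.orthogonal_le h h2))
        · exact Or.inr (cproj_of_mem (h h1))
      refine hY (fun _ => R) _ 1 (fun _ => hRY) (fun _ => hRn) ?_
      refine eq_cproj_tendsto (fun _ => hRn) ?_ ?_
      · rintro _ ⟨a, ha, rfl⟩
        rcases hcyc a ha with h | h
        · simp only [h, map_zero]; exact tendsto_const_nhds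
        · simp only [h, hRζ]; exact tendsto_const_nhds
      · intro _ x hx
        have : ⟪ζ, x⟫ = 0 := hx _ (cyc_self (A := nprojs N) ⟨⊤, nest_top hN, by ext x; exact cproj_of_mem trivial⟩ ζ)
        simp [hR, this]
    · have hζ' : ∀ p q, Cons N p q → cproj q ζ = cproj p ζ := by
        intro p q hpq
        have hle := hpq.2.2.1.le
        have h0 := hζ (cproj q ζ - cproj p ζ) ⟨p, q, hpq,
          sub_mem (nproj_mem hN hpq.2.1 _) (hle (nproj_mem hN hpq.1 _)), by
          rw [← cproj_eq_zero, map_sub, cproj_le_left hle, cproj_idem, sub_self]⟩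
        have hs : IsStarProjection (cproj q - cproj p) := by
          refine IsStarProjection.sub_of_mul_eq_left (cproj_star _) (cproj_star _) ?_
          ext x; exact cproj_le_left hle x
        have := inner_proj_self hs ζ
        rw [show (cproj q - cproj p) ζ = cproj q ζ - cproj p ζ from rfl, h0] at this
        have h3 : ‖cproj q ζ - cproj p ζ‖ ^ 2 = 0 := by exact_mod_cast this.symm
        exact sub_eq_zero.1 (norm_eq_zero.1 (pow_eq_zero_iff (by norm_num) |>.1 h3))
      choose R hRY hRn hRc hR0 using step_exists hN hζ0 hζ' Y hr
      refine hY R _ 1 hRY hRn (eq_cproj_tendsto hRn ?_ hR0)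
      rintro _ ⟨_, ⟨p, hp, rfl⟩, rfl⟩
      rw [tendsto_iff_norm_sub_tendsto_zero]
      refine squeeze_zero (fun _ => norm_nonneg _) (fun n => hRc n p hp) ?_
      have h1 : Tendsto (fun n : ℕ => ‖ζ‖ ^ 2 / ((n : ℝ) + 1)) atTop (𝓝 0) :=
        tendsto_const_nhds.div_atTop (tendsto_atTop_add_const_right _ _ tendsto_natCast_atTop_atTop)
      have h2 := (Real.continuous_sqrt.tendsto 0).comp h1
      have h3 := h2.const_mul 3
      simpa using h3

end nest2

end P4
end OpSynth


namespace OpSynth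

open Filter Topology
open scoped ComplexInnerProductSpace Pointwise ComplexOrder
open Set

noncomputable section P5

section
variable {H : Type*} [NormedAddCommGroup H] [InnerProductSpace ℂ H] [CompleteSpace H]

lemma IsMasa.mem_of_comm {D : StarSubalgebra ℂ (H →L[ℂ] H)} (hD : IsMasa D) {p : H →L[ℂ] H}
    (hp : IsSelfAdjoint p) (hc : ∀ d ∈ D, p * d = d * p) : p ∈ D := by
  have h1 : ∀ a ∈ (D : Set (H →L[ℂ] H)) ∪ {p}, ∀ b ∈ (D : Set (H →L[ℂ] H)) ∪ {p}, a * b = b * a := by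
    rintro a (ha | rfl) b (hb | rfl)
    · exact hD.1 a ha b hb
    · exact (hc a ha).symm
    · exact hc b hb
    · rfl
  have h2 : ∀ b ∈ (D : Set (H →L[ℂ] H)) ∪ {p}, star b ∈ (D : Set (H →L[ℂ] H)) ∪ {p} := by
    rintro b (hb | rfl)
    · exact Or.inl (star_mem hb)
    · rw [hp.star_eq]; exact Or.inr rfl
  have h3 := StarAlgebra.isMulCommutative_adjoin ℂ h1 (fun a ha b hb => h1 a ha _ (h2 b hb))
  have h4 := hD.2 (StarAlgebra.adjoin ℂ ((D : Set (H →L[ℂ] H)) ∪ {p})) (fun a ha b hb => by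
    exact congrArg Subtype.val (h3.is_comm.comm ⟨a, ha⟩ ⟨b, hb⟩))
    (fun d hd => StarAlgebra.subset_adjoin ℂ _ (Or.inl hd))
  rw [← h4]
  exact StarAlgebra.subset_adjoin ℂ _ (Or.inr rfl)

lemma IsMasa.cproj_mem {D : StarSubalgebra ℂ (H →L[ℂ] H)} (hD : IsMasa D) {S : Submodule ℂ H}
    (h : ∀ d ∈ D, ∀ x ∈ S, d x ∈ S) : cproj S ∈ D :=
  hD.mem_of_comm (cproj_star S).isSelfAdjoint fun d hd =>
    cproj_comm (h d hd) (h _ (star_mem hd))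
end

variable {H₁ H₂ : Type*}
  [NormedAddCommGroup H₁] [InnerProductSpace ℂ H₁] [CompleteSpace H₁]
  [NormedAddCommGroup H₂] [InnerProductSpace ℂ H₂] [CompleteSpace H₂]

/-- Z ↦ X Z A -/
def sandL (X : H₁ →L[ℂ] H₂) (A : H₁ →L[ℂ] H₁) : (H₁ →L[ℂ] H₁) →ₗ[ℂ] (H₁ →L[ℂ] H₂) where
  toFun Z := X ∘L Z ∘L A
  map_add' a b := by ext; simp
  map_smul' c a := by ext; simp

lemma bc_sand {M : Set (H₁ →L[ℂ] H₂)} (hM : IsWkClosedSubspace M) (X : H₁ →L[ℂ] H₂) (A : H₁ →L[ℂ] H₁) :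
    BCClosed (hM.sub.comap (sandL X A)) := by
  intro Z Z' C h1 h2 h3
  refine hM.bc (fun n => X ∘L Z n ∘L A) _ (‖X‖ * (C * ‖A‖)) h1 (fun n => ?_) fun x => ?_
  · refine (ContinuousLinearMap.opNorm_comp_le _ _).trans ?_
    gcongr
    refine (ContinuousLinearMap.opNorm_comp_le _ _).trans ?_
    gcongr
    exact h2 n
  · exact (X.continuous.tendsto _).comp (h3 (A x))

lemma rankOne_mem_closure {M : Set (H₁ →L[ℂ] H₂)} (hM : IsWkClosedSubspace M) {S : Submodule ℂ H₂} {x : H₁}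
    (h : ∀ y ∈ S, InnerProductSpace.rankOne ℂ y x ∈ M) :
    ∀ y ∈ S.topologicalClosure, InnerProductSpace.rankOne ℂ y x ∈ M := by
  intro y hy
  obtain ⟨u, hu, hlim⟩ := mem_closure_iff_seq_limit.1 hy
  obtain ⟨C, hC⟩ := hlim.norm.bddAbove_range
  refine hM.bc (fun n => InnerProductSpace.rankOne ℂ (u n) x) _ (C * ‖x‖) (fun n => h _ (hu n)) (fun n => ?_) fun v => ?_
  · rw [InnerProductSpace.norm_rankOne]
    gcongr
    exact hC ⟨n, rfl⟩
  · simp only [InnerProductSpace.rankOne_apply]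
    exact hlim.const_smul _

theorem nest_lemma [TopologicalSpace.SeparableSpace H₁]
    {D₁ : StarSubalgebra ℂ (H₁ →L[ℂ] H₁)} {D₂ : StarSubalgebra ℂ (H₂ →L[ℂ] H₂)}
    (hD₁ : IsMasa D₁) (hD₂ : IsMasa D₂) {M : Set (H₁ →L[ℂ] H₂)}
    (hM : IsMasaBimodule D₁ D₂ M) (hn : IsNestBimodule M) :
    ∃ (I : Set (Submodule ℂ H₁)) (P : I → (H₁ →L[ℂ] H₁)) (Q : I → (H₂ →L[ℂ] H₂)),
      (∀ i, P i ∈ D₁ ∧ IsStarProjection (P i)) ∧ (∀ i, Q i ∈ D₂ ∧ IsStarProjection (Q i)) ∧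
      (∀ i, ∀ b ∈ M, (1 - Q i) ∘L b ∘L P i = 0) ∧
      (∀ i X, Q i ∘L X ∘L (1 - P i) ∈ M) ∧
      (∀ X, (∀ i, Q i ∘L X = X ∘L P i) → X ∈ M) := by
  obtain ⟨hMs, N₁, N₂, hN₁, hN₂, hb⟩ := hn
  have hbr : ∀ X ∈ M, ∀ A ∈ nestAlg N₁, X ∘L A ∈ M := by
    intro X hX A hA
    have := hb X hX A hA 1 (fun p _ x hx => hx)
    exact this
  set φ : N₁ → Submodule ℂ H₂ := fun N => Submodule.span ℂ {y | ∃ b ∈ M, ∃ n ∈ N.1, y = b n} with hφ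
  set σ : N₁ → Submodule ℂ H₁ := fun N =>
    { carrier := {x | ∀ b ∈ M, b x ∈ (φ N).topologicalClosure}
      zero_mem' := fun b _ => by rw [map_zero]; exact zero_mem _
      add_mem' := fun ha hb b hbM => by rw [map_add]; exact add_mem (ha b hbM) (hb b hbM)
      smul_mem' := fun c x hx b hbM => by rw [map_smul]; exact Submodule.smul_mem _ _ (hx b hbM) } with hσ
  have hσc : ∀ N, IsClosed (σ N : Set H₁) := by
    intro N
    have : (σ N : Set H₁) = ⋂ b ∈ M, {x | b x ∈ (φ N).topologicalClosure} := by
      ext x; simp [hσ]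
    rw [this]
    exact isClosed_biInter fun b _ => (Submodule.isClosed_topologicalClosure _).preimage b.continuous
  have hNσ : ∀ N : N₁, N.1 ≤ σ N := fun N x hx b hbM =>
    Submodule.le_topologicalClosure _ (Submodule.subset_span ⟨b, hbM, x, hx, rfl⟩)
  -- (0)
  have fact0 : ∀ N : N₁, ∀ x, (∀ L ∈ N₁, x ∈ Lᗮ ∨ N.1 ≤ L) → ∀ y ∈ (φ N).topologicalClosure,
      InnerProductSpace.rankOne ℂ y x ∈ M := by
    intro N x hx
    refine rankOne_mem_closure hMs fun y hy => ?_
    induction hy using Submodule.span_induction with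
    | mem y hy =>
      obtain ⟨b, hbM, n, hnN, rfl⟩ := hy
      have : InnerProductSpace.rankOne ℂ (b n) x = b ∘L InnerProductSpace.rankOne ℂ n x := by
        ext v; simp
      rw [this]
      refine hbr b hbM _ fun L hL v hv => ?_
      rcases hx L hL with h | h
      · have : ⟪x, v⟫ = 0 := by rw [← inner_conj_symm, h v hv, map_zero]
        simp [this]
      · rw [InnerProductSpace.rankOne_apply]
        exact Submodule.smul_mem _ _ (h hnN)
    | zero => rw [map_zero]; exact hMs.sub.zero_mem
    | add a b _ _ ha hb => rw [map_add]; exact hMs.sub.add_mem ha hb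
    | smul c a _ ha => rw [map_smul]; exact hMs.sub.smul_mem c ha
  have hQ : ∀ N, cproj (φ N) ∈ D₂ := by
    intro N
    refine hD₂.cproj_mem fun d hd x hx => ?_
    induction hx using Submodule.span_induction with
    | mem y hy =>
      obtain ⟨b, hbM, n, hnN, rfl⟩ := hy
      exact Submodule.subset_span ⟨d ∘L b ∘L 1, hM.2 b hbM 1 (one_mem _) d hd, n, hnN, rfl⟩
    | zero => rw [map_zero]; exact zero_mem _
    | add a b _ _ ha hb => rw [map_add]; exact add_mem ha hb
    | smul c a _ ha => rw [map_smul]; exact Submodule.smul_mem _ _ ha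
  have hP : ∀ N, cproj (σ N) ∈ D₁ := by
    intro N
    refine hD₁.cproj_mem fun d hd x hx b hbM => ?_
    exact hx (1 ∘L b ∘L d) (hM.2 b hbM d hd 1 (one_mem _))
  have hPm : ∀ N x, cproj (σ N) x ∈ σ N := by
    intro N x
    have := cproj_mem (σ N) x
    rwa [(hσc N).submodule_topologicalClosure_eq] at this
  refine ⟨N₁, fun N => cproj (σ N), fun N => cproj (φ N), fun N => ⟨hP N, cproj_star _⟩,
    fun N => ⟨hQ N, cproj_star _⟩, ?_, ?_, ?_⟩
  · intro N b hbM
    ext x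
    have := hPm N x b hbM
    rw [← cproj_eq_self] at this
    simp [this]
  · intro N X
    have key := lemG {1} rfl (by simp) (by simp) _ (bc_sand hMs (cproj (φ N) ∘L X) (1 - cproj (σ N))) univ
      (by rw [Submodule.span_univ]; exact top_le_iff.1 (Submodule.le_topologicalClosure _)) (by simp) ?_
    · exact key
    · intro ζ _
      have hm : cproj (φ N) ∘L X ∘L (InnerProductSpace.rankOne ℂ ζ ζ) ∘L (1 - cproj (σ N)) ∈ M := by
        have : cproj (φ N) ∘L X ∘L (InnerProductSpace.rankOne ℂ ζ ζ) ∘L (1 - cproj (σ N)) =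
            InnerProductSpace.rankOne ℂ (cproj (φ N) (X ζ)) (ζ - cproj (σ N) ζ) := by
          ext v
          simp [inner_sub_left, inner_sub_right, cproj_inner, sub_smul]
        rw [this]
        refine fact0 N _ ?_ _ (cproj_mem _ _)
        intro L hL
        rcases nest_total hN₁ hL N.2 with h | h
        · exact Or.inl (Submodule.orthogonal_le (h.trans (hNσ N)) (cproj_sub_mem _ _))
        · exact Or.inr h
      have hc : cproj (cyc {1} ζ) = ((‖ζ‖ : ℂ) ^ 2)⁻¹ • InnerProductSpace.rankOne ℂ ζ ζ := by
        have : cyc {1} ζ = Submodule.span ℂ {ζ} := by simp [cyc]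
        rw [this]
        ext v
        have aux : ∀ (S : Submodule ℂ H₁) (_ : S = Submodule.span ℂ {ζ}) [S.HasOrthogonalProjection],
            S.starProjection v = (Submodule.span ℂ {ζ}).starProjection v := by
          intro S hS _; subst hS; rfl
        rw [cproj, aux _ (Submodule.closed_of_finiteDimensional _).submodule_topologicalClosure_eq,
          Submodule.starProjection_singleton]
        simp [smul_smul, div_eq_inv_mul]
      rw [hc]
      refine Submodule.smul_mem _ _ ?_
      exact hm
  · intro X hX
    have key := lemE hN₁ (hMs.sub.comap (sandL X 1)) (bc_sand hMs X 1) ?_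
    · exact key
    · intro N hN n hn x hx
      have h1 : sandL X 1 (InnerProductSpace.rankOne ℂ n x) = InnerProductSpace.rankOne ℂ (X n) x := by
        ext v; simp [sandL]
      rw [Submodule.mem_comap, h1]
      refine fact0 ⟨N, hN⟩ x hx _ ?_
      have h2 := congrArg (fun f : H₁ →L[ℂ] H₂ => f n) (hX ⟨N, hN⟩)
      simp only [ContinuousLinearMap.comp_apply] at h2
      rw [cproj_of_mem (hNσ ⟨N, hN⟩ hn)] at h2
      rw [← h2]
      exact cproj_mem _ _

end P5
end OpSynth


namespace OpSynth

open Filter Topology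
open scoped ComplexInnerProductSpace Pointwise ComplexOrder
open Set

noncomputable section P6

section cells
variable {𝔄 I : Type*} [CommRing 𝔄] [StarRing 𝔄] [DecidableEq I]

/-- cells -/
def cell (r : I → 𝔄) (F s : Finset I) : 𝔄 := (∏ i ∈ s, r i) * ∏ i ∈ F \ s, (1 - r i)

lemma cell_sum (r : I → 𝔄) (F : Finset I) : ∑ s ∈ F.powerset, cell r F s = 1 := by
  unfold cell
  rw [← Finset.prod_add]
  simp

lemma cell_idem {r : I → 𝔄} (hr : ∀ i, r i * r i = r i) (F s : Finset I) :
    cell r F s * cell r F s = cell r F s := by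
  unfold cell
  rw [mul_mul_mul_comm, ← Finset.prod_mul_distrib, ← Finset.prod_mul_distrib]
  congr 1
  · exact Finset.prod_congr rfl fun i _ => hr i
  · refine Finset.prod_congr rfl fun i _ => ?_
    linear_combination hr i

lemma cell_star {r : I → 𝔄} (hr : ∀ i, star (r i) = r i) (F s : Finset I) :
    star (cell r F s) = cell r F s := by
  unfold cell
  simp [star_prod, hr]

lemma cell_mul {r : I → 𝔄} (hr : ∀ i, r i * r i = r i) {F s : Finset I} {j : I} (hj : j ∈ F) :
    cell r F s * r j = cell r F s ∨ cell r F s * r j = 0 := by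
  unfold cell
  by_cases h : j ∈ s
  · left
    rw [← Finset.mul_prod_erase s r h]
    linear_combination ((∏ x ∈ s.erase j, r x) * ∏ i ∈ F \ s, (1 - r i)) * hr j
  · right
    rw [← Finset.mul_prod_erase (F \ s) (fun i => 1 - r i) (a := j) (by simp [hj, h])]
    linear_combination -((∏ x ∈ s, r x) * ∏ i ∈ (F \ s).erase j, (1 - r i)) * hr j

lemma cell_mul_monoid {r : I → 𝔄} (hr : ∀ i, r i * r i = r i) {a : 𝔄}
    (ha : a ∈ Submonoid.closure (range r)) :
    ∃ G : Finset I, ∀ F s : Finset I, G ⊆ F → cell r F s * a = cell r F s ∨ cell r F s * a = 0 := by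
  induction ha using Submonoid.closure_induction with
  | mem x hx =>
    obtain ⟨j, rfl⟩ := hx
    exact ⟨{j}, fun F s h => cell_mul hr (h (by simp))⟩
  | one => exact ⟨∅, fun F s _ => Or.inl (mul_one _)⟩
  | mul x y _ _ hx hy =>
    obtain ⟨G, hG⟩ := hx
    obtain ⟨G', hG'⟩ := hy
    refine ⟨G ∪ G', fun F s h => ?_⟩
    rw [← mul_assoc]
    rcases hG F s (Finset.union_subset_left h) with h1 | h1 <;> rw [h1]
    · exact hG' F s (Finset.union_subset_right h)
    · exact Or.inr (zero_mul _)

lemma monoid_sa {r : I → 𝔄} (hr : ∀ i, star (r i) = r i) {a : 𝔄}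
    (ha : a ∈ Submonoid.closure (range r)) : star a = a := by
  induction ha using Submonoid.closure_induction with
  | mem x hx => obtain ⟨j, rfl⟩ := hx; exact hr j
  | one => simp
  | mul x y _ _ hx hy => rw [star_mul, hx, hy, mul_comm]

end cells

section O
variable {H K : Type*} [NormedAddCommGroup H] [InnerProductSpace ℂ H] [CompleteSpace H]
  [NormedAddCommGroup K] [InnerProductSpace ℂ K] [CompleteSpace K]

lemma sum_proj_sq {ι : Type*} (s : Finset ι) (e : ι → (H →L[ℂ] H)) (he : ∀ i ∈ s, IsStarProjection (e i))
    (hs : ∑ i ∈ s, e i = 1) (v : H) : ∑ i ∈ s, ‖e i v‖ ^ 2 = ‖v‖ ^ 2 := by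
  have : ((∑ i ∈ s, ‖e i v‖ ^ 2 : ℝ) : ℂ) = ((‖v‖ ^ 2 : ℝ) : ℂ) := by
    push_cast
    rw [Finset.sum_congr rfl fun i hi => (inner_proj_self (he i hi) v).symm, ← sum_inner]
    rw [← ContinuousLinearMap.sum_apply, hs]
    simp
  exact_mod_cast this

lemma lemO {ι : Type*} (s : Finset ι) (e : ι → (H →L[ℂ] H)) (f : ι → (K →L[ℂ] K)) (X : ι → (H →L[ℂ] K))
    (he : ∀ i ∈ s, IsStarProjection (e i)) (hf : ∀ i ∈ s, IsStarProjection (f i))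
    (hes : ∑ i ∈ s, e i = 1) (hfs : ∑ i ∈ s, f i = 1) {C : ℝ} (hC : 0 ≤ C) (hX : ∀ i ∈ s, ‖X i‖ ≤ C) :
    ‖∑ i ∈ s, f i ∘L X i ∘L e i‖ ≤ C := by
  refine ContinuousLinearMap.opNorm_le_bound _ hC fun v => ?_
  set w := (∑ i ∈ s, f i ∘L X i ∘L e i) v with hw
  have key : ‖w‖ ^ 2 ≤ ‖w‖ * (C * ‖v‖) := by
    have h1 : ‖w‖ ^ 2 = ‖⟪w, w⟫‖ := by
      rw [inner_self_eq_norm_sq_to_K]; simp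
    have h2 : ⟪w, w⟫ = ∑ i ∈ s, ⟪w, (f i ∘L X i ∘L e i) v⟫ := by
      conv_lhs => rw [hw]
      rw [← hw, hw, ContinuousLinearMap.sum_apply, inner_sum]
    rw [h1, h2]
    calc ‖∑ i ∈ s, ⟪w, (f i ∘L X i ∘L e i) v⟫‖ ≤ ∑ i ∈ s, ‖⟪w, (f i ∘L X i ∘L e i) v⟫‖ := norm_sum_le _ _
      _ ≤ ∑ i ∈ s, C * (‖f i w‖ * ‖e i v‖) := by
          refine Finset.sum_le_sum fun i hi => ?_
          have : ⟪w, (f i ∘L X i ∘L e i) v⟫ = ⟪f i w, X i (e i v)⟫ := by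
            rw [sa_inner (hf i hi).isSelfAdjoint]; rfl
          rw [this]
          calc _ ≤ ‖f i w‖ * ‖X i (e i v)‖ := norm_inner_le_norm _ _
            _ ≤ ‖f i w‖ * (C * ‖e i v‖) := by
                gcongr; exact (X i).le_of_opNorm_le (hX i hi) _
            _ = _ := by ring
      _ = C * ∑ i ∈ s, (‖f i w‖ * ‖e i v‖) := by rw [Finset.mul_sum]
      _ ≤ C * (√(∑ i ∈ s, ‖f i w‖ ^ 2) * √(∑ i ∈ s, ‖e i v‖ ^ 2)) := by
          gcongr; exact Real.sum_mul_le_sqrt_mul_sqrt _ _ _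
      _ = ‖w‖ * (C * ‖v‖) := by
          rw [sum_proj_sq s f hf hfs, sum_proj_sq s e he hes, Real.sqrt_sq (norm_nonneg _),
            Real.sqrt_sq (norm_nonneg _)]; ring
  rcases eq_or_lt_of_le (norm_nonneg w) with h | h
  · rw [← h]; positivity
  · exact le_of_mul_le_mul_left (by rw [← sq]; exact key) h

end O

section C
variable {𝔄 I : Type*} [CommRing 𝔄] [StarRing 𝔄] [Algebra ℂ 𝔄] [DecidableEq I]
variable {H : Type*} [NormedAddCommGroup H] [InnerProductSpace ℂ H] [CompleteSpace H]

lemma cell_proj {r : I → 𝔄} (hr : ∀ i, r i * r i = r i) (hs : ∀ i, star (r i) = r i)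
    (ρ : 𝔄 →⋆ₐ[ℂ] (H →L[ℂ] H)) (F s : Finset I) : IsStarProjection (ρ (cell r F s)) where
  isIdempotentElem := by rw [IsIdempotentElem, ← map_mul, cell_idem hr]
  isSelfAdjoint := by rw [IsSelfAdjoint, ← map_star, cell_star hs]

lemma cell_rho_sum (r : I → 𝔄) (ρ : 𝔄 →⋆ₐ[ℂ] (H →L[ℂ] H)) (F : Finset I) :
    ∑ s ∈ F.powerset, ρ (cell r F s) = 1 := by
  rw [← map_sum, cell_sum, map_one]

/-- intertwiners -/
lemma intertw {H₁ H₂ : Type*} [NormedAddCommGroup H₁] [InnerProductSpace ℂ H₁] [CompleteSpace H₁]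
    [NormedAddCommGroup H₂] [InnerProductSpace ℂ H₂] [CompleteSpace H₂]
    {r : I → 𝔄} (ρ₁ : 𝔄 →⋆ₐ[ℂ] (H₁ →L[ℂ] H₁)) (ρ₂ : 𝔄 →⋆ₐ[ℂ] (H₂ →L[ℂ] H₂)) {B : H₁ →L[ℂ] H₂}
    (hB : ∀ i, ρ₂ (r i) ∘L B = B ∘L ρ₁ (r i)) {a : 𝔄} (ha : a ∈ Algebra.adjoin ℂ (range r)) :
    ρ₂ a ∘L B = B ∘L ρ₁ a := by
  induction ha using Algebra.adjoin_induction with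
  | mem x hx => obtain ⟨i, rfl⟩ := hx; exact hB i
  | algebraMap c =>
    ext x; simp [Algebra.algebraMap_eq_smul_one]
  | add x y _ _ hx hy =>
    rw [map_add, map_add, ContinuousLinearMap.add_comp, ContinuousLinearMap.comp_add, hx, hy]
  | mul x y _ _ hx hy =>
    rw [map_mul, map_mul]
    change ρ₂ x ∘L ρ₂ y ∘L B = (B ∘L ρ₁ x) ∘L ρ₁ y
    rw [hy, ← hx]; rfl

lemma cell_mem (r : I → 𝔄) (F s : Finset I) : cell r F s ∈ Algebra.adjoin ℂ (range r) := by
  unfold cell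
  refine mul_mem (prod_mem fun i _ => Algebra.subset_adjoin ⟨i, rfl⟩) (prod_mem fun i _ => ?_)
  exact sub_mem (one_mem _) (Algebra.subset_adjoin ⟨i, rfl⟩)

/-- monoid image -/
def mimg (r : I → 𝔄) (ρ : 𝔄 →⋆ₐ[ℂ] (H →L[ℂ] H)) : Set (H →L[ℂ] H) :=
  ρ '' (Submonoid.closure (range r) : Set 𝔄)

lemma mimg_one (r : I → 𝔄) (ρ : 𝔄 →⋆ₐ[ℂ] (H →L[ℂ] H)) : 1 ∈ mimg r ρ := ⟨1, one_mem _, map_one _⟩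
lemma mimg_mul (r : I → 𝔄) (ρ : 𝔄 →⋆ₐ[ℂ] (H →L[ℂ] H)) : ∀ a ∈ mimg r ρ, ∀ b ∈ mimg r ρ, a * b ∈ mimg r ρ := by
  rintro _ ⟨a, ha, rfl⟩ _ ⟨b, hb, rfl⟩
  exact ⟨a * b, mul_mem ha hb, map_mul _ _ _⟩
lemma mimg_sa {r : I → 𝔄} (hs : ∀ i, star (r i) = r i) (ρ : 𝔄 →⋆ₐ[ℂ] (H →L[ℂ] H)) :
    ∀ a ∈ mimg r ρ, IsSelfAdjoint a := by
  rintro _ ⟨a, ha, rfl⟩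
  rw [IsSelfAdjoint, ← map_star, monoid_sa hs ha]
lemma mimg_r (r : I → 𝔄) (ρ : 𝔄 →⋆ₐ[ℂ] (H →L[ℂ] H)) (i : I) : ρ (r i) ∈ mimg r ρ :=
  ⟨r i, Submonoid.subset_closure ⟨i, rfl⟩, rfl⟩

/-- averaged operator -/
def avgB (r : I → 𝔄) (ρ : 𝔄 →⋆ₐ[ℂ] (H →L[ℂ] H)) (B : H →L[ℂ] H) (ζ : H) (F : Finset I) : H →L[ℂ] H :=
  ∑ s ∈ F.powerset, (((‖ρ (cell r F s) ζ‖ : ℂ) ^ 2)⁻¹ * ⟪ρ (cell r F s) ζ, B (ρ (cell r F s) ζ)⟫) • ρ (cell r F s)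

lemma avgB_norm {r : I → 𝔄} (hr : ∀ i, r i * r i = r i) (hs : ∀ i, star (r i) = r i)
    (ρ : 𝔄 →⋆ₐ[ℂ] (H →L[ℂ] H)) (B : H →L[ℂ] H) (ζ : H) (F : Finset I) : ‖avgB r ρ B ζ F‖ ≤ ‖B‖ := by
  have := lemO F.powerset (fun s => ρ (cell r F s)) (fun s => ρ (cell r F s))
    (fun s => (((‖ρ (cell r F s) ζ‖ : ℂ) ^ 2)⁻¹ * ⟪ρ (cell r F s) ζ, B (ρ (cell r F s) ζ)⟫) • (1 : H →L[ℂ] H))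
    (fun s _ => cell_proj hr hs ρ F s) (fun s _ => cell_proj hr hs ρ F s) (cell_rho_sum r ρ F) (cell_rho_sum r ρ F)
    (norm_nonneg B) (fun s _ => ?_)
  · convert this using 2
    unfold avgB
    refine Finset.sum_congr rfl fun s _ => ?_
    have h := (cell_proj hr hs ρ F s).isIdempotentElem.eq
    ext x
    have h' := congrArg (fun f : H →L[ℂ] H => f x) h
    simp only [mul_apply_eq_comp] at h'
    simp [h']
  · refine (norm_smul_le _ _).trans ?_
    refine (mul_le_mul_of_nonneg_left ContinuousLinearMap.norm_id_le (norm_nonneg _)).trans ?_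
    rw [mul_one, norm_mul, norm_inv, norm_pow, Complex.norm_real, norm_norm]
    set w := ρ (cell r F s) ζ
    rcases eq_or_ne ‖w‖ 0 with h0 | h0
    · rw [h0]; simp
    · rw [inv_mul_le_iff₀ (by positivity)]
      calc _ ≤ ‖w‖ * ‖B w‖ := norm_inner_le_norm _ _
        _ ≤ ‖w‖ * (‖B‖ * ‖w‖) := by gcongr; exact B.le_opNorm w
        _ = _ := by ring

lemma avgB_tendsto {r : I → 𝔄} (hr : ∀ i, r i * r i = r i) (hs : ∀ i, star (r i) = r i)
    (ρ : 𝔄 →⋆ₐ[ℂ] (H →L[ℂ] H)) (B : H →L[ℂ] H) (hB : ∀ i, ρ (r i) ∘L B = B ∘L ρ (r i)) (ζ : H) :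
    ∀ x ∈ (cyc (mimg r ρ) ζ).topologicalClosure, ∀ y ∈ (cyc (mimg r ρ) ζ).topologicalClosure,
      Tendsto (fun F => ⟪y, avgB r ρ B ζ F x⟫) atTop (𝓝 ⟪y, B x⟫) := by
  refine tendsto_coef_of_dense (avgB_norm hr hs ρ B ζ) _ _ ?_
  rintro _ ⟨_, ⟨a, ha, rfl⟩, rfl⟩ _ ⟨_, ⟨b, hb, rfl⟩, rfl⟩
  obtain ⟨G, hG⟩ := cell_mul_monoid hr ha
  obtain ⟨G', hG'⟩ := cell_mul_monoid hr hb
  refine tendsto_const_nhds.congr' ?_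
  filter_upwards [eventually_ge_atTop (G ∪ G')] with F hF
  have hsum : B (ρ a ζ) = ∑ s ∈ F.powerset, ρ (cell r F s) (B (ρ a ζ)) := by
    rw [← ContinuousLinearMap.sum_apply, cell_rho_sum]; rfl
  rw [hsum]
  unfold avgB
  rw [ContinuousLinearMap.sum_apply, inner_sum, inner_sum]
  refine Finset.sum_congr rfl fun s _ => ?_
  have hp := cell_proj hr hs ρ F s
  have e1 : ∀ x, ρ (cell r F s) x = ρ (cell r F s) (ρ (cell r F s) x) := fun x =>
    (congrArg (fun f : H →L[ℂ] H => f x) hp.isIdempotentElem.eq).symm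
  have e2 : ∀ x, ρ (cell r F s) (B x) = B (ρ (cell r F s) x) := fun x =>
    congrArg (fun f : H →L[ℂ] H => f x) (intertw ρ ρ hB (cell_mem r F s))
  have e3 : ∀ c, ρ (cell r F s) (ρ c ζ) = ρ (cell r F s * c) ζ := fun c => by rw [map_mul]; rfl
  rw [ContinuousLinearMap.smul_apply, inner_smul_right]
  rw [e1 (B _), ← sa_inner hp.isSelfAdjoint, e2, e1 (ρ a ζ), ← sa_inner hp.isSelfAdjoint, e3, e3]
  rcases hG F s (Finset.union_subset_left hF) with h1 | h1 <;>
  rcases hG' F s (Finset.union_subset_right hF) with h2 | h2 <;> rw [h1, h2]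
  · set w := ρ (cell r F s) ζ
    rcases eq_or_ne w 0 with h0 | h0
    · rw [h0]; simp
    · have : (‖w‖ : ℂ) ≠ 0 := by simpa using h0
      rw [inner_self_eq_norm_sq_to_K]
      simp only [Complex.coe_algebraMap]
      have hww : ρ (cell r F s) w = w := (e1 ζ).symm
      rw [hww]
      field_simp
  all_goals simp
end C

section ergodic
variable {H : Type*} [NormedAddCommGroup H] [InnerProductSpace ℂ H] [CompleteSpace H]

lemma ergodic {h : H →L[ℂ] H} (hh : ‖1 - h‖ ≤ 1) (Y : Submodule ℂ (H →L[ℂ] H)) (hY : BCClosed Y)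
    (hYn : ∀ n : ℕ, 1 - (1 - h) ^ n ∈ Y) (S : Submodule ℂ H) (hS : ∀ x, h x = 0 ↔ x ∈ Sᗮ) :
    cproj S ∈ Y := by
  have ht := ContinuousLinearMap.tendsto_birkhoffAverage_orthogonalProjection (1 - h) hh
  refine hY (fun n => 1 - ((n + 1 : ℕ) : ℂ)⁻¹ • ∑ k ∈ Finset.range (n + 1), (1 - h) ^ k) _ 2 (fun n => ?_)
    (fun n => ?_) fun x => ?_
  · have : 1 - ((n + 1 : ℕ) : ℂ)⁻¹ • ∑ k ∈ Finset.range (n + 1), (1 - h) ^ k =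
      ((n + 1 : ℕ) : ℂ)⁻¹ • ∑ k ∈ Finset.range (n + 1), (1 - (1 - h) ^ k) := by
      rw [Finset.sum_sub_distrib, smul_sub]
      congr 1
      simp only [Finset.sum_const, Finset.card_range]
      rw [← Nat.cast_smul_eq_nsmul ℂ, smul_smul, inv_mul_cancel₀ (by positivity), one_smul]
    rw [this]
    exact Y.smul_mem _ (Y.sum_mem fun k _ => hYn k)
  · have h1 : ‖(1 : H →L[ℂ] H)‖ ≤ 1 := ContinuousLinearMap.norm_id_le
    have hk : ∀ k : ℕ, ‖(1 - h) ^ k‖ ≤ 1 := by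
      intro k
      induction k with
      | zero => simpa using h1
      | succ k ih =>
        rw [pow_succ]
        refine (norm_mul_le _ _).trans ?_
        exact mul_le_one₀ ih (norm_nonneg _) hh
    have : ‖((n + 1 : ℕ) : ℂ)⁻¹ • ∑ k ∈ Finset.range (n + 1), (1 - h) ^ k‖ ≤ 1 := by
      rw [norm_smul, norm_inv, Complex.norm_natCast, inv_mul_le_iff₀ (by positivity)]
      refine (norm_sum_le _ _).trans ?_
      refine (Finset.sum_le_sum fun k _ => hk k).trans ?_
      simp
    calc _ ≤ ‖(1 : H →L[ℂ] H)‖ + _ := norm_sub_le _ _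
      _ ≤ 1 + 1 := add_le_add h1 this
      _ = 2 := by norm_num
  · have h2 := (tendsto_add_atTop_iff_nat 1).2 (ht x)
    have h3 := h2.const_sub x
    have hlim : x - (((1 - h).eqLocus (1 : H →L[ℂ] H)).orthogonalProjectionOnto x : H) = cproj S x := by
      have hE : ∀ z, z ∈ ((1 - h).eqLocus (1 : H →L[ℂ] H)) ↔ z ∈ Sᗮ := by
        intro z
        rw [← hS]
        simp [LinearMap.mem_eqLocus]
      have hm : x - cproj S x ∈ ((1 - h).eqLocus (1 : H →L[ℂ] H)) := by
        rw [hE]; exact cproj_sub_mem S x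
      have : (((1 - h).eqLocus (1 : H →L[ℂ] H)).orthogonalProjectionOnto x : H) = x - cproj S x := by
        rw [← Submodule.starProjection_apply]
        refine (Submodule.eq_starProjection_of_mem_of_inner_eq_zero hm fun w hw => ?_)
        rw [hE] at hw
        rw [sub_sub_cancel]
        have h5 : cproj S w = 0 := cproj_eq_zero.2 hw
        rw [cproj_inner, h5, inner_zero_right]
      rw [this, sub_sub_cancel]
    rw [hlim] at h3
    refine h3.congr fun n => ?_
    simp only [birkhoffAverage, birkhoffSum, ContinuousLinearMap.sub_apply, ContinuousLinearMap.smul_apply,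
      ContinuousLinearMap.sum_apply, id]
    congr 2
    refine Finset.sum_congr rfl fun k _ => ?_
    clear * -
    induction k with
    | zero => rfl
    | succ k ih => rw [Function.iterate_succ_apply', ih, pow_succ']; rfl
end ergodic

end P6
end OpSynth


namespace OpSynth

open Filter Topology
open scoped ComplexInnerProductSpace Pointwise ComplexOrder
open Set

noncomputable section P7
set_option linter.all false

variable {H₁ H₂ : Type*}
  [NormedAddCommGroup H₁] [InnerProductSpace ℂ H₁] [CompleteSpace H₁]
  [NormedAddCommGroup H₂] [InnerProductSpace ℂ H₂] [CompleteSpace H₂]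

section DS
variable (H₁ H₂)
/-- inclusion 1 -/
def J1 : H₁ →L[ℂ] WithLp 2 (H₁ × H₂) :=
  (WithLp.prodContinuousLinearEquiv 2 ℂ H₁ H₂).symm.toContinuousLinearMap ∘L ContinuousLinearMap.inl ℂ H₁ H₂
/-- inclusion 2 -/
def J2 : H₂ →L[ℂ] WithLp 2 (H₁ × H₂) :=
  (WithLp.prodContinuousLinearEquiv 2 ℂ H₁ H₂).symm.toContinuousLinearMap ∘L ContinuousLinearMap.inr ℂ H₁ H₂
/-- projection 1 -/
def F1 : WithLp 2 (H₁ × H₂) →L[ℂ] H₁ := WithLp.fstL 2 ℂ H₁ H₂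
/-- projection 2 -/
def F2 : WithLp 2 (H₁ × H₂) →L[ℂ] H₂ := WithLp.sndL 2 ℂ H₁ H₂
variable {H₁ H₂}

lemma J1_apply (x : H₁) : J1 H₁ H₂ x = WithLp.toLp 2 (x, 0) := rfl
lemma J2_apply (x : H₂) : J2 H₁ H₂ x = WithLp.toLp 2 (0, x) := rfl
lemma F1_apply (x) : F1 H₁ H₂ x = x.fst := rfl
lemma F2_apply (x) : F2 H₁ H₂ x = x.snd := rfl

lemma inner_J1 (x : H₁) (v : WithLp 2 (H₁ × H₂)) : ⟪J1 H₁ H₂ x, v⟫ = ⟪x, F1 H₁ H₂ v⟫ := by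
  simp [J1_apply, F1_apply, WithLp.prod_inner_apply]
lemma inner_J2 (x : H₂) (v : WithLp 2 (H₁ × H₂)) : ⟪J2 H₁ H₂ x, v⟫ = ⟪x, F2 H₁ H₂ v⟫ := by
  simp [J2_apply, F2_apply, WithLp.prod_inner_apply]
lemma F1_J1 (x : H₁) : F1 H₁ H₂ (J1 H₁ H₂ x) = x := rfl
lemma F2_J2 (x : H₂) : F2 H₁ H₂ (J2 H₁ H₂ x) = x := rfl
lemma norm_J1 (x : H₁) : ‖J1 H₁ H₂ x‖ = ‖x‖ := by
  have h : ‖J1 H₁ H₂ x‖ ^ 2 = ‖x‖ ^ 2 + ‖(0 : H₂)‖ ^ 2 := WithLp.prod_norm_sq_eq_of_L2 _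
  rw [norm_zero, zero_pow two_ne_zero, add_zero] at h
  exact (pow_left_inj₀ (norm_nonneg _) (norm_nonneg _) two_ne_zero).1 h
lemma norm_J2 (x : H₂) : ‖J2 H₁ H₂ x‖ = ‖x‖ := by
  have h : ‖J2 H₁ H₂ x‖ ^ 2 = ‖(0 : H₁)‖ ^ 2 + ‖x‖ ^ 2 := WithLp.prod_norm_sq_eq_of_L2 _
  rw [norm_zero, zero_pow two_ne_zero, zero_add] at h
  exact (pow_left_inj₀ (norm_nonneg _) (norm_nonneg _) two_ne_zero).1 h
lemma norm_F_sq (v : WithLp 2 (H₁ × H₂)) : ‖v‖ ^ 2 = ‖F1 H₁ H₂ v‖ ^ 2 + ‖F2 H₁ H₂ v‖ ^ 2 :=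
  WithLp.prod_norm_sq_eq_of_L2 _
lemma norm_F1_le (v : WithLp 2 (H₁ × H₂)) : ‖F1 H₁ H₂ v‖ ≤ ‖v‖ := by
  have := norm_F_sq v
  exact le_of_sq_le_sq (by nlinarith [sq_nonneg ‖F2 H₁ H₂ v‖]) (norm_nonneg _)
lemma norm_F2_le (v : WithLp 2 (H₁ × H₂)) : ‖F2 H₁ H₂ v‖ ≤ ‖v‖ := by
  have := norm_F_sq v
  exact le_of_sq_le_sq (by nlinarith [sq_nonneg ‖F1 H₁ H₂ v‖]) (norm_nonneg _)

variable {𝔄 I : Type*} [CommRing 𝔄] [StarRing 𝔄] [Algebra ℂ 𝔄] [DecidableEq I]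

lemma DS_ext {A B : WithLp 2 (H₁ × H₂) →L[ℂ] WithLp 2 (H₁ × H₂)}
    (h1 : ∀ x, F1 H₁ H₂ (A x) = F1 H₁ H₂ (B x)) (h2 : ∀ x, F2 H₁ H₂ (A x) = F2 H₁ H₂ (B x)) : A = B := by
  ext1 x
  refine (WithLp.ofLp_injective 2) (Prod.ext ?_ ?_)
  · exact h1 x
  · exact h2 x

/-- direct sum operator -/
def dsop (a : H₁ →L[ℂ] H₁) (b : H₂ →L[ℂ] H₂) : WithLp 2 (H₁ × H₂) →L[ℂ] WithLp 2 (H₁ × H₂) :=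
  J1 H₁ H₂ ∘L a ∘L F1 H₁ H₂ + J2 H₁ H₂ ∘L b ∘L F2 H₁ H₂

lemma F1_dsop (a : H₁ →L[ℂ] H₁) (b : H₂ →L[ℂ] H₂) (x) : F1 H₁ H₂ (dsop a b x) = a (F1 H₁ H₂ x) := by
  simp [dsop, J1_apply, J2_apply, F1_apply]
lemma F2_dsop (a : H₁ →L[ℂ] H₁) (b : H₂ →L[ℂ] H₂) (x) : F2 H₁ H₂ (dsop a b x) = b (F2 H₁ H₂ x) := by
  simp [dsop, J1_apply, J2_apply, F2_apply]

lemma dsop_star (a : H₁ →L[ℂ] H₁) (b : H₂ →L[ℂ] H₂) : dsop (star a) (star b) = star (dsop a b) := by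
  refine ContinuousLinearMap.ext fun x => ext_inner_right ℂ fun y => ?_
  rw [star_inner, WithLp.prod_inner_apply, WithLp.prod_inner_apply]
  change ⟪F1 H₁ H₂ (dsop _ _ x), F1 H₁ H₂ y⟫ + ⟪F2 H₁ H₂ (dsop _ _ x), F2 H₁ H₂ y⟫ =
    ⟪F1 H₁ H₂ x, F1 H₁ H₂ (dsop _ _ y)⟫ + ⟪F2 H₁ H₂ x, F2 H₁ H₂ (dsop _ _ y)⟫
  rw [F1_dsop, F2_dsop, F1_dsop, F2_dsop, star_inner, star_inner]

/-- direct sum representation -/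
def dsrep (π₁ : 𝔄 →⋆ₐ[ℂ] (H₁ →L[ℂ] H₁)) (π₂ : 𝔄 →⋆ₐ[ℂ] (H₂ →L[ℂ] H₂)) :
    𝔄 →⋆ₐ[ℂ] (WithLp 2 (H₁ × H₂) →L[ℂ] WithLp 2 (H₁ × H₂)) where
  toFun a := dsop (π₁ a) (π₂ a)
  map_one' := DS_ext (fun x => by rw [F1_dsop]; simp) (fun x => by rw [F2_dsop]; simp)
  map_mul' a b := DS_ext (fun x => by simp [F1_dsop]) (fun x => by simp [F2_dsop])
  map_zero' := DS_ext (fun x => by rw [F1_dsop]; simp) (fun x => by rw [F2_dsop]; simp)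
  map_add' a b := DS_ext (fun x => by simp [F1_dsop]) (fun x => by simp [F2_dsop])
  commutes' r := DS_ext (fun x => by rw [F1_dsop]; simp [Algebra.algebraMap_eq_smul_one])
    (fun x => by rw [F2_dsop]; simp [Algebra.algebraMap_eq_smul_one])
  map_star' a := by rw [map_star, map_star, dsop_star]

variable (π₁ : 𝔄 →⋆ₐ[ℂ] (H₁ →L[ℂ] H₁)) (π₂ : 𝔄 →⋆ₐ[ℂ] (H₂ →L[ℂ] H₂))

lemma F1_rep (a : 𝔄) (x) : F1 H₁ H₂ (dsrep π₁ π₂ a x) = π₁ a (F1 H₁ H₂ x) := F1_dsop _ _ _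
lemma F2_rep (a : 𝔄) (x) : F2 H₁ H₂ (dsrep π₁ π₂ a x) = π₂ a (F2 H₁ H₂ x) := F2_dsop _ _ _
lemma rep_J1 (a : 𝔄) (x) : dsrep π₁ π₂ a (J1 H₁ H₂ x) = J1 H₁ H₂ (π₁ a x) := by
  change dsop _ _ _ = _
  simp [dsop, F1_J1, show F2 H₁ H₂ (J1 H₁ H₂ x) = 0 from rfl]
lemma rep_J2 (a : 𝔄) (x) : dsrep π₁ π₂ a (J2 H₁ H₂ x) = J2 H₁ H₂ (π₂ a x) := by
  change dsop _ _ _ = _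
  simp [dsop, F2_J2, show F1 H₁ H₂ (J2 H₁ H₂ x) = 0 from rfl]

end DS

section main
variable {K₁ K₂ T₁ T₂ : Type*}
    [NormedAddCommGroup K₁] [InnerProductSpace ℂ K₁] [CompleteSpace K₁]
    [NormedAddCommGroup K₂] [InnerProductSpace ℂ K₂] [CompleteSpace K₂]
    [NormedAddCommGroup T₁] [InnerProductSpace ℂ T₁] [CompleteSpace T₁]
    [NormedAddCommGroup T₂] [InnerProductSpace ℂ T₂] [CompleteSpace T₂]

omit [CompleteSpace H₁] [CompleteSpace K₁] [CompleteSpace T₁] in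
lemma IsTensorEmbedding.flip {t₁ : H₁ → K₁ → T₁} (ht : IsTensorEmbedding t₁) :
    IsTensorEmbedding (fun y x => t₁ x y) := by
  obtain ⟨h1, h2, h3, h4, h5, h6⟩ := ht
  refine ⟨fun x x' y => h2 _ _ _, fun x y y' => h1 _ _ _, fun c x y => h4 _ _ _, fun c x y => h3 _ _ _,
    fun x x' y y' => by rw [h5, mul_comm], ?_⟩
  rw [← h6]
  congr 2
  ext z
  exact ⟨fun ⟨x, y, h⟩ => ⟨y, x, h⟩, fun ⟨x, y, h⟩ => ⟨y, x, h⟩⟩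

variable {𝔄 I : Type*} [CommRing 𝔄] [StarRing 𝔄] [Algebra ℂ 𝔄] [DecidableEq I]

/-- intertwiner space -/
def Dl (r : I → 𝔄) (π₁ : 𝔄 →⋆ₐ[ℂ] (H₁ →L[ℂ] H₁)) (π₂ : 𝔄 →⋆ₐ[ℂ] (H₂ →L[ℂ] H₂)) : Set (H₁ →L[ℂ] H₂) :=
  {X | ∀ i, π₂ (r i) ∘L X = X ∘L π₁ (r i)}

lemma Dl_mul {r : I → 𝔄} {π₁ : 𝔄 →⋆ₐ[ℂ] (H₁ →L[ℂ] H₁)} {π₂ : 𝔄 →⋆ₐ[ℂ] (H₂ →L[ℂ] H₂)}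
    {b : H₂ →L[ℂ] H₂} {a : H₁ →L[ℂ] H₁} (hb : ∀ i, b * π₂ (r i) = π₂ (r i) * b)
    (ha : ∀ i, a * π₁ (r i) = π₁ (r i) * a) {X} (hX : X ∈ Dl r π₁ π₂) : b ∘L X ∘L a ∈ Dl r π₁ π₂ := by
  intro i
  have h1 : π₂ (r i) ∘L b = b ∘L π₂ (r i) := (hb i).symm
  have h2 : a ∘L π₁ (r i) = π₁ (r i) ∘L a := ha i
  rw [← ContinuousLinearMap.comp_assoc, h1, ContinuousLinearMap.comp_assoc, ← ContinuousLinearMap.comp_assoc _ X,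
    hX i, ContinuousLinearMap.comp_assoc, ← h2]
  rfl

variable {t₁ : H₁ → K₁ → T₁} {t₂ : H₂ → K₂ → T₂} (ht₁ : IsTensorEmbedding t₁) (ht₂ : IsTensorEmbedding t₂)
include ht₁ ht₂

/-- the key local statement -/
lemma Ssig_local {r : I → 𝔄} (hr : ∀ i, r i * r i = r i) (hs : ∀ i, star (r i) = r i)
    (π₁ : 𝔄 →⋆ₐ[ℂ] (H₁ →L[ℂ] H₁)) (π₂ : 𝔄 →⋆ₐ[ℂ] (H₂ →L[ℂ] H₂))
    {U : Set (K₁ →L[ℂ] K₂)} (hU : IsWkClosedSubspace U) {T : T₁ →L[ℂ] T₂}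
    (hT : T ∈ wTensor t₁ t₂ univ U)
    (hTr : ∀ i, amp ht₂ (π₂ (r i)) ∘L T = T ∘L amp ht₁ (π₁ (r i))) (ζ : WithLp 2 (H₁ × H₂)) :
    amp ht₂ (F2 H₁ H₂ ∘L cproj (cyc (mimg r (dsrep π₁ π₂)) ζ) ∘L J2 H₁ H₂) ∘L T ∘L
      amp ht₁ (F1 H₁ H₂ ∘L cproj (cyc (mimg r (dsrep π₁ π₂)) ζ) ∘L J1 H₁ H₂)
      ∈ wTensor t₁ t₂ (Dl r π₁ π₂) U := by
  set ρ := dsrep π₁ π₂ with hρ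
  set e := cproj (cyc (mimg r ρ) ζ) with he
  set W : H₁ →L[ℂ] H₂ := F2 H₁ H₂ ∘L e ∘L J1 H₁ H₂ with hW
  have ecomm : ∀ a ∈ mimg r ρ, e * a = a * e := fun a ha => cyc_comm (mimg_mul r ρ) (mimg_sa hs ρ) ζ ha
  have ecomm' : ∀ a ∈ Algebra.adjoin ℂ (range r), ρ a ∘L e = e ∘L ρ a := fun a ha =>
    intertw ρ ρ (fun i => (ecomm _ (mimg_r r ρ i)).symm) ha
  have hWa : ∀ a ∈ Algebra.adjoin ℂ (range r), ∀ x, π₂ a (W x) = W (π₁ a x) := by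
    intro a ha x
    have h1 := congrArg (fun f : _ →L[ℂ] _ => F2 H₁ H₂ (f (J1 H₁ H₂ x))) (ecomm' a ha)
    simp only [ContinuousLinearMap.comp_apply] at h1
    rw [hρ, F2_rep, rep_J1] at h1
    exact h1
  have hWD : W ∈ Dl r π₁ π₂ := fun i => ContinuousLinearMap.ext fun x =>
    hWa _ (Algebra.subset_adjoin ⟨i, rfl⟩) x
  set ξ := F1 H₁ H₂ ζ
  set η := F2 H₁ H₂ ζ
  let sc : Finset I → Finset I → (K₁ →L[ℂ] K₂) := fun F s =>
    ((‖ρ (cell r F s) ζ‖ : ℂ) ^ 2)⁻¹ • slice ht₁ ht₂ (π₁ (cell r F s) ξ) (π₂ (cell r F s) η) T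
  let Θ : Finset I → (T₁ →L[ℂ] T₂) := fun F => ∑ s ∈ F.powerset, tens t₁ t₂ (π₂ (cell r F s) ∘L W) (sc F s)
  have hsU : ∀ F s, sc F s ∈ U := fun F s => hU.sub.smul_mem _ (slice_mem ht₁ ht₂ hU hT _ _)
  have hsn : ∀ F s, ‖sc F s‖ ≤ ‖T‖ := by
    intro F s
    refine (norm_smul_le (((‖ρ (cell r F s) ζ‖ : ℂ) ^ 2)⁻¹)
      (slice ht₁ ht₂ (π₁ (cell r F s) ξ) (π₂ (cell r F s) η) T)).trans ?_
    rw [norm_inv, norm_pow, Complex.norm_real, norm_norm]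
    have h1 : ‖π₁ (cell r F s) ξ‖ ≤ ‖ρ (cell r F s) ζ‖ := by
      rw [← F1_rep π₁ π₂]; exact norm_F1_le _
    have h2 : ‖π₂ (cell r F s) η‖ ≤ ‖ρ (cell r F s) ζ‖ := by
      rw [← F2_rep π₁ π₂]; exact norm_F2_le _
    rcases eq_or_ne ‖ρ (cell r F s) ζ‖ 0 with h0 | h0
    · rw [h0]; simp
    · rw [inv_mul_le_iff₀ (by positivity), sq]
      refine (norm_slice_le ht₁ ht₂ _ _ _).trans ?_
      gcongr
  have hW1 : ‖W‖ ≤ 1 := by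
    refine ContinuousLinearMap.opNorm_le_bound _ zero_le_one fun x => ?_
    rw [one_mul]
    exact (norm_F2_le _).trans ((cproj_norm_le _ _).trans (norm_J1 x).le)
  have hΘn : ∀ F, ‖Θ F‖ ≤ ‖T‖ := by
    intro F
    have := lemO F.powerset (fun s => amp ht₁ (π₁ (cell r F s))) (fun s => amp ht₂ (π₂ (cell r F s)))
      (fun s => tens t₁ t₂ W (sc F s))
      (fun s _ => cell_proj hr hs ((amp ht₁).comp π₁) F s) (fun s _ => cell_proj hr hs ((amp ht₂).comp π₂) F s)
      (cell_rho_sum r ((amp ht₁).comp π₁) F) (cell_rho_sum r ((amp ht₂).comp π₂) F)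
      (norm_nonneg T) (fun s _ => ?_)
    · convert this using 2
      refine Finset.sum_congr rfl fun s _ => ht₁.ext fun x y => ?_
      simp only [ContinuousLinearMap.comp_apply, tens_apply ht₁ ht₂, amp_apply]
      rw [← hWa _ (cell_mem r F s)]
      congr 1
      exact (congrArg (fun f : _ →L[ℂ] _ => f (W x)) (cell_proj hr hs π₂ F s).isIdempotentElem.eq).symm
    · refine (norm_tens_le ht₁ ht₂ _ _).trans ?_
      calc _ ≤ 1 * ‖T‖ := by gcongr; exact hsn F s
        _ = _ := one_mul _
  have hΘY : ∀ F, Θ F ∈ wTensor t₁ t₂ (Dl r π₁ π₂) U := by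
    intro F
    refine (isWkClosedSubspace_wTensor (Dl r π₁ π₂) U).sub.sum_mem fun s _ => ?_
    refine tens_mem ht₁ ht₂ ?_ (hsU F s)
    have := Dl_mul (a := 1) (b := π₂ (cell r F s)) (fun i => by rw [← map_mul, ← map_mul, mul_comm])
      (fun i => by simp) hWD
    exact this
  refine (isWkClosedSubspace_wTensor (Dl r π₁ π₂) U).2.mem_of_bdd (l := atTop) hΘY hΘn ?_
  have hall := tendsto_coef_of_dense (l := atTop) (X := amp ht₂ (F2 H₁ H₂ ∘L e ∘L J2 H₁ H₂) ∘L T ∘L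
      amp ht₁ (F1 H₁ H₂ ∘L e ∘L J1 H₁ H₂)) hΘn { z | ∃ x y, z = t₁ x y } { z | ∃ x y, z = t₂ x y } ?_
  · intro x y
    exact hall x (by rw [ht₁.dense]; trivial) y (by rw [ht₂.dense]; trivial)
  rintro _ ⟨x', y, rfl⟩ _ ⟨x'', z, rfl⟩
  let S : H₁ →L[ℂ] H₂ := slice ht₁.flip ht₂.flip y z T
  have hS : ∀ x x2, ⟪x2, S x⟫ = ⟪t₂ x2 z, T (t₁ x y)⟫ := fun x x2 => inner_slice ht₁.flip ht₂.flip y z T x x2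
  have hSr : ∀ i x, π₂ (r i) (S x) = S (π₁ (r i) x) := by
    intro i x
    refine ext_inner_left ℂ fun w => ?_
    have hsa : IsSelfAdjoint (π₂ (r i)) := by rw [IsSelfAdjoint, ← map_star, hs]
    rw [← sa_inner hsa, hS, hS]
    have h1 := congrArg (fun f : _ →L[ℂ] _ => ⟪t₂ w z, f (t₁ x y)⟫) (hTr i)
    simp only [ContinuousLinearMap.comp_apply, amp_apply] at h1
    rw [← h1, ← sa_inner (by rw [IsSelfAdjoint, ← map_star, hsa.star_eq]), amp_apply]
  have hBr : ∀ i, ρ (r i) ∘L (J2 H₁ H₂ ∘L S ∘L F1 H₁ H₂) = (J2 H₁ H₂ ∘L S ∘L F1 H₁ H₂) ∘L ρ (r i) := by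
    intro i
    ext1 v
    simp only [ContinuousLinearMap.comp_apply]
    rw [hρ, rep_J2, F1_rep, hSr]
  have lim := avgB_tendsto hr hs ρ _ hBr ζ (e (J1 H₁ H₂ x')) (cproj_mem _ _) (e (J2 H₁ H₂ x'')) (cproj_mem _ _)
  convert lim using 1
  · ext F
    simp only [Θ, avgB]
    rw [ContinuousLinearMap.sum_apply, ContinuousLinearMap.sum_apply, inner_sum, inner_sum]
    refine Finset.sum_congr rfl fun s _ => ?_
    rw [tens_apply ht₁ ht₂, ht₂.inner, ContinuousLinearMap.smul_apply, inner_smul_right]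
    simp only [sc, ContinuousLinearMap.smul_apply, ContinuousLinearMap.comp_apply]
    rw [inner_smul_right, inner_slice, ← hS]
    have h1 : ⟪ρ (cell r F s) ζ, J2 H₁ H₂ (S (F1 H₁ H₂ (ρ (cell r F s) ζ)))⟫ =
        ⟪π₂ (cell r F s) η, S (π₁ (cell r F s) ξ)⟫ := by
      rw [hρ, F1_rep, ← inner_conj_symm, inner_J2, F2_rep, inner_conj_symm]
    have h2 : ⟪e (J2 H₁ H₂ x''), ρ (cell r F s) (e (J1 H₁ H₂ x'))⟫ = ⟪x'', π₂ (cell r F s) (W x')⟫ := by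
      have h3 := congrArg (fun f : _ →L[ℂ] _ => f (e (J1 H₁ H₂ x'))) (ecomm' _ (cell_mem r F s))
      simp only [ContinuousLinearMap.comp_apply] at h3
      rw [he, cproj_idem, ← he] at h3
      rw [he, cproj_inner, ← he, ← h3, inner_J2, hρ, F2_rep]
      rfl
    rw [h1, h2]
    ring
  · congr 1
    simp only [ContinuousLinearMap.comp_apply, amp_apply]
    have hsa : IsSelfAdjoint (F2 H₁ H₂ ∘L e ∘L J2 H₁ H₂) := by
      refine ContinuousLinearMap.ext fun x => ext_inner_right ℂ fun y => ?_
      rw [star_inner]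
      simp only [ContinuousLinearMap.comp_apply]
      rw [← inner_J2, he, ← cproj_inner, ← inner_conj_symm (F2 H₁ H₂ _), ← inner_J2, inner_conj_symm]
    rw [← sa_inner (by rw [IsSelfAdjoint, ← map_star, hsa.star_eq]), amp_apply, ← hS]
    simp only [ContinuousLinearMap.comp_apply]
    rw [← inner_conj_symm (e _), inner_J2, inner_conj_symm]

end main
end P7
end OpSynth


namespace OpSynth

open Filter Topology
open scoped ComplexInnerProductSpace Pointwise ComplexOrder
open Set

noncomputable section P8
set_option linter.all false

variable {H₁ H₂ : Type*}
  [NormedAddCommGroup H₁] [InnerProductSpace ℂ H₁] [CompleteSpace H₁]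
  [NormedAddCommGroup H₂] [InnerProductSpace ℂ H₂] [CompleteSpace H₂]

lemma mem_span_orth {S : Set H₁} {x : H₁} : x ∈ (Submodule.span ℂ S)ᗮ ↔ ∀ s ∈ S, ⟪s, x⟫ = 0 := by
  rw [Submodule.mem_orthogonal]
  refine ⟨fun h s hs => h s (Submodule.subset_span hs), fun h u hu => ?_⟩
  induction hu using Submodule.span_induction with
  | mem y hy => exact h y hy
  | zero => simp
  | add x y _ _ hx hy => rw [inner_add_left, hx, hy, add_zero]
  | smul c x _ hx => rw [inner_smul_left, hx, mul_zero]

lemma cproj_zero_iff (S : Submodule ℂ H₁) (x : H₁) : cproj S x = 0 ↔ ⟪x, cproj S x⟫ = 0 := by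
  refine ⟨fun h => by rw [h, inner_zero_right], fun h => ?_⟩
  rw [← cproj_idem, ← cproj_inner, inner_self_eq_zero] at h
  exact h

variable {𝔄 I : Type*} [CommRing 𝔄] [StarRing 𝔄] [Algebra ℂ 𝔄] [DecidableEq I]

section h
variable (r : I → 𝔄) (π₁ : 𝔄 →⋆ₐ[ℂ] (H₁ →L[ℂ] H₁)) (π₂ : 𝔄 →⋆ₐ[ℂ] (H₂ →L[ℂ] H₂)) (ζ : WithLp 2 (H₁ × H₂))

/-- h1 -/
def hh1 : H₁ →L[ℂ] H₁ := F1 H₁ H₂ ∘L cproj (cyc (mimg r (dsrep π₁ π₂)) ζ) ∘L J1 H₁ H₂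
/-- h2 -/
def hh2 : H₂ →L[ℂ] H₂ := F2 H₁ H₂ ∘L cproj (cyc (mimg r (dsrep π₁ π₂)) ζ) ∘L J2 H₁ H₂

lemma hh1_norm : ‖1 - hh1 r π₁ π₂ ζ‖ ≤ 1 := by
  refine ContinuousLinearMap.opNorm_le_bound _ zero_le_one fun x => ?_
  rw [one_mul]
  have : (1 - hh1 r π₁ π₂ ζ) x = F1 H₁ H₂ (J1 H₁ H₂ x - cproj (cyc (mimg r (dsrep π₁ π₂)) ζ) (J1 H₁ H₂ x)) := by
    rw [map_sub, F1_J1]; rfl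
  rw [this]
  refine (norm_F1_le _).trans ?_
  rw [← norm_J1 (H₂ := H₂) x]
  refine le_of_sq_le_sq ?_ (norm_nonneg _)
  rw [cproj_pyth']
  exact sub_le_self _ (sq_nonneg _)

lemma hh2_norm : ‖1 - hh2 r π₁ π₂ ζ‖ ≤ 1 := by
  refine ContinuousLinearMap.opNorm_le_bound _ zero_le_one fun x => ?_
  rw [one_mul]
  have : (1 - hh2 r π₁ π₂ ζ) x = F2 H₁ H₂ (J2 H₁ H₂ x - cproj (cyc (mimg r (dsrep π₁ π₂)) ζ) (J2 H₁ H₂ x)) := by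
    rw [map_sub, F2_J2]; rfl
  rw [this]
  refine (norm_F2_le _).trans ?_
  rw [← norm_J2 (H₁ := H₁) x]
  refine le_of_sq_le_sq ?_ (norm_nonneg _)
  rw [cproj_pyth']
  exact sub_le_self _ (sq_nonneg _)

lemma hh1_ker (x : H₁) : hh1 r π₁ π₂ ζ x = 0 ↔ x ∈ (cyc (mimg r π₁) (F1 H₁ H₂ ζ))ᗮ := by
  have h1 : hh1 r π₁ π₂ ζ x = 0 ↔ cproj (cyc (mimg r (dsrep π₁ π₂)) ζ) (J1 H₁ H₂ x) = 0 := by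
    constructor
    · intro h
      rw [cproj_zero_iff, inner_J1]
      have : F1 H₁ H₂ (cproj (cyc (mimg r (dsrep π₁ π₂)) ζ) (J1 H₁ H₂ x)) = 0 := h
      rw [this, inner_zero_right]
    · intro h
      change F1 H₁ H₂ (cproj (cyc (mimg r (dsrep π₁ π₂)) ζ) (J1 H₁ H₂ x)) = 0
      rw [h, map_zero]
  rw [h1, cproj_eq_zero, cyc, cyc, mem_span_orth, mem_span_orth]
  have key : ∀ a : 𝔄, ⟪dsrep π₁ π₂ a ζ, J1 H₁ H₂ x⟫ = 0 ↔ ⟪π₁ a (F1 H₁ H₂ ζ), x⟫ = 0 := by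
    intro a
    rw [← inner_conj_symm, inner_J1, F1_rep, inner_conj_symm]
  constructor
  · rintro h _ ⟨_, ⟨a, ha, rfl⟩, rfl⟩
    exact (key a).1 (h _ ⟨_, ⟨a, ha, rfl⟩, rfl⟩)
  · rintro h _ ⟨_, ⟨a, ha, rfl⟩, rfl⟩
    exact (key a).2 (h _ ⟨_, ⟨a, ha, rfl⟩, rfl⟩)

lemma hh2_ker (x : H₂) : hh2 r π₁ π₂ ζ x = 0 ↔ x ∈ (cyc (mimg r π₂) (F2 H₁ H₂ ζ))ᗮ := by
  have h1 : hh2 r π₁ π₂ ζ x = 0 ↔ cproj (cyc (mimg r (dsrep π₁ π₂)) ζ) (J2 H₁ H₂ x) = 0 := by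
    constructor
    · intro h
      rw [cproj_zero_iff, inner_J2]
      have : F2 H₁ H₂ (cproj (cyc (mimg r (dsrep π₁ π₂)) ζ) (J2 H₁ H₂ x)) = 0 := h
      rw [this, inner_zero_right]
    · intro h
      change F2 H₁ H₂ (cproj (cyc (mimg r (dsrep π₁ π₂)) ζ) (J2 H₁ H₂ x)) = 0
      rw [h, map_zero]
  rw [h1, cproj_eq_zero, cyc, cyc, mem_span_orth, mem_span_orth]
  have key : ∀ a : 𝔄, ⟪dsrep π₁ π₂ a ζ, J2 H₁ H₂ x⟫ = 0 ↔ ⟪π₂ a (F2 H₁ H₂ ζ), x⟫ = 0 := by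
    intro a
    rw [← inner_conj_symm, inner_J2, F2_rep, inner_conj_symm]
  constructor
  · rintro h _ ⟨_, ⟨a, ha, rfl⟩, rfl⟩
    exact (key a).1 (h _ ⟨_, ⟨a, ha, rfl⟩, rfl⟩)
  · rintro h _ ⟨_, ⟨a, ha, rfl⟩, rfl⟩
    exact (key a).2 (h _ ⟨_, ⟨a, ha, rfl⟩, rfl⟩)

variable {r} (hs : ∀ i, star (r i) = r i)
include hs
lemma hh1_comm (i : I) : Commute (hh1 r π₁ π₂ ζ) (π₁ (r i)) := by
  refine ContinuousLinearMap.ext fun x => ?_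
  have h := congrArg (fun f : _ →L[ℂ] _ => F1 H₁ H₂ (f (J1 H₁ H₂ x)))
    (cyc_comm (mimg_mul r (dsrep π₁ π₂)) (mimg_sa hs _) ζ (mimg_r r (dsrep π₁ π₂) i))
  simp only [mul_apply_eq_comp] at h
  rw [rep_J1, F1_rep] at h
  exact h
lemma hh2_comm (i : I) : Commute (hh2 r π₁ π₂ ζ) (π₂ (r i)) := by
  refine ContinuousLinearMap.ext fun x => ?_
  have h := congrArg (fun f : _ →L[ℂ] _ => F2 H₁ H₂ (f (J2 H₁ H₂ x)))
    (cyc_comm (mimg_mul r (dsrep π₁ π₂)) (mimg_sa hs _) ζ (mimg_r r (dsrep π₁ π₂) i))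
  simp only [mul_apply_eq_comp] at h
  rw [rep_J2, F2_rep] at h
  exact h
end h

variable {K₁ K₂ T₁ T₂ : Type*}
    [NormedAddCommGroup K₁] [InnerProductSpace ℂ K₁] [CompleteSpace K₁]
    [NormedAddCommGroup K₂] [InnerProductSpace ℂ K₂] [CompleteSpace K₂]
    [NormedAddCommGroup T₁] [InnerProductSpace ℂ T₁] [CompleteSpace T₁]
    [NormedAddCommGroup T₂] [InnerProductSpace ℂ T₂] [CompleteSpace T₂]
variable {t₁ : H₁ → K₁ → T₁} {t₂ : H₂ → K₂ → T₂} (ht₁ : IsTensorEmbedding t₁) (ht₂ : IsTensorEmbedding t₂)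
include ht₁ ht₂

omit ht₂ in
lemma mem_ramp {Y : Set (T₁ →L[ℂ] T₂)} (hY : IsWkClosedSubspace Y) (X : T₁ →L[ℂ] T₂) (Z : H₁ →L[ℂ] H₁) :
    Z ∈ hY.sub.comap (rampL ht₁ X) ↔ X ∘L amp ht₁ Z ∈ Y := Iff.rfl
omit ht₁ in
lemma mem_lamp {Y : Set (T₁ →L[ℂ] T₂)} (hY : IsWkClosedSubspace Y) (X : T₁ →L[ℂ] T₂) (Z : H₂ →L[ℂ] H₂) :
    Z ∈ hY.sub.comap (lampL ht₂ X) ↔ amp ht₂ Z ∘L X ∈ Y := Iff.rfl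

lemma Dl_right {r : I → 𝔄} {π₁ : 𝔄 →⋆ₐ[ℂ] (H₁ →L[ℂ] H₁)} {π₂ : 𝔄 →⋆ₐ[ℂ] (H₂ →L[ℂ] H₂)}
    {U : Set (K₁ →L[ℂ] K₂)} {a : H₁ →L[ℂ] H₁} (ha : ∀ i, Commute a (π₁ (r i))) {X : T₁ →L[ℂ] T₂}
    (hX : X ∈ wTensor t₁ t₂ (Dl r π₁ π₂) U) : X ∘L amp ht₁ a ∈ wTensor t₁ t₂ (Dl r π₁ π₂) U := by
  have := wTensor_map ht₁ ht₂ (1 : H₂ →L[ℂ] H₂) a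
    (fun Y hY => Dl_mul (fun i => by simp) ha hY) hX
  rw [map_one] at this
  exact this

lemma Dl_left {r : I → 𝔄} {π₁ : 𝔄 →⋆ₐ[ℂ] (H₁ →L[ℂ] H₁)} {π₂ : 𝔄 →⋆ₐ[ℂ] (H₂ →L[ℂ] H₂)}
    {U : Set (K₁ →L[ℂ] K₂)} {b : H₂ →L[ℂ] H₂} (hb : ∀ i, Commute b (π₂ (r i))) {X : T₁ →L[ℂ] T₂}
    (hX : X ∈ wTensor t₁ t₂ (Dl r π₁ π₂) U) : amp ht₂ b ∘L X ∈ wTensor t₁ t₂ (Dl r π₁ π₂) U := by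
  have := wTensor_map ht₁ ht₂ b (1 : H₁ →L[ℂ] H₁)
    (fun Y hY => Dl_mul hb (fun i => by simp) hY) hX
  rw [map_one] at this
  exact this

lemma Ssig_s1
    {r : I → 𝔄} (hr : ∀ i, r i * r i = r i) (hs : ∀ i, star (r i) = r i)
    (π₁ : 𝔄 →⋆ₐ[ℂ] (H₁ →L[ℂ] H₁)) (π₂ : 𝔄 →⋆ₐ[ℂ] (H₂ →L[ℂ] H₂))
    {U : Set (K₁ →L[ℂ] K₂)} (hU : IsWkClosedSubspace U) {T : T₁ →L[ℂ] T₂}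
    (hT : T ∈ wTensor t₁ t₂ univ U)
    (hTr : ∀ i, amp ht₂ (π₂ (r i)) ∘L T = T ∘L amp ht₁ (π₁ (r i))) (ξ : H₁) (η : H₂) :
    amp ht₂ (cproj (cyc (mimg r π₂) η)) ∘L (T ∘L amp ht₁ (cproj (cyc (mimg r π₁) ξ)))
      ∈ wTensor t₁ t₂ (Dl r π₁ π₂) U := by
  have hY := isWkClosedSubspace_wTensor (t₁ := t₁) (t₂ := t₂) (Dl r π₁ π₂) U
  obtain ⟨ζ, rfl, rfl⟩ : ∃ ζ : WithLp 2 (H₁ × H₂), F1 H₁ H₂ ζ = ξ ∧ F2 H₁ H₂ ζ = η :=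
    ⟨WithLp.toLp 2 (ξ, η), rfl, rfl⟩
  have h0 : (amp ht₂ (hh2 r π₁ π₂ ζ) ∘L T) ∘L amp ht₁ (hh1 r π₁ π₂ ζ) ∈ wTensor t₁ t₂ (Dl r π₁ π₂) U := by
    rw [ContinuousLinearMap.comp_assoc]
    exact Ssig_local ht₁ ht₂ hr hs π₁ π₂ hU hT hTr ζ
  have h1 := ergodic (hh1_norm r π₁ π₂ ζ) _ (bc_ramp ht₁ hY (amp ht₂ (hh2 r π₁ π₂ ζ) ∘L T))
    (fun n => by
      rw [← mul_neg_geom_sum, sub_sub_cancel, mem_ramp, map_mul, ContinuousLinearMap.mul_def,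
        ← ContinuousLinearMap.comp_assoc]
      refine Dl_right ht₁ ht₂ (fun i => ?_) h0
      exact Commute.sum_left _ _ _ fun k _ =>
        ((Commute.one_left _).sub_left (hh1_comm π₁ π₂ ζ hs i)).pow_left k) _ (hh1_ker r π₁ π₂ ζ)
  rw [mem_ramp, ContinuousLinearMap.comp_assoc] at h1
  have h2 := ergodic (hh2_norm r π₁ π₂ ζ) _ (bc_lamp ht₂ hY (T ∘L amp ht₁ (cproj (cyc (mimg r π₁) (F1 H₁ H₂ ζ)))))
    (fun n => by
      rw [← geom_sum_mul_neg, sub_sub_cancel, mem_lamp, map_mul, ContinuousLinearMap.mul_def,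
        ContinuousLinearMap.comp_assoc]
      refine Dl_left ht₁ ht₂ (fun i => ?_) h1
      exact Commute.sum_left _ _ _ fun k _ =>
        ((Commute.one_left _).sub_left (hh2_comm π₁ π₂ ζ hs i)).pow_left k) _ (hh2_ker r π₁ π₂ ζ)
  rwa [mem_lamp] at h2

omit ht₁ ht₂ in
lemma span_top : (Submodule.span ℂ (univ : Set H₁)).topologicalClosure = ⊤ := by
  rw [Submodule.span_univ]; exact top_le_iff.1 (Submodule.le_topologicalClosure _)

theorem Ssig [TopologicalSpace.SeparableSpace H₁] [TopologicalSpace.SeparableSpace H₂]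
    {r : I → 𝔄} (hr : ∀ i, r i * r i = r i) (hs : ∀ i, star (r i) = r i)
    (π₁ : 𝔄 →⋆ₐ[ℂ] (H₁ →L[ℂ] H₁)) (π₂ : 𝔄 →⋆ₐ[ℂ] (H₂ →L[ℂ] H₂))
    {U : Set (K₁ →L[ℂ] K₂)} (hU : IsWkClosedSubspace U) {T : T₁ →L[ℂ] T₂}
    (hT : T ∈ wTensor t₁ t₂ univ U)
    (hTr : ∀ i, amp ht₂ (π₂ (r i)) ∘L T = T ∘L amp ht₁ (π₁ (r i))) :
    T ∈ wTensor t₁ t₂ (Dl r π₁ π₂) U := by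
  have hY := isWkClosedSubspace_wTensor (t₁ := t₁) (t₂ := t₂) (Dl r π₁ π₂) U
  have s2 : ∀ ξ, T ∘L amp ht₁ (cproj (cyc (mimg r π₁) ξ)) ∈ wTensor t₁ t₂ (Dl r π₁ π₂) U := by
    intro ξ
    have := lemG (mimg r π₂) (mimg_one r π₂) (mimg_mul r π₂) (mimg_sa hs π₂)
      (hY.sub.comap (lampL ht₂ (T ∘L amp ht₁ (cproj (cyc (mimg r π₁) ξ))))) (bc_lamp ht₂ hY _) univ
      span_top (fun _ _ _ _ _ => trivial) (fun η _ => by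
        rw [mem_lamp]; exact Ssig_s1 ht₁ ht₂ hr hs π₁ π₂ hU hT hTr ξ η)
    rw [mem_lamp, map_one, ContinuousLinearMap.one_def, ContinuousLinearMap.id_comp] at this
    exact this
  have := lemG (mimg r π₁) (mimg_one r π₁) (mimg_mul r π₁) (mimg_sa hs π₁)
      (hY.sub.comap (rampL ht₁ T)) (bc_ramp ht₁ hY _) univ
      span_top (fun _ _ _ _ _ => trivial) (fun η _ => by rw [mem_ramp]; exact s2 η)
  rw [mem_ramp, map_one, ContinuousLinearMap.one_def, ContinuousLinearMap.comp_id] at this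
  exact this

end P8
end OpSynth


namespace OpSynth

open Filter Topology
open scoped ComplexInnerProductSpace Pointwise ComplexOrder
open Set

noncomputable section P9
set_option linter.all false

variable {H₁ H₂ : Type*}
  [NormedAddCommGroup H₁] [InnerProductSpace ℂ H₁] [CompleteSpace H₁]
  [NormedAddCommGroup H₂] [InnerProductSpace ℂ H₂] [CompleteSpace H₂]
variable {K₁ K₂ T₁ T₂ : Type*}
    [NormedAddCommGroup K₁] [InnerProductSpace ℂ K₁] [CompleteSpace K₁]
    [NormedAddCommGroup K₂] [InnerProductSpace ℂ K₂] [CompleteSpace K₂]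
    [NormedAddCommGroup T₁] [InnerProductSpace ℂ T₁] [CompleteSpace T₁]
    [NormedAddCommGroup T₂] [InnerProductSpace ℂ T₂] [CompleteSpace T₂]
variable {t₁ : H₁ → K₁ → T₁} {t₂ : H₂ → K₂ → T₂} (ht₁ : IsTensorEmbedding t₁) (ht₂ : IsTensorEmbedding t₂)

open scoped IsMulCommutative in
lemma Ssig_masa [TopologicalSpace.SeparableSpace H₁] [TopologicalSpace.SeparableSpace H₂]
    {D₁ : StarSubalgebra ℂ (H₁ →L[ℂ] H₁)} {D₂ : StarSubalgebra ℂ (H₂ →L[ℂ] H₂)}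
    (hD₁ : IsMasa D₁) (hD₂ : IsMasa D₂) {I : Type*} (P : I → (H₁ →L[ℂ] H₁)) (Q : I → (H₂ →L[ℂ] H₂))
    (hP : ∀ i, P i ∈ D₁ ∧ IsStarProjection (P i)) (hQ : ∀ i, Q i ∈ D₂ ∧ IsStarProjection (Q i))
    {U : Set (K₁ →L[ℂ] K₂)} (hU : IsWkClosedSubspace U) {T : T₁ →L[ℂ] T₂}
    (hT : T ∈ wTensor t₁ t₂ univ U)
    (hTr : ∀ i, amp ht₂ (Q i) ∘L T = T ∘L amp ht₁ (P i)) :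
    T ∈ wTensor t₁ t₂ {X | ∀ i, Q i ∘L X = X ∘L P i} U := by
  classical
  haveI : IsMulCommutative D₁ := ⟨⟨fun a b => Subtype.ext (hD₁.1 a a.2 b b.2)⟩⟩
  haveI : IsMulCommutative D₂ := ⟨⟨fun a b => Subtype.ext (hD₂.1 a a.2 b b.2)⟩⟩
  have := Ssig (𝔄 := D₁ × D₂) (r := fun i => (⟨P i, (hP i).1⟩, ⟨Q i, (hQ i).1⟩)) ht₁ ht₂
    (fun i => Prod.ext (Subtype.ext (hP i).2.isIdempotentElem.eq) (Subtype.ext (hQ i).2.isIdempotentElem.eq))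
    (fun i => Prod.ext (Subtype.ext (hP i).2.isSelfAdjoint.star_eq) (Subtype.ext (hQ i).2.isSelfAdjoint.star_eq))
    (D₁.subtype.comp (StarAlgHom.fst ℂ D₁ D₂)) (D₂.subtype.comp (StarAlgHom.snd ℂ D₁ D₂)) hU hT hTr
  exact this

/-- sandwich -/
def sw (b : H₂ →L[ℂ] H₂) (a : H₁ →L[ℂ] H₁) (T : T₁ →L[ℂ] T₂) : T₁ →L[ℂ] T₂ := amp ht₂ b ∘L T ∘L amp ht₁ a

/-- intertwining -/
def dg (b : H₂ →L[ℂ] H₂) (a : H₁ →L[ℂ] H₁) (T : T₁ →L[ℂ] T₂) : Prop := amp ht₂ b ∘L T = T ∘L amp ht₁ a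

lemma sw_sw (b q : H₂ →L[ℂ] H₂) (a p : H₁ →L[ℂ] H₁) (T : T₁ →L[ℂ] T₂) :
    sw ht₁ ht₂ b a (sw ht₁ ht₂ q p T) = sw ht₁ ht₂ (b * q) (p * a) T := by
  unfold sw; rw [map_mul, map_mul, ContinuousLinearMap.mul_def, ContinuousLinearMap.mul_def]; simp only [ContinuousLinearMap.comp_assoc]

lemma sw_add (b : H₂ →L[ℂ] H₂) (a : H₁ →L[ℂ] H₁) (T T' : T₁ →L[ℂ] T₂) :
    sw ht₁ ht₂ b a (T + T') = sw ht₁ ht₂ b a T + sw ht₁ ht₂ b a T' := by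
  unfold sw; ext x; simp

lemma dg_sw {b q : H₂ →L[ℂ] H₂} {a p : H₁ →L[ℂ] H₁} {T : T₁ →L[ℂ] T₂} (hb : b * q = q * b) (ha : a * p = p * a)
    (h : dg ht₁ ht₂ b a T) : dg ht₁ ht₂ b a (sw ht₁ ht₂ q p T) := by
  unfold dg sw at *
  have e1 : amp ht₂ b ∘L amp ht₂ q = amp ht₂ q ∘L amp ht₂ b := by
    have := congrArg (amp ht₂) hb; rw [map_mul, map_mul, ContinuousLinearMap.mul_def, ContinuousLinearMap.mul_def] at this; exact this
  have e2 : amp ht₁ a ∘L amp ht₁ p = amp ht₁ p ∘L amp ht₁ a := by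
    have := congrArg (amp ht₁) ha; rw [map_mul, map_mul, ContinuousLinearMap.mul_def, ContinuousLinearMap.mul_def] at this; exact this
  rw [← ContinuousLinearMap.comp_assoc, e1, ContinuousLinearMap.comp_assoc,
    ← ContinuousLinearMap.comp_assoc _ T, h, ContinuousLinearMap.comp_assoc, e2]
  simp only [ContinuousLinearMap.comp_assoc]

lemma dg_add {b : H₂ →L[ℂ] H₂} {a : H₁ →L[ℂ] H₁} {T T' : T₁ →L[ℂ] T₂}
    (h : dg ht₁ ht₂ b a T) (h' : dg ht₁ ht₂ b a T') : dg ht₁ ht₂ b a (T + T') := by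
  unfold dg at *
  rw [ContinuousLinearMap.comp_add, ContinuousLinearMap.add_comp, h, h']

/-- diagonal compression -/
def Dm (Q : H₂ →L[ℂ] H₂) (P : H₁ →L[ℂ] H₁) (T : T₁ →L[ℂ] T₂) : T₁ →L[ℂ] T₂ :=
  sw ht₁ ht₂ Q P T + sw ht₁ ht₂ (1 - Q) (1 - P) T

lemma Dm_sub (Q : H₂ →L[ℂ] H₂) (P : H₁ →L[ℂ] H₁) (T : T₁ →L[ℂ] T₂) :
    T - Dm ht₁ ht₂ Q P T = sw ht₁ ht₂ Q (1 - P) T + sw ht₁ ht₂ (1 - Q) P T := by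
  unfold Dm sw
  rw [map_sub, map_sub, map_one, map_one]
  ext x
  simp
  abel

lemma Dm_norm {Q : H₂ →L[ℂ] H₂} {P : H₁ →L[ℂ] H₁} (hP : IsStarProjection P) (hQ : IsStarProjection Q)
    (T : T₁ →L[ℂ] T₂) : ‖Dm ht₁ ht₂ Q P T‖ ≤ ‖T‖ := by
  have := lemO (Finset.univ : Finset Bool) (fun b => cond b (amp ht₁ P) (amp ht₁ (1 - P)))
    (fun b => cond b (amp ht₂ Q) (amp ht₂ (1 - Q))) (fun _ => T)
    (fun b _ => ?_) (fun b _ => ?_) ?_ ?_ (norm_nonneg T) (fun _ _ => le_rfl)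
  · rw [Fintype.sum_bool] at this
    exact this
  · cases b
    · exact hP.one_sub.map (amp ht₁)
    · exact hP.map (amp ht₁)
  · cases b
    · exact hQ.one_sub.map (amp ht₂)
    · exact hQ.map (amp ht₂)
  · rw [Fintype.sum_bool]; simp
  · rw [Fintype.sum_bool]; simp

lemma sw_zero_left (a : H₁ →L[ℂ] H₁) (T : T₁ →L[ℂ] T₂) : sw ht₁ ht₂ 0 a T = 0 := by
  unfold sw; rw [map_zero]; ext; simp
lemma sw_zero_right (a : H₂ →L[ℂ] H₂) (T : T₁ →L[ℂ] T₂) : sw ht₁ ht₂ a 0 T = 0 := by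
  unfold sw; rw [map_zero]; ext; simp

lemma dg_iff (b : H₂ →L[ℂ] H₂) (a : H₁ →L[ℂ] H₁) (T : T₁ →L[ℂ] T₂) :
    dg ht₁ ht₂ b a T ↔ sw ht₁ ht₂ b 1 T = sw ht₁ ht₂ 1 a T := by
  unfold dg sw; rw [map_one, map_one, ContinuousLinearMap.one_def, ContinuousLinearMap.one_def, ContinuousLinearMap.comp_id, ContinuousLinearMap.id_comp]

lemma dg_Dm {Q : H₂ →L[ℂ] H₂} {P : H₁ →L[ℂ] H₁} (hP : IsStarProjection P) (hQ : IsStarProjection Q)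
    (T : T₁ →L[ℂ] T₂) : dg ht₁ ht₂ Q P (Dm ht₁ ht₂ Q P T) := by
  rw [dg_iff]
  unfold Dm
  simp only [sw_add, sw_sw, mul_sub, sub_mul, hP.isIdempotentElem.eq, hQ.isIdempotentElem.eq, mul_one, one_mul,
    sub_self, sw_zero_left, sw_zero_right]

lemma wkClosed_dg (b : H₂ →L[ℂ] H₂) (a : H₁ →L[ℂ] H₁) : WkClosed {T : T₁ →L[ℂ] T₂ | dg ht₁ ht₂ b a T} := by
  have := wkClosed_eq (amp ht₂ b) 1 (1 : T₁ →L[ℂ] T₁) (amp ht₁ a)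
  simp only [ContinuousLinearMap.one_def, ContinuousLinearMap.comp_id, ContinuousLinearMap.id_comp] at this
  unfold dg
  exact this

lemma wkClosed_sw (b : H₂ →L[ℂ] H₂) (a : H₁ →L[ℂ] H₁) : WkClosed {T : T₁ →L[ℂ] T₂ | sw ht₁ ht₂ b a T = T} := by
  have := wkClosed_eq (amp ht₂ b) 1 (amp ht₁ a) (1 : T₁ →L[ℂ] T₁)
  simp only [ContinuousLinearMap.one_def, ContinuousLinearMap.comp_id, ContinuousLinearMap.id_comp] at this
  unfold sw
  exact this

lemma sw_wTensor {V V' : Set (H₁ →L[ℂ] H₂)} {U : Set (K₁ →L[ℂ] K₂)} {b : H₂ →L[ℂ] H₂} {a : H₁ →L[ℂ] H₁}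
    (h : ∀ X ∈ V, b ∘L X ∘L a ∈ V') {T} (hT : T ∈ wTensor t₁ t₂ V U) :
    sw ht₁ ht₂ b a T ∈ wTensor t₁ t₂ V' U := wTensor_map ht₁ ht₂ b a h hT

lemma sw_Fubini {V V' : Set (H₁ →L[ℂ] H₂)} {U : Set (K₁ →L[ℂ] K₂)} {b : H₂ →L[ℂ] H₂} {a : H₁ →L[ℂ] H₁}
    (h : ∀ X ∈ V, b ∘L X ∘L a ∈ V') {T} (hT : T ∈ Fubini t₁ t₂ V U) :
    sw ht₁ ht₂ b a T ∈ Fubini t₁ t₂ V' U :=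
  ⟨sw_wTensor ht₁ ht₂ h hT.1, sw_wTensor ht₁ ht₂ (V' := univ) (fun _ _ => mem_univ _) hT.2⟩

lemma Fubini_sub (V : Set (H₁ →L[ℂ] H₂)) (U : Set (K₁ →L[ℂ] K₂)) : IsWkClosedSubspace (Fubini t₁ t₂ V U) := by
  have h1 := isWkClosedSubspace_wTensor (t₁ := t₁) (t₂ := t₂) V univ
  have h2 := isWkClosedSubspace_wTensor (t₁ := t₁) (t₂ := t₂) univ U
  exact ⟨⟨h1.sub ⊓ h2.sub, rfl⟩, h1.2.inter h2.2⟩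

end P9
end OpSynth


namespace OpSynth

open Filter Topology
open scoped ComplexInnerProductSpace Pointwise ComplexOrder
open Set

noncomputable section P10
set_option linter.all false

lemma cpt_fam {H K : Type*} [NormedAddCommGroup H] [InnerProductSpace ℂ H] [CompleteSpace H]
    [NormedAddCommGroup K] [InnerProductSpace ℂ K] [CompleteSpace K]
    {ι : Type*} {C : Set (H →L[ℂ] K)} (hC : WkClosed C) {r : ℝ}
    (Dg : ι → Set (H →L[ℂ] K)) (hDg : ∀ i, WkClosed (Dg i)) (hne : ∃ T ∈ C, ‖T‖ ≤ r)
    (step : ∀ i, ∀ T ∈ C, ‖T‖ ≤ r → ∃ T' ∈ C, ‖T'‖ ≤ r ∧ T' ∈ Dg i ∧ ∀ i', T ∈ Dg i' → T' ∈ Dg i') :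
    ∃ T ∈ C, ∀ i, T ∈ Dg i := by
  classical
  have hr : 0 ≤ r := by obtain ⟨T, _, h⟩ := hne; exact (norm_nonneg _).trans h
  have hfin : ∀ s : Finset ι, ∃ T ∈ C, ‖T‖ ≤ r ∧ ∀ i ∈ s, T ∈ Dg i := by
    intro s
    induction s using Finset.induction_on with
    | empty => obtain ⟨T, h1, h2⟩ := hne; exact ⟨T, h1, h2, by simp⟩
    | insert a s ha ih =>
      obtain ⟨T, h1, h2, h3⟩ := ih
      obtain ⟨T', g1, g2, g3, g4⟩ := step a T h1 h2
      refine ⟨T', g1, g2, fun i hi => ?_⟩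
      rcases Finset.mem_insert.1 hi with rfl | hi
      · exact g3
      · exact g4 _ (h3 i hi)
  have hcp : @IsCompact _ (sigmaWeak H K) ({X : H →L[ℂ] K | ‖X‖ ≤ r} ∩ C) :=
    @IsCompact.inter_right _ (sigmaWeak H K) _ _ (wk_compact_ball r hr) hC
  obtain ⟨T, hT, hT'⟩ := @IsCompact.inter_iInter_nonempty _ (sigmaWeak H K) _ ι hcp Dg hDg (fun s => by
    obtain ⟨T, h1, h2, h3⟩ := hfin s
    exact ⟨T, ⟨h2, h1⟩, mem_iInter₂.2 h3⟩)
  exact ⟨T, hT.2, fun i => mem_iInter.1 hT' i⟩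

variable {H₁ H₂ : Type*}
  [NormedAddCommGroup H₁] [InnerProductSpace ℂ H₁] [CompleteSpace H₁]
  [NormedAddCommGroup H₂] [InnerProductSpace ℂ H₂] [CompleteSpace H₂]
variable {K₁ K₂ T₁ T₂ : Type*}
    [NormedAddCommGroup K₁] [InnerProductSpace ℂ K₁] [CompleteSpace K₁]
    [NormedAddCommGroup K₂] [InnerProductSpace ℂ K₂] [CompleteSpace K₂]
    [NormedAddCommGroup T₁] [InnerProductSpace ℂ T₁] [CompleteSpace T₁]
    [NormedAddCommGroup T₂] [InnerProductSpace ℂ T₂] [CompleteSpace T₂]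
variable {t₁ : H₁ → K₁ → T₁} {t₂ : H₂ → K₂ → T₂} (ht₁ : IsTensorEmbedding t₁) (ht₂ : IsTensorEmbedding t₂)

lemma sw_comm {b q : H₂ →L[ℂ] H₂} {a p : H₁ →L[ℂ] H₁} (T : T₁ →L[ℂ] T₂) (hb : b * q = q * b) (ha : a * p = p * a) :
    sw ht₁ ht₂ b a (sw ht₁ ht₂ q p T) = sw ht₁ ht₂ q p (sw ht₁ ht₂ b a T) := by
  rw [sw_sw, sw_sw, hb, ha]

lemma sw_one (T : T₁ →L[ℂ] T₂) : sw ht₁ ht₂ 1 1 T = T := by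
  unfold sw
  rw [map_one, map_one, ContinuousLinearMap.one_def, ContinuousLinearMap.one_def, ContinuousLinearMap.comp_id, ContinuousLinearMap.id_comp]

lemma assoc4 (b q : H₂ →L[ℂ] H₂) (p a : H₁ →L[ℂ] H₁) (X : H₁ →L[ℂ] H₂) :
    (b * q) ∘L X ∘L (p * a) = b ∘L (q ∘L X ∘L p) ∘L a := by
  rw [ContinuousLinearMap.mul_def, ContinuousLinearMap.mul_def]; simp only [ContinuousLinearMap.comp_assoc]

section Ind

variable [TopologicalSpace.SeparableSpace H₁] [TopologicalSpace.SeparableSpace H₂]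
    {D₁ : StarSubalgebra ℂ (H₁ →L[ℂ] H₁)} {D₂ : StarSubalgebra ℂ (H₂ →L[ℂ] H₂)}
    (hD₁ : IsMasa D₁) (hD₂ : IsMasa D₂)
    {V C : Set (H₁ →L[ℂ] H₂)} {k : ℕ} {Bs : Fin k → Set (H₁ →L[ℂ] H₂)}
    (hBs : ∀ j, IsMasaBimodule D₁ D₂ (Bs j))
    {U : Set (K₁ →L[ℂ] K₂)} (hU : IsWkClosedSubspace U)
    (hVC : V ⊆ C) (hBC : (⋂ j, Bs j) ⊆ C)
    (hC : ∀ X ∈ C, ∀ A ∈ D₁, ∀ B ∈ D₂, B ∘L X ∘L A ∈ C)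
    (hF : Fubini t₁ t₂ V U = wTensor t₁ t₂ V U)
    {I : Fin k → Set (Submodule ℂ H₁)} {P : ∀ j, I j → (H₁ →L[ℂ] H₁)} {Q : ∀ j, I j → (H₂ →L[ℂ] H₂)}
    (hP : ∀ j i, P j i ∈ D₁ ∧ IsStarProjection (P j i)) (hQ : ∀ j i, Q j i ∈ D₂ ∧ IsStarProjection (Q j i))
    (hS : ∀ j i, ∀ X ∈ C, (1 - Q j i) ∘L X ∘L P j i ∈ V)
    (hL : ∀ j i X, Q j i ∘L X ∘L (1 - P j i) ∈ Bs j)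
    (hDl : ∀ j X, (∀ i, Q j i ∘L X = X ∘L P j i) → X ∈ Bs j)

include hD₁ hD₂ hBs hU hBC hP hQ hDl in
lemma ind_base (T : T₁ →L[ℂ] T₂) (a : H₁ →L[ℂ] H₁) (b : H₂ →L[ℂ] H₂)
    (hT : T ∈ Fubini t₁ t₂ C U) (ha : a ∈ D₁) (hb : b ∈ D₂) (hab : sw ht₁ ht₂ b a T = T)
    (h : ∀ j, (∀ X, b ∘L X ∘L a ∈ Bs j) ∨ (∀ i, dg ht₁ ht₂ (Q j i) (P j i) T)) :
    T ∈ wTensor t₁ t₂ C U := by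
  have h1 := Ssig_masa ht₁ ht₂ hD₁ hD₂ (I := Σ j : {j // ∀ i, dg ht₁ ht₂ (Q j i) (P j i) T}, I j.1)
    (fun x => P x.1.1 x.2) (fun x => Q x.1.1 x.2) (fun x => hP _ _) (fun x => hQ _ _) hU hT.2
    (fun x => x.1.2 x.2)
  rw [← hab]
  refine sw_wTensor ht₁ ht₂ (fun X hX => hBC (mem_iInter.2 fun j => ?_)) h1
  rcases h j with h | h
  · exact h X
  · exact (hBs j).2 X (hDl j X fun i => hX ⟨⟨j, h⟩, i⟩) a ha b hb

include hD₁ hD₂ hBs hU hBC hP hQ hDl hL hS hVC hF hC in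
lemma ind_step (s : Finset (Fin k)) : ∀ (T : T₁ →L[ℂ] T₂) (a : H₁ →L[ℂ] H₁) (b : H₂ →L[ℂ] H₂)
    (hT : T ∈ Fubini t₁ t₂ C U) (ha : a ∈ D₁) (hb : b ∈ D₂) (hab : sw ht₁ ht₂ b a T = T)
    (h : ∀ j, j ∉ s → (∀ X, b ∘L X ∘L a ∈ Bs j) ∨ (∀ i, dg ht₁ ht₂ (Q j i) (P j i) T)),
    T ∈ wTensor t₁ t₂ C U := by
  classical
  induction s using Finset.induction_on with
  | empty =>
    intro T a b hT ha hb hab h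
    exact ind_base ht₁ ht₂ hD₁ hD₂ hBs hU hBC hP hQ hDl T a b hT ha hb hab (fun j => h j (Finset.notMem_empty j))
  | insert j s hj ih =>
    intro T a b hT ha hb hab h
    have hW := isWkClosedSubspace_wTensor (t₁ := t₁) (t₂ := t₂) C U
    have hFu := Fubini_sub (t₁ := t₁) (t₂ := t₂) C U
    have sadd : ∀ {x y}, x ∈ wTensor t₁ t₂ C U → y ∈ wTensor t₁ t₂ C U → x + y ∈ wTensor t₁ t₂ C U :=
      fun hx hy => hW.sub.add_mem hx hy
    set E : Set (T₁ →L[ℂ] T₂) := {T' | T' - T ∈ wTensor t₁ t₂ C U} ∩ Fubini t₁ t₂ C U ∩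
      {T' | sw ht₁ ht₂ b a T' = T'} ∩
      (⋂ j', ⋂ i', ⋂ (_ : ∀ i, dg ht₁ ht₂ (Q j' i) (P j' i) T), {T' | dg ht₁ ht₂ (Q j' i') (P j' i') T'}) with hE
    have hEc : WkClosed E := by
      refine WkClosed.inter (WkClosed.inter (WkClosed.inter ?_ hFu.2) (wkClosed_sw ht₁ ht₂ b a)) ?_
      · have := hW.2.preim (wk_cont_add_right (-T))
        simp only [← sub_eq_add_neg] at this
        exact this
      · exact @isClosed_iInter _ _ (sigmaWeak T₁ T₂) _ fun j' => @isClosed_iInter _ _ (sigmaWeak T₁ T₂) _ fun i' =>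
          @isClosed_iInter _ _ (sigmaWeak T₁ T₂) _ fun _ => wkClosed_dg ht₁ ht₂ _ _
    have c1 : ∀ x ∈ D₁, ∀ j i, x * P j i = P j i * x := fun x hx j i => hD₁.1 x hx _ (hP j i).1
    have c2 : ∀ x ∈ D₂, ∀ j i, x * Q j i = Q j i * x := fun x hx j i => hD₂.1 x hx _ (hQ j i).1
    have m1 : ∀ j i, 1 - P j i ∈ D₁ := fun j i => sub_mem (one_mem _) (hP j i).1
    have m2 : ∀ j i, 1 - Q j i ∈ D₂ := fun j i => sub_mem (one_mem _) (hQ j i).1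
    have key : ∀ i, ∀ T' ∈ E, Dm ht₁ ht₂ (Q j i) (P j i) T' ∈ E := by
      rintro i T' ⟨⟨⟨e1, e2⟩, e3⟩, e4⟩
      have e3' : sw ht₁ ht₂ b a T' = T' := e3
      have e4' : ∀ j', (∀ i, dg ht₁ ht₂ (Q j' i) (P j' i) T) → ∀ i', dg ht₁ ht₂ (Q j' i') (P j' i') T' := by
        intro j' hj' i'
        exact mem_iInter.1 (mem_iInter.1 (mem_iInter.1 e4 j') i') hj'
      have swF : ∀ q ∈ D₂, ∀ p ∈ D₁, sw ht₁ ht₂ q p T' ∈ Fubini t₁ t₂ C U :=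
        fun q hq p hp => sw_Fubini ht₁ ht₂ (fun X hX => hC X hX p hp q hq) e2
      have swdg : ∀ q ∈ D₂, ∀ p ∈ D₁, ∀ j', (∀ i, dg ht₁ ht₂ (Q j' i) (P j' i) T) → ∀ i',
          dg ht₁ ht₂ (Q j' i') (P j' i') (sw ht₁ ht₂ q p T') :=
        fun q hq p hp j' hj' i' => dg_sw ht₁ ht₂ (c2 q hq _ _).symm (c1 p hp _ _).symm (e4' j' hj' i')
      have swab : ∀ q ∈ D₂, ∀ p ∈ D₁, sw ht₁ ht₂ b a (sw ht₁ ht₂ q p T') = sw ht₁ ht₂ q p T' := by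
        intro q hq p hp
        rw [sw_comm ht₁ ht₂ T' (hD₂.1 b hb q hq) (hD₁.1 a ha p hp), e3']
      have A1 : sw ht₁ ht₂ (Q j i) (1 - P j i) T' ∈ wTensor t₁ t₂ C U := by
        refine ih _ ((1 - P j i) * a) (b * Q j i) (swF _ (hQ j i).1 _ (m1 j i)) (mul_mem (m1 j i) ha)
          (mul_mem hb (hQ j i).1) ?_ ?_
        · rw [← sw_sw, sw_sw _ _ (Q j i), (hQ j i).2.isIdempotentElem.eq, (hP j i).2.one_sub.isIdempotentElem.eq]
          exact swab _ (hQ j i).1 _ (m1 j i)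
        · intro j' hj'
          by_cases hjj : j' = j
          · subst hjj
            left
            intro X
            rw [assoc4]
            exact (hBs j').2 _ (hL j' i X) a ha b hb
          · rcases h j' (by simp [hjj, hj']) with h | h
            · left
              intro X
              rw [assoc4]
              exact h _
            · right
              exact swdg _ (hQ j i).1 _ (m1 j i) j' h
      have A2 : sw ht₁ ht₂ (1 - Q j i) (P j i) T' ∈ wTensor t₁ t₂ C U := by
        have : sw ht₁ ht₂ (1 - Q j i) (P j i) T' ∈ Fubini t₁ t₂ V U :=
          sw_Fubini ht₁ ht₂ (fun X hX => hS j i X hX) e2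
        rw [hF] at this
        exact wTensor_mono hVC (subset_refl _) this
      refine ⟨⟨⟨?_, ?_⟩, ?_⟩, ?_⟩
      · have h3 : T' - Dm ht₁ ht₂ (Q j i) (P j i) T' ∈ wTensor t₁ t₂ C U := by
          rw [Dm_sub]; exact sadd A1 A2
        have h4 := hW.sub.sub_mem e1 h3
        have : T' - T - (T' - Dm ht₁ ht₂ (Q j i) (P j i) T') = Dm ht₁ ht₂ (Q j i) (P j i) T' - T := by abel
        rw [this] at h4
        exact h4
      · exact hFu.sub.add_mem (swF _ (hQ j i).1 _ (hP j i).1) (swF _ (m2 j i) _ (m1 j i))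
      · show sw ht₁ ht₂ b a (Dm ht₁ ht₂ (Q j i) (P j i) T') = Dm ht₁ ht₂ (Q j i) (P j i) T'
        unfold Dm
        rw [sw_add, swab _ (hQ j i).1 _ (hP j i).1, swab _ (m2 j i) _ (m1 j i)]
      · refine mem_iInter.2 fun j' => mem_iInter.2 fun i' => mem_iInter.2 fun hj' => ?_
        exact dg_add ht₁ ht₂ (swdg _ (hQ j i).1 _ (hP j i).1 j' hj' i') (swdg _ (m2 j i) _ (m1 j i) j' hj' i')
    obtain ⟨R, hR, hRd⟩ := cpt_fam hEc (r := ‖T‖) (fun i : I j => {T' | dg ht₁ ht₂ (Q j i) (P j i) T'})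
      (fun i => wkClosed_dg ht₁ ht₂ _ _)
      ⟨T, ⟨⟨⟨by
        show T - T ∈ wTensor t₁ t₂ C U
        rw [sub_self]; exact hW.sub.zero_mem, hT⟩, hab⟩,
        mem_iInter.2 fun j' => mem_iInter.2 fun i' => mem_iInter.2 fun hj' => hj' i'⟩, le_rfl⟩
      (fun i T' hT' hn => ⟨Dm ht₁ ht₂ (Q j i) (P j i) T', key i T' hT',
        (Dm_norm ht₁ ht₂ (hP j i).2 (hQ j i).2 T').trans hn, dg_Dm ht₁ ht₂ (hP j i).2 (hQ j i).2 T',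
        fun i' hi' => dg_add ht₁ ht₂
          (dg_sw ht₁ ht₂ (c2 _ (hQ j i).1 _ _).symm (c1 _ (hP j i).1 _ _).symm hi')
          (dg_sw ht₁ ht₂ (c2 _ (m2 j i) _ _).symm (c1 _ (m1 j i) _ _).symm hi')⟩)
    obtain ⟨⟨⟨e1, e2⟩, e3⟩, e4⟩ := hR
    have hRS : R ∈ wTensor t₁ t₂ C U := by
      refine ih R a b e2 ha hb e3 fun j' hj' => ?_
      by_cases hjj : j' = j
      · subst hjj; exact Or.inr hRd
      · rcases h j' (by simp [hjj, hj']) with h | h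
        · exact Or.inl h
        · right
          intro i'
          exact mem_iInter.1 (mem_iInter.1 (mem_iInter.1 e4 j') i') h
    have h4 := hW.sub.sub_mem hRS e1
    rw [sub_sub_cancel] at h4
    exact h4

end Ind

theorem main5 (ht₁ : IsTensorEmbedding t₁) (ht₂ : IsTensorEmbedding t₂) [TopologicalSpace.SeparableSpace H₁] [TopologicalSpace.SeparableSpace H₂]
    {D₁ : StarSubalgebra ℂ (H₁ →L[ℂ] H₁)} {D₂ : StarSubalgebra ℂ (H₂ →L[ℂ] H₂)}
    (hD₁ : IsMasa D₁) (hD₂ : IsMasa D₂)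
    {V B : Set (H₁ →L[ℂ] H₂)}
    (hV : IsMasaBimodule D₁ D₂ V) (hB : HasFiniteWidth D₁ D₂ B)
    {U : Set (K₁ →L[ℂ] K₂)} (hU : IsWkClosedSubspace U)
    (hF : Fubini t₁ t₂ V U = wTensor t₁ t₂ V U) :
    Fubini t₁ t₂ (wkClosure (V + B)) U = wTensor t₁ t₂ (wkClosure (V + B)) U := by
  obtain ⟨k, Bs, hBs, rfl⟩ := hB
  have hz : ∀ j, (0 : H₁ →L[ℂ] H₂) ∈ Bs j := fun j => (hBs j).1.1.sub.zero_mem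
  have hVC : V ⊆ wkClosure (V + ⋂ j, Bs j) := fun X hX => subset_wkClosure _
    ⟨X, hX, 0, mem_iInter.2 hz, add_zero X⟩
  have hBC : (⋂ j, Bs j) ⊆ wkClosure (V + ⋂ j, Bs j) := fun X hX => subset_wkClosure _
    ⟨0, hV.1.sub.zero_mem, X, hX, zero_add X⟩
  have hC : ∀ X ∈ wkClosure (V + ⋂ j, Bs j), ∀ A ∈ D₁, ∀ B ∈ D₂, B ∘L X ∘L A ∈ wkClosure (V + ⋂ j, Bs j) := by
    intro X hX A hA B hB
    refine wkClosure_map (wk_cont_mul B A) ?_ (wkClosed_wkClosure _) hX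
    rintro _ ⟨v, hv, w, hw, rfl⟩
    refine subset_wkClosure _ ⟨B ∘L v ∘L A, hV.2 v hv A hA B hB, B ∘L w ∘L A,
      mem_iInter.2 fun j => (hBs j).1.2 w (mem_iInter.1 hw j) A hA B hB, ?_⟩
    ext x; simp
  choose I P Q hP hQ h0 hL hDl using fun j => nest_lemma hD₁ hD₂ (hBs j).1 (hBs j).2
  have hS : ∀ j i, ∀ X ∈ wkClosure (V + ⋂ j, Bs j), (1 - Q j i) ∘L X ∘L P j i ∈ V := by
    intro j i X hX
    refine wkClosure_map (wk_cont_mul (1 - Q j i) (P j i)) ?_ hV.1.2 hX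
    rintro _ ⟨v, hv, w, hw, rfl⟩
    have e : (1 - Q j i) ∘L (v + w) ∘L P j i = (1 - Q j i) ∘L v ∘L P j i + (1 - Q j i) ∘L w ∘L P j i := by
      rw [ContinuousLinearMap.add_comp, ContinuousLinearMap.comp_add]
    have : (1 - Q j i) ∘L (v + w) ∘L P j i ∈ V := by
      rw [e, h0 j i w (mem_iInter.1 hw j), add_zero]
      exact hV.2 v hv _ (hP j i).1 _ (sub_mem (one_mem _) (hQ j i).1)
    exact this
  refine Subset.antisymm (fun T hT => ?_) (fun T hT => ⟨wTensor_mono (subset_refl _) (subset_univ _) hT,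
    wTensor_mono (subset_univ _) (subset_refl _) hT⟩)
  exact ind_step ht₁ ht₂ hD₁ hD₂ (fun j => (hBs j).1) hU hVC hBC hC hF hP hQ hS hL hDl Finset.univ T 1 1 hT
    (one_mem _) (one_mem _) (sw_one ht₁ ht₂ T) (fun j hj => absurd (Finset.mem_univ j) hj)

end P10
end OpSynth




open scoped ComplexInnerProductSpace Pointwise
open Set OpSynth

/-- Theorem `th_sump`. -/
theorem statement5
    {H₁ H₂ K₁ K₂ T₁ T₂ : Type*}
    [NormedAddCommGroup H₁] [InnerProductSpace ℂ H₁] [CompleteSpace H₁]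
    [NormedAddCommGroup H₂] [InnerProductSpace ℂ H₂] [CompleteSpace H₂]
    [NormedAddCommGroup K₁] [InnerProductSpace ℂ K₁] [CompleteSpace K₁]
    [NormedAddCommGroup K₂] [InnerProductSpace ℂ K₂] [CompleteSpace K₂]
    [NormedAddCommGroup T₁] [InnerProductSpace ℂ T₁] [CompleteSpace T₁]
    [NormedAddCommGroup T₂] [InnerProductSpace ℂ T₂] [CompleteSpace T₂]
    [TopologicalSpace.SeparableSpace H₁] [TopologicalSpace.SeparableSpace H₂]
    (D₁ : StarSubalgebra ℂ (H₁ →L[ℂ] H₁)) (D₂ : StarSubalgebra ℂ (H₂ →L[ℂ] H₂))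
    (hD₁ : IsMasa D₁) (hD₂ : IsMasa D₂)
    (V B : Set (H₁ →L[ℂ] H₂))
    (hV : IsMasaBimodule D₁ D₂ V) (hB : HasFiniteWidth D₁ D₂ B)
    (U : Set (K₁ →L[ℂ] K₂)) (hU : IsWkClosedSubspace U)
    (t₁ : H₁ → K₁ → T₁) (t₂ : H₂ → K₂ → T₂)
    (ht₁ : IsTensorEmbedding t₁) (ht₂ : IsTensorEmbedding t₂) :
    (Fubini t₁ t₂ V U = wTensor t₁ t₂ V U →
      Fubini t₁ t₂ (wkClosure (V + B)) U = wTensor t₁ t₂ (wkClosure (V + B)) U) ∧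
    (HasSsigma V → HasSsigma (wkClosure (V + B))) := by
  exact ⟨fun h => main5 ht₁ ht₂ hD₁ hD₂ hV hB hU h,
    fun h K₁ K₂ T₁ T₂ _ _ _ _ _ _ _ _ _ _ _ _ t₁ t₂ ht₁ ht₂ U hU =>
      main5 ht₁ ht₂ hD₁ hD₂ hV hB hU (h K₁ K₂ T₁ T₂ t₁ t₂ ht₁ ht₂ U hU)⟩
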